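/- arXiv:2503.05548 — 6 statements merged into one kernel-verified Lean document; each statement's English description precedes it below -/
import Mathlib

section
/- Let m, n ≥ 1, let M ∈ {0,1}^{m×n} be the incidence matrix of a simple graph and let c ∈ ℤ^n. Then the function f_{c,M} is SBO jump M-convex: for every z^(1), z^(2) ∈ ℤ^m with f_{c,M}(z^(1)) < +∞ and f_{c,M}(z^(2)) < +∞, there exist a 2-step decomposition p^(1), …, p^(ℓ) of z^(2) − z^(1) and real numbers g^(1), …, g^(ℓ) such that f_{c,M}(z^(2)) = f_{c,M}(z^(1)) + Σ_{k=1}^ℓ g^(k), and for every subset I ⊆ {1, …, ℓ} it holds that f_{c,M}(z^(1) + Σ_{k∈I} p^(k)) ≤ f_{c,M}(z^(1)) + Σ_{k∈I} g^(k). -/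
open Matrix BigOperators

/-- `M` is the (vertex–edge) incidence matrix of a simple graph. -/
def IsIncidenceOfSimpleGraph {m n : ℕ} (M : Matrix (Fin m) (Fin n) ℤ) : Prop :=
  (∀ i j, M i j = 0 ∨ M i j = 1) ∧
  (∀ j, (Finset.univ.filter (fun i => M i j = 1)).card = 2) ∧
  (∀ j j' : Fin n, (∀ i, M i j = M i j') → j = j')

/-- `fcost M c z = min { cᵀx : Mx = z, x ∈ ℤⁿ, x ≥ 0 }`, `+∞` if infeasible. -/
noncomputable def fcost {m n : ℕ} (M : Matrix (Fin m) (Fin n) ℤ) (c : Fin n → ℤ)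
    (z : Fin m → ℤ) : EReal :=
  sInf {w : EReal | ∃ x : Fin n → ℤ, (∀ j, 0 ≤ x j) ∧ M.mulVec x = z ∧
    w = (((c ⬝ᵥ x : ℤ) : ℝ) : EReal)}

/-- `x ⊑ y`: `x` is conformal to `y`, i.e. `|xᵢ| ≤ |yᵢ|` and `xᵢ·yᵢ ≥ 0` for all `i`. -/
def ConformalTo {m : ℕ} (x y : Fin m → ℤ) : Prop :=
  ∀ i, |x i| ≤ |y i| ∧ 0 ≤ x i * y i

/-- A 2-step decomposition of `d`: steps `p 1, …, p ℓ` with `‖p k‖₁ = 2`, `p k ⊑ d`,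
summing to `d`. -/
def TwoStepDecomp {m : ℕ} (ℓ : ℕ) (p : Fin ℓ → Fin m → ℤ) (d : Fin m → ℤ) : Prop :=
  (∀ k, (∑ i, |p k i|) = 2 ∧ ConformalTo (p k) d) ∧ (∀ i, (∑ k, p k i) = d i)

/-- SBO jump M-convexity of a function `f : ℤ^m → ℝ ∪ {±∞}`. -/
def SBOJumpMConvex {m : ℕ} (f : (Fin m → ℤ) → EReal) : Prop :=
  ∀ z1 z2 : Fin m → ℤ, f z1 < ⊤ → f z2 < ⊤ →
    ∃ (ℓ : ℕ) (p : Fin ℓ → Fin m → ℤ) (g : Fin ℓ → ℝ),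
      TwoStepDecomp ℓ p (fun i => z2 i - z1 i) ∧
      f z2 = f z1 + ((∑ k, g k : ℝ) : EReal) ∧
      ∀ I : Finset (Fin ℓ),
        f (fun i => z1 i + ∑ k ∈ I, p k i) ≤ f z1 + ((∑ k ∈ I, g k : ℝ) : EReal)

lemma conf_cases {m : ℕ} {x y : Fin m → ℤ} (h : ConformalTo x y) (i : Fin m) :
    (0 ≤ x i ∧ x i ≤ y i) ∨ (y i ≤ x i ∧ x i ≤ 0) := by
  obtain ⟨h1, h2⟩ := h i
  rcases le_total 0 (y i) with hy | hy
  · left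
    rw [abs_of_nonneg hy] at h1
    have h3 := abs_le.1 h1
    refine ⟨?_, h3.2⟩
    by_contra hx
    push Not at hx
    have : 0 < y i := by omega
    nlinarith
  · right
    rw [abs_of_nonpos hy] at h1
    have h3 := abs_le.1 h1
    refine ⟨by omega, ?_⟩
    by_contra hx
    push Not at hx
    have : y i < 0 := by omega
    nlinarith

lemma conf_of {m : ℕ} {x y : Fin m → ℤ}
    (h : ∀ i, (0 ≤ x i ∧ x i ≤ y i) ∨ (y i ≤ x i ∧ x i ≤ 0)) : ConformalTo x y := by
  intro i
  rcases h i with ⟨h1, h2⟩ | ⟨h1, h2⟩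
  · rw [abs_of_nonneg h1, abs_of_nonneg (h1.trans h2)]
    exact ⟨h2, mul_nonneg h1 (h1.trans h2)⟩
  · rw [abs_of_nonpos h2, abs_of_nonpos (h1.trans h2)]
    exact ⟨by omega, mul_nonneg_of_nonpos_of_nonpos h2 (h1.trans h2)⟩

lemma conf_trans {m : ℕ} {x y z : Fin m → ℤ} (h : ConformalTo x y) (h' : ConformalTo y z) :
    ConformalTo x z := by
  refine conf_of fun i => ?_
  have a := conf_cases h i
  have b := conf_cases h' i
  omega

lemma conf_sub {m : ℕ} {x y : Fin m → ℤ} (h : ConformalTo x y) : ConformalTo (y - x) y := by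
  refine conf_of fun i => ?_
  have a := conf_cases h i
  simp only [Pi.sub_apply]
  omega

lemma edge_col {m n : ℕ} {M : Matrix (Fin m) (Fin n) ℤ} (hM : IsIncidenceOfSimpleGraph M)
    (w : Fin m) (j : Fin n) (h : M w j = 1) :
    ∃ u, M.col j = Pi.single w 1 + Pi.single u 1 := by
  obtain ⟨h01, h2, -⟩ := hM
  obtain ⟨a, b, hab, hs⟩ := Finset.card_eq_two.1 (h2 j)
  have key : ∀ i, M i j = 1 ↔ i = a ∨ i = b := by
    intro i
    have : i ∈ Finset.univ.filter (fun i => M i j = 1) ↔ i ∈ ({a, b} : Finset (Fin m)) := by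
      rw [hs]
    simpa using this
  have col : M.col j = Pi.single a 1 + Pi.single b 1 := by
    funext i
    simp only [Matrix.col_apply, Pi.add_apply, Pi.single_apply]
    have k := key i
    rcases h01 i j with h0 | h0
    · have hna : ¬ (i = a ∨ i = b) := by rw [← k]; omega
      push Not at hna
      simp [hna.1, hna.2, h0]
    · rcases k.1 h0 with rfl | rfl
      · simp [h0, hab]
      · simp [h0, hab.symm]
  rcases (key w).1 h with rfl | rfl
  · exact ⟨b, col⟩
  · exact ⟨a, by rw [col, add_comm]⟩

lemma trail_finish {m n : ℕ} {M : Matrix (Fin m) (Fin n) ℤ} (hM : IsIncidenceOfSimpleGraph M)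
    (y : Fin n → ℤ) (v : Fin m) (s : ℤ) (hs : s = 1 ∨ s = -1) (hsv : 0 < s * (M *ᵥ y) v)
    (q : Fin n → ℤ) (w : Fin m) (t : ℤ) (ht : t = 1 ∨ t = -1) (hq : ConformalTo q y)
    (hMq : M *ᵥ q = Pi.single v s + Pi.single w t)
    (hall : ∀ j, M w j = 1 → 0 ≤ t * (y j - q j)) :
    ∃ q', ConformalTo q' y ∧ ConformalTo (M *ᵥ q') (M *ᵥ y) ∧ (∑ i, |(M *ᵥ q') i|) = 2 := by
  have hw : 0 ≤ t * ((M *ᵥ y) w - (M *ᵥ q) w) := by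
    rw [← Pi.sub_apply, ← Matrix.mulVec_sub, Matrix.mulVec, dotProduct, Finset.mul_sum]
    refine Finset.sum_nonneg fun j _ => ?_
    rcases hM.1 w j with h | h
    · simp [h]
    · simpa [h] using hall j h
  have habs : |s| = 1 ∧ |t| = 1 := by
    constructor
    · rcases hs with rfl | rfl <;> simp
    · rcases ht with rfl | rfl <;> simp
  refine ⟨q, hq, ?_⟩
  rw [hMq] at hw ⊢
  generalize M *ᵥ y = d at *
  by_cases hvw : w = v
  · subst hvw
    rw [← Pi.single_add] at *
    rw [Pi.single_eq_same] at hw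
    have hst : s = t ∧ 2 ≤ t * d w := by
      rcases ht with rfl | rfl <;> rcases hs with rfl | rfl <;> omega
    obtain ⟨rfl, h2⟩ := hst
    constructor
    · refine conf_of fun i => ?_
      by_cases hi : i = w
      · subst hi
        rw [Pi.single_eq_same]
        rcases ht with rfl | rfl <;> omega
      · rw [Pi.single_eq_of_ne hi]; omega
    · rw [Finset.sum_eq_single w]
      · rw [Pi.single_eq_same]
        rcases ht with rfl | rfl <;> simp
      · intro i _ hi
        simp [Pi.single_eq_of_ne hi]
      · simp
  · have hvw' : v ≠ w := fun h => hvw h.symm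
    rw [Pi.add_apply, Pi.single_eq_same, Pi.single_eq_of_ne hvw] at hw
    constructor
    · refine conf_of fun i => ?_
      rw [Pi.add_apply]
      by_cases hi : i = w
      · subst hi
        rw [Pi.single_eq_same, Pi.single_eq_of_ne hvw]
        rcases ht with rfl | rfl <;> omega
      · rw [Pi.single_eq_of_ne hi]
        by_cases hi' : i = v
        · subst hi'
          rw [Pi.single_eq_same]
          rcases hs with rfl | rfl <;> omega
        · rw [Pi.single_eq_of_ne hi']; omega
    · have : ∀ i, |(Pi.single v s + Pi.single w t : Fin m → ℤ) i|
          = (if i = v then 1 else 0) + (if i = w then 1 else 0) := by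
        intro i
        rw [Pi.add_apply, Pi.single_apply, Pi.single_apply]
        by_cases h1 : i = v
        · subst h1
          simp [hvw', habs.1]
        · by_cases h2 : i = w
          · simp [h2, hvw, habs.2]
          · simp [h1, h2]
      simp only [this, Finset.sum_add_distrib]
      simp

lemma trail {m n : ℕ} {M : Matrix (Fin m) (Fin n) ℤ} (hM : IsIncidenceOfSimpleGraph M)
    (y : Fin n → ℤ) (v : Fin m) (s : ℤ) (hs : s = 1 ∨ s = -1) (hsv : 0 < s * (M *ᵥ y) v) :
    ∀ (N : ℕ) (q : Fin n → ℤ) (w : Fin m) (t : ℤ), (t = 1 ∨ t = -1) → ConformalTo q y →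
      M *ᵥ q = Pi.single v s + Pi.single w t → (∑ j, (y j - q j).natAbs) = N →
      ∃ q', ConformalTo q' y ∧ ConformalTo (M *ᵥ q') (M *ᵥ y) ∧ (∑ i, |(M *ᵥ q') i|) = 2 := by
  intro N
  induction N with
  | zero =>
    intro q w t ht hq hMq hN
    refine trail_finish hM y v s hs hsv q w t ht hq hMq fun j hj => ?_
    have h0 := Finset.sum_eq_zero_iff.1 hN j (Finset.mem_univ j)
    have : y j - q j = 0 := by omega
    simp [this]
  | succ N ih =>
    intro q w t ht hq hMq hN
    by_cases hall : ∀ j, M w j = 1 → 0 ≤ t * (y j - q j)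
    · exact trail_finish hM y v s hs hsv q w t ht hq hMq hall
    push Not at hall
    obtain ⟨j, hwj, hj⟩ := hall
    obtain ⟨u, hu⟩ := edge_col hM w j hwj
    refine ih (q + Pi.single j (-t)) u (-t) (by omega) (conf_of fun i => ?_) ?_ ?_
    · have a := conf_cases hq i
      by_cases hij : i = j
      · subst hij
        simp only [Pi.add_apply, Pi.single_eq_same]
        rcases ht with rfl | rfl <;> omega
      · simp only [Pi.add_apply, Pi.single_eq_of_ne hij]
        omega
    · rw [Matrix.mulVec_add, hMq, Matrix.mulVec_single, hu]
      funext i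
      simp only [Pi.add_apply, Pi.smul_apply, Pi.single_apply, MulOpposite.smul_eq_mul_unop,
        MulOpposite.unop_op]
      split_ifs <;> ring
    · have e1 := Finset.add_sum_erase Finset.univ (fun j => (y j - q j).natAbs) (Finset.mem_univ j)
      have e2 := Finset.add_sum_erase Finset.univ
        (fun i => (y i - (q + Pi.single j (-t) : Fin n → ℤ) i).natAbs) (Finset.mem_univ j)
      have e3 : ∑ i ∈ Finset.univ.erase j, (y i - (q + Pi.single j (-t) : Fin n → ℤ) i).natAbs
          = ∑ i ∈ Finset.univ.erase j, (y i - q i).natAbs := by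
        refine Finset.sum_congr rfl fun i hi => ?_
        simp [Pi.single_eq_of_ne (Finset.ne_of_mem_erase hi)]
      have e4 : (y j - (q + Pi.single j (-t) : Fin n → ℤ) j).natAbs + 1 = (y j - q j).natAbs := by
        simp only [Pi.add_apply, Pi.single_eq_same]
        rcases ht with rfl | rfl <;> omega
      omega

lemma extract {m n : ℕ} {M : Matrix (Fin m) (Fin n) ℤ} (hM : IsIncidenceOfSimpleGraph M)
    (y : Fin n → ℤ) (h : M *ᵥ y ≠ 0) :
    ∃ q', ConformalTo q' y ∧ ConformalTo (M *ᵥ q') (M *ᵥ y) ∧ (∑ i, |(M *ᵥ q') i|) = 2 := by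
  obtain ⟨v, hv⟩ := Function.ne_iff.1 h
  simp only [Pi.zero_apply] at hv
  obtain ⟨s, hs, hsv⟩ : ∃ s : ℤ, (s = 1 ∨ s = -1) ∧ 0 < s * (M *ᵥ y) v := by
    rcases lt_or_gt_of_ne hv with h | h
    · exact ⟨-1, by simp, by omega⟩
    · exact ⟨1, by simp, by omega⟩
  refine trail hM y v s hs hsv _ 0 v (-s) (by omega) (conf_of fun i => ?_) ?_ rfl
  · simp only [Pi.zero_apply]; omega
  · rw [← Pi.single_add]; simp

lemma decomp {m n : ℕ} {M : Matrix (Fin m) (Fin n) ℤ} (hM : IsIncidenceOfSimpleGraph M) :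
    ∀ (N : ℕ) (y : Fin n → ℤ), (∑ j, (y j).natAbs) ≤ N →
      ∃ (l : ℕ) (q : Fin l → Fin n → ℤ) (y0 : Fin n → ℤ),
        (∀ k, ConformalTo (q k) y ∧ ConformalTo (M *ᵥ (q k)) (M *ᵥ y) ∧
          (∑ i, |(M *ᵥ (q k)) i|) = 2) ∧
        ConformalTo y0 y ∧ M *ᵥ y0 = 0 ∧ y0 + ∑ k, q k = y := by
  intro N
  induction N with
  | zero =>
    intro y hy
    have : y = 0 := by
      funext j
      have := Finset.sum_eq_zero_iff.1 (Nat.le_zero.1 hy) j (Finset.mem_univ j)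
      simpa using this
    subst this
    exact ⟨0, Fin.elim0, 0, fun k => k.elim0, conf_of fun i => by simp, by simp, by simp⟩
  | succ N ih =>
    intro y hy
    by_cases h : M *ᵥ y = 0
    · exact ⟨0, Fin.elim0, y, fun k => k.elim0, conf_of fun i => by omega, h, by simp⟩
    obtain ⟨q', h1, h2, h3⟩ := extract hM y h
    have hlt : (∑ j, ((y - q') j).natAbs) < ∑ j, (y j).natAbs := by
      have hne : q' ≠ 0 := by
        rintro rfl
        simp at h3
      obtain ⟨j, hj⟩ := Function.ne_iff.1 hne
      simp only [Pi.zero_apply] at hj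
      refine Finset.sum_lt_sum (fun j _ => ?_) ⟨j, Finset.mem_univ j, ?_⟩
      · have := conf_cases h1 j
        simp only [Pi.sub_apply]; omega
      · have := conf_cases h1 j
        simp only [Pi.sub_apply]; omega
    obtain ⟨l, q, y0, hq, hy0, hM0, hsum⟩ := ih (y - q') (by omega)
    have hc : ConformalTo (M *ᵥ (y - q')) (M *ᵥ y) := by
      rw [Matrix.mulVec_sub]; exact conf_sub h2
    refine ⟨l + 1, Fin.cons q' q, y0, ?_, conf_trans hy0 (conf_sub h1), hM0, ?_⟩
    · intro k
      refine Fin.cases ?_ (fun k => ?_) k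
      · exact ⟨h1, h2, h3⟩
      · simp only [Fin.cons_succ]
        exact ⟨conf_trans (hq k).1 (conf_sub h1), conf_trans (hq k).2.1 hc, (hq k).2.2⟩
    · rw [Fin.sum_univ_succ]
      simp only [Fin.cons_zero, Fin.cons_succ]
      rw [add_left_comm, hsum]; abel

lemma attained {m n : ℕ} {M : Matrix (Fin m) (Fin n) ℤ} (hM : IsIncidenceOfSimpleGraph M)
    (c : Fin n → ℤ) (z : Fin m → ℤ) (h : fcost M c z < ⊤) :
    ∃ x : Fin n → ℤ, (∀ j, 0 ≤ x j) ∧ M *ᵥ x = z ∧ fcost M c z = (((c ⬝ᵥ x : ℤ) : ℝ) : EReal) ∧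
      ∀ x' : Fin n → ℤ, (∀ j, 0 ≤ x' j) → M *ᵥ x' = z → c ⬝ᵥ x ≤ c ⬝ᵥ x' := by
  have hfin : {x : Fin n → ℤ | (∀ j, 0 ≤ x j) ∧ M *ᵥ x = z}.Finite := by
    refine (Set.finite_Icc (0 : Fin n → ℤ) (fun _ => ∑ i, |z i|)).subset ?_
    rintro x ⟨hx, hz⟩
    refine ⟨hx, fun j => ?_⟩
    obtain ⟨w, hw⟩ : ∃ w, M w j = 1 := by
      have h2 := hM.2.1 j
      have : (Finset.univ.filter (fun i => M i j = 1)).Nonempty := by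
        rw [← Finset.card_pos]; omega
      obtain ⟨w, hw⟩ := this
      exact ⟨w, by simpa using hw⟩
    have h1 : x j ≤ z w := by
      rw [← hz, Matrix.mulVec, dotProduct]
      have : M w j * x j ≤ ∑ j, M w j * x j := by
        refine Finset.single_le_sum (f := fun j => M w j * x j) (fun i _ => ?_) (Finset.mem_univ j)
        rcases hM.1 w i with h | h <;> simp [h, hx i]
      simpa [hw] using this
    have h3 : |z w| ≤ ∑ i, |z i| :=
      Finset.single_le_sum (f := fun i => |z i|) (fun i _ => abs_nonneg _) (Finset.mem_univ w)
    exact h1.trans ((le_abs_self _).trans h3)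
  obtain ⟨w, ⟨x0, hx0, hz0, -⟩, -⟩ := sInf_lt_iff.1 h
  obtain ⟨x, ⟨hx, hz⟩, hmin⟩ := Set.exists_min_image _ (fun x => c ⬝ᵥ x) hfin ⟨x0, hx0, hz0⟩
  refine ⟨x, hx, hz, ?_, fun x' h1 h2 => hmin x' ⟨h1, h2⟩⟩
  refine le_antisymm (sInf_le ⟨x, hx, hz, rfl⟩) (le_sInf ?_)
  rintro _ ⟨x', h1, h2, rfl⟩
  have := hmin x' ⟨h1, h2⟩
  exact_mod_cast this

theorem statement1 {m n : ℕ} (hm : 1 ≤ m) (hn : 1 ≤ n)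
    (M : Matrix (Fin m) (Fin n) ℤ) (hM : IsIncidenceOfSimpleGraph M)
    (c : Fin n → ℤ) :
    SBOJumpMConvex (fcost M c) := by
  intro z1 z2 hz1 hz2
  obtain ⟨x1, hx1, hM1, hf1, hmin1⟩ := attained hM c z1 hz1
  obtain ⟨x2, hx2, hM2, hf2, hmin2⟩ := attained hM c z2 hz2
  obtain ⟨l, q, y0, hq, hy0, hM0, hsum⟩ := decomp hM _ (x2 - x1) le_rfl
  have hd : M *ᵥ (x2 - x1) = fun i => z2 i - z1 i := by
    rw [Matrix.mulVec_sub, hM1, hM2]; rfl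
  have hc0 : c ⬝ᵥ y0 = 0 := by
    have h1 := hmin1 (x1 + y0) (fun j => by
      have a := conf_cases hy0 j
      have := hx1 j; have := hx2 j
      simp only [Pi.add_apply, Pi.sub_apply] at *; omega) (by
      rw [Matrix.mulVec_add, hM0, hM1, add_zero])
    have h2 := hmin2 (x2 - y0) (fun j => by
      have a := conf_cases hy0 j
      have := hx1 j; have := hx2 j
      simp only [Pi.sub_apply] at *; omega) (by
      rw [Matrix.mulVec_sub, hM0, hM2, sub_zero])
    rw [dotProduct_add] at h1
    rw [dotProduct_sub] at h2
    omega
  refine ⟨l, fun k => M *ᵥ q k, fun k => ((c ⬝ᵥ q k : ℤ) : ℝ), ⟨fun k => ⟨(hq k).2.2, ?_⟩, ?_⟩,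
    ?_, ?_⟩
  · rw [← hd]; exact (hq k).2.1
  · intro i
    rw [← hd, ← hsum, Matrix.mulVec_add, hM0, zero_add, Matrix.mulVec_sum, Finset.sum_apply]
  · rw [hf1, hf2]
    have : c ⬝ᵥ x2 = c ⬝ᵥ x1 + ∑ k, c ⬝ᵥ q k := by
      have h := congrArg (fun t => c ⬝ᵥ t) hsum
      simp only [dotProduct_add, dotProduct_sub, dotProduct_sum, hc0] at h
      omega
    rw [this, ← EReal.coe_add]
    push_cast
    rfl
  · intro I
    rw [hf1, ← EReal.coe_add]
    refine sInf_le ⟨x1 + ∑ k ∈ I, q k, ?_, ?_, ?_⟩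
    · intro j
      have hj : y0 j + ∑ k, q k j = x2 j - x1 j := by
        have := congrFun hsum j
        simpa [Finset.sum_apply] using this
      have hsplit := Finset.sum_add_sum_compl I (fun k => q k j)
      have h1 := hx1 j
      have h2 := hx2 j
      have h0 := conf_cases hy0 j
      simp only [Pi.add_apply, Pi.sub_apply, Finset.sum_apply] at *
      rcases le_total 0 (x2 j - x1 j) with hp | hp
      · have : 0 ≤ ∑ k ∈ I, q k j := Finset.sum_nonneg fun k _ => by
          have := conf_cases (hq k).1 j
          simp only [Pi.sub_apply] at this; omega
        omega
      · have : ∑ k ∈ Iᶜ, q k j ≤ 0 := Finset.sum_nonpos fun k _ => by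
          have := conf_cases (hq k).1 j
          simp only [Pi.sub_apply] at this; omega
        omega
    · rw [Matrix.mulVec_add, hM1, Matrix.mulVec_sum]
      funext i
      simp [Finset.sum_apply]
    · rw [dotProduct_add, dotProduct_sum]
      push_cast
      rfl
end

section
/- Let f : ℤ^m → ℚ ∪ {+∞} be SBO jump M-convex. Let z^(1), z^(2) ∈ ℤ^m with z^(1) ≡ z^(2) (mod 2) componentwise, and let i* ∈ {1, …, m} satisfy z^(1)_{i*} − z^(2)_{i*} ≥ 2. Then there exist z^(1)′, z^(2)′ ∈ ℤ^m such that: (i) z^(1)′ ≡ z^(1) (mod 2) and z^(2)′ ≡ z^(2) (mod 2); (ii) z^(1)′ + z^(2)′ = z^(1) + z^(2); (iii) z^(1)′_{i*} = z^(1)_{i*} − 2 and z^(2)′_{i*} = z^(2)_{i*} + 2; (iv) for every i ∈ {1, …, m}, if z^(1)_i = z^(2)_i then z^(1)_i = z^(1)′_i = z^(2)′_i = z^(2)_i; and (v) f(z^(1)′) + f(z^(2)′) ≤ f(z^(1)) + f(z^(2)) (in ℚ ∪ {+∞}). -/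
open Matrix BigOperators

theorem aux_single {m : ℕ} (a : Fin m → ℕ) (n : ℕ) (h : ∑ i, a i = n + 1) :
    ∃ (u : Fin m) (b : Fin m → ℕ), (∀ i, a i = (if i = u then 1 else 0) + b i) ∧ ∑ i, b i = n := by
  obtain ⟨u, -, hu⟩ : ∃ u ∈ Finset.univ, a u ≠ 0 := by
    apply Finset.exists_ne_zero_of_sum_ne_zero
    omega
  have key : ∀ i, a i = (if i = u then 1 else 0) + (a i - if i = u then 1 else 0) := by
    intro i
    split_ifs with hi
    · subst hi; omega
    · omega
  refine ⟨u, fun i => a i - if i = u then 1 else 0, key, ?_⟩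
  have h2 : ∑ i, a i = ∑ i, ((if i = u then 1 else 0) + (a i - if i = u then 1 else 0)) :=
    Finset.sum_congr rfl (fun i _ => key i)
  rw [Finset.sum_add_distrib, Finset.sum_ite_eq' Finset.univ u] at h2
  simp only [Finset.mem_univ, if_true] at h2
  show ∑ i, (a i - if i = u then 1 else 0) = n
  omega

theorem aux_edge {m : ℕ} (a : Fin m → ℕ) (h : ∑ i, a i = 2) :
    ∃ u v : Fin m, ∀ i, a i = (if i = u then 1 else 0) + (if i = v then 1 else 0) := by
  obtain ⟨u, b, hb, hs⟩ := aux_single a 1 h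
  obtain ⟨v, c, hc, hs'⟩ := aux_single b 0 hs
  refine ⟨u, v, fun i => ?_⟩
  have : c i = 0 := by
    rw [Finset.sum_eq_zero_iff] at hs'
    exact hs' i (Finset.mem_univ i)
  rw [hb, hc, this, add_zero]

theorem aux_cycle {m ℓ : ℕ} (a : Fin ℓ → Fin m → ℕ) (h2 : ∀ k, ∑ i, a k i = 2)
    (he : ∀ i, 2 ∣ ∑ k, a k i) (s : Fin m) (hs : ∑ k, a k s ≠ 0) :
    ∃ I : Finset (Fin ℓ), (∀ i, 2 ∣ ∑ k ∈ I, a k i) ∧ ∑ k ∈ I, a k s = 2 := by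
  classical
  have hedge : ∀ k j, a k j ≠ 0 →
      ∃ w, ∀ i, a k i = (if i = j then 1 else 0) + (if i = w then 1 else 0) := by
    intro k j hj
    obtain ⟨u, v, huv⟩ := aux_edge (a k) (h2 k)
    by_cases hju : j = u
    · exact ⟨v, by rw [hju]; exact huv⟩
    · have hjv : j = v := by
        by_contra hne
        apply hj
        rw [huv]; simp [hju, hne]
      refine ⟨u, fun i => ?_⟩
      rw [huv, hjv, add_comm]
  by_contra hcon
  have grow : ∀ n : ℕ, ∃ I : Finset (Fin ℓ), n ≤ I.card ∧ ∑ k ∈ I, a k s = 1 ∧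
      ∃ j, j ≠ s ∧ ∀ i, (∑ k ∈ I, a k i) % 2 =
        ((if i = s then 1 else 0) + (if i = j then 1 else 0)) % 2 := by
    intro n
    induction n with
    | zero =>
      obtain ⟨k, -, hk⟩ := Finset.exists_ne_zero_of_sum_ne_zero hs
      obtain ⟨w, hw⟩ := hedge k s hk
      by_cases hws : w = s
      · exfalso
        apply hcon
        refine ⟨{k}, fun i => ?_, ?_⟩
        · rw [Finset.sum_singleton, hw, hws]; split_ifs <;> decide
        · rw [Finset.sum_singleton, hw, hws]; simp
      · refine ⟨{k}, Nat.zero_le _, ?_, w, hws, fun i => ?_⟩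
        · rw [Finset.sum_singleton, hw]; simp [Ne.symm hws]
        · rw [Finset.sum_singleton, hw]
    | succ n ih =>
      obtain ⟨I, hn, h1, j, hjs, hI⟩ := ih
      have hex : ∃ k, k ∉ I ∧ a k j ≠ 0 := by
        by_contra hno
        push Not at hno
        have : ∑ k ∈ I, a k j = ∑ k, a k j :=
          Finset.sum_subset (Finset.subset_univ I) (fun k _ hk => hno k hk)
        have hj := hI j
        have hj2 := he j
        rw [← this] at hj2
        simp [hjs] at hj
        omega
      obtain ⟨k, hkI, hk⟩ := hex
      obtain ⟨w, hw⟩ := hedge k j hk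
      by_cases hws : w = s
      · exfalso
        apply hcon
        refine ⟨insert k I, fun i => ?_, ?_⟩
        · have := hI i
          rw [Finset.sum_insert hkI, hw, hws]
          split_ifs at this ⊢ <;> omega
        · rw [Finset.sum_insert hkI, hw, hws, h1]; simp [Ne.symm hjs]
      · refine ⟨insert k I, ?_, ?_, w, hws, fun i => ?_⟩
        · rw [Finset.card_insert_of_notMem hkI]; omega
        · rw [Finset.sum_insert hkI, hw, h1]; simp [Ne.symm hjs, Ne.symm hws]
        · have := hI i
          rw [Finset.sum_insert hkI, hw]
          split_ifs at this ⊢ <;> omega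
  obtain ⟨I, hI, -⟩ := grow (ℓ + 1)
  have := Finset.card_le_univ I
  rw [Fintype.card_fin] at this
  omega

theorem statement2 {m : ℕ} (f : (Fin m → ℤ) → EReal)
    (hrange : ∀ z, f z = ⊤ ∨ ∃ q : ℚ, f z = ((q : ℝ) : EReal))
    (hf : SBOJumpMConvex f)
    (z1 z2 : Fin m → ℤ) (hpar : ∀ i, (2 : ℤ) ∣ (z1 i - z2 i))
    (istar : Fin m) (hstar : 2 ≤ z1 istar - z2 istar) :
    ∃ z1' z2' : Fin m → ℤ,
      (∀ i, (2 : ℤ) ∣ (z1' i - z1 i)) ∧ (∀ i, (2 : ℤ) ∣ (z2' i - z2 i)) ∧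
      (∀ i, z1' i + z2' i = z1 i + z2 i) ∧
      z1' istar = z1 istar - 2 ∧ z2' istar = z2 istar + 2 ∧
      (∀ i, z1 i = z2 i → z1' i = z1 i ∧ z2' i = z1 i) ∧
      f z1' + f z2' ≤ f z1 + f z2 := by
  classical
  by_cases htop : f z1 = ⊤ ∨ f z2 = ⊤
  · have hnb : ∀ z, f z ≠ ⊥ := by
      intro z
      rcases hrange z with h | ⟨q, h⟩ <;> rw [h]
      · exact top_ne_bot
      · exact EReal.coe_ne_bot _
    have hsum : f z1 + f z2 = ⊤ := by
      rcases htop with h | h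
      · rw [h, EReal.top_add_of_ne_bot (hnb _)]
      · rw [h, EReal.add_top_of_ne_bot (hnb _)]
    refine ⟨fun i => z1 i - if i = istar then 2 else 0, fun i => z2 i + if i = istar then 2 else 0,
      ?_, ?_, ?_, by simp, by simp, ?_, by rw [hsum]; exact le_top⟩
    · intro i; dsimp only; split_ifs <;> omega
    · intro i; dsimp only; split_ifs <;> omega
    · intro i; ring
    · intro i hi
      have : i ≠ istar := by rintro rfl; omega
      simp [this, hi]
  push Not at htop
  obtain ⟨ht1, ht2⟩ := htop
  obtain ⟨ℓ, p, g, ⟨hp, hsum⟩, hg, hI⟩ := hf z1 z2 (lt_top_iff_ne_top.2 ht1) (lt_top_iff_ne_top.2 ht2)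
  obtain ⟨q1, hq1⟩ := (hrange z1).resolve_left ht1
  obtain ⟨q2, hq2⟩ := (hrange z2).resolve_left ht2
  have hpar' : ∀ (J : Finset (Fin ℓ)) i,
      (2 : ℤ) ∣ ∑ k ∈ J, p k i ↔ 2 ∣ ∑ k ∈ J, (p k i).natAbs := by
    intro J i
    have h : (2 : ℤ) ∣ ((∑ k ∈ J, (p k i).natAbs : ℕ) : ℤ) - ∑ k ∈ J, p k i := by
      push_cast
      rw [← Finset.sum_sub_distrib]
      apply Finset.dvd_sum
      intro k _
      rcases abs_cases (p k i) with ⟨h, -⟩ | ⟨h, -⟩ <;> rw [h] <;> omega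
    omega
  have hneg : ∀ J : Finset (Fin ℓ),
      ∑ k ∈ J, p k istar = -((∑ k ∈ J, (p k istar).natAbs : ℕ) : ℤ) := by
    intro J
    push_cast
    rw [← Finset.sum_neg_distrib]
    apply Finset.sum_congr rfl
    intro k _
    have h := ((hp k).2 istar).2
    have h3 : p k istar ≤ 0 := by
      by_contra hc
      push Not at hc
      dsimp only at h
      nlinarith
    rw [abs_of_nonpos h3, neg_neg]
  obtain ⟨I, hIe, hIs⟩ := aux_cycle (fun k i => (p k i).natAbs)
    (by
      intro k
      have h := (hp k).1
      zify
      exact h)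
    (by
      intro i
      rw [← hpar', hsum]
      have := hpar i
      show (2 : ℤ) ∣ z2 i - z1 i
      omega) istar
    (by
      have h1 := hneg Finset.univ
      rw [hsum] at h1
      intro h0
      rw [h0] at h1
      push_cast at h1
      omega)
  have hcompl : ∀ i, ∑ k ∈ I, p k i + ∑ k ∈ Iᶜ, p k i = z2 i - z1 i := by
    intro i; rw [Finset.sum_add_sum_compl, hsum]
  have hst : ∑ k ∈ I, p k istar = -2 := by
    rw [hneg]; rw [hIs]; rfl
  have hev : ∀ i, (2 : ℤ) ∣ ∑ k ∈ I, p k i := fun i => (hpar' I i).2 (hIe i)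
  refine ⟨fun i => z1 i + ∑ k ∈ I, p k i, fun i => z1 i + ∑ k ∈ Iᶜ, p k i, ?_, ?_, ?_, ?_, ?_, ?_, ?_⟩
  · intro i; have := hev i; dsimp only; omega
  · intro i; have := hev i; have := hcompl i; dsimp only; omega
  · intro i; have := hcompl i; dsimp only; omega
  · dsimp only; omega
  · have := hcompl istar; dsimp only; omega
  · intro i hi
    have hz : ∀ k, p k i = 0 := by
      intro k
      have h := ((hp k).2 i).1
      simpa [hi] using h
    simp [hz]
  · refine (add_le_add (hI I) (hI Iᶜ)).trans ?_
    rw [hg, hq1, ← Finset.sum_add_sum_compl I g]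
    norm_cast
    apply le_of_eq
    push_cast
    ring
end

section
/- Let f : ℤ^m → ℚ ∪ {+∞} be SBO jump M-convex. Let r ∈ ℤ^m, let ℓ ≥ 1, let z^(1), …, z^(ℓ) ∈ ℤ^m satisfy z^(k) ≡ r (mod 2) componentwise for every k, and let λ^(1), …, λ^(ℓ) ≥ 0 be real numbers with Σ_{k=1}^ℓ λ^(k) = 1 such that z := Σ_{k=1}^ℓ λ^(k) z^(k) has all integer entries and z ≡ r (mod 2). Then f(z) ≤ Σ_{k=1}^ℓ λ^(k) f(z^(k)), where the right-hand side is interpreted in ℝ ∪ {+∞} with λ·(+∞) = +∞ for λ > 0 and 0·(+∞) = 0. -/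
open Matrix BigOperators

lemma graph_aux {m ℓ : ℕ} (p : Fin ℓ → Fin m → ℤ) (h1 : ∀ k, (∑ i, |p k i|) = 2)
    (i0 : Fin m) (hpos : ∀ k, 0 ≤ p k i0) (heven : ∀ i, (2 : ℤ) ∣ ∑ k, p k i)
    (hd : 0 < ∑ k, p k i0) :
    ∃ I : Finset (Fin ℓ), (∀ i, (2 : ℤ) ∣ ∑ k ∈ I, p k i) ∧ ∑ k ∈ I, p k i0 = 2 := by
  classical
  by_contra hcon
  have hone : ∀ k i, |p k i| ≤ 2 := by
    intro k i
    rw [← h1 k]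
    exact Finset.single_le_sum (f := fun i => |p k i|) (fun j _ => abs_nonneg _)
      (Finset.mem_univ i)
  have htwo : ∀ k i j, i ≠ j → |p k i| + |p k j| ≤ 2 := by
    intro k i j hij
    rw [← h1 k, ← Finset.sum_pair (f := fun i => |p k i|) hij]
    exact Finset.sum_le_sum_of_subset_of_nonneg (Finset.subset_univ _)
      (fun j _ _ => abs_nonneg _)
  have hthree : ∀ k i j l, i ≠ j → i ≠ l → j ≠ l → |p k i| + |p k j| + |p k l| ≤ 2 := by
    intro k i j l hij hil hjl
    have : |p k i| + |p k j| + |p k l| = ∑ x ∈ ({i, j, l} : Finset (Fin m)), |p k x| := by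
      rw [Finset.sum_insert (by simp [hij, hil]), Finset.sum_pair hjl, add_assoc]
    rw [← h1 k, this]
    exact Finset.sum_le_sum_of_subset_of_nonneg (Finset.subset_univ _)
      (fun j _ _ => abs_nonneg _)
  -- an edge which is odd at `b` has another odd end
  have hother : ∀ k b, ¬ (2 : ℤ) ∣ p k b → ∃ c, c ≠ b ∧ ¬ (2 : ℤ) ∣ p k c ∧
      |p k b| = 1 ∧ |p k c| = 1 ∧ ∀ j, j ≠ b → j ≠ c → p k j = 0 := by
    intro k b hb
    have hb1 : |p k b| = 1 := by have := hone k b; grind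
    have hs : ∑ i ∈ Finset.univ.erase b, |p k i| = 1 := by
      have := Finset.add_sum_erase Finset.univ (fun i => |p k i|) (Finset.mem_univ b)
      simp only [h1, hb1] at this
      omega
    obtain ⟨c, hc, hc0⟩ := Finset.exists_ne_zero_of_sum_ne_zero
      (s := Finset.univ.erase b) (f := fun i => |p k i|) (by rw [hs]; norm_num)
    have hcb : c ≠ b := Finset.ne_of_mem_erase hc
    have hc1 : |p k c| = 1 := by
      have := htwo k c b hcb
      have := abs_nonneg (p k c)
      omega
    refine ⟨c, hcb, by grind, hb1, hc1, ?_⟩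
    intro j hjb hjc
    have := hthree k j b c hjb hjc hcb.symm
    have := abs_nonneg (p k j)
    apply abs_eq_zero.mp
    omega
  -- trails
  let T : Finset (Finset (Fin ℓ)) := Finset.univ.filter fun I =>
    ∑ k ∈ I, p k i0 = 1 ∧ ∃ b, b ≠ i0 ∧ ¬ (2 : ℤ) ∣ ∑ k ∈ I, p k b ∧
      ∀ j, j ≠ i0 → j ≠ b → (2 : ℤ) ∣ ∑ k ∈ I, p k j
  have hTne : T.Nonempty := by
    obtain ⟨k, -, hk⟩ := Finset.exists_lt_of_sum_lt
      (s := Finset.univ) (f := fun _ : Fin ℓ => (0 : ℤ)) (g := fun k => p k i0) (by simpa using hd)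
    have h2 := hone k i0
    rw [abs_of_pos hk] at h2
    have hk1 : p k i0 = 1 := by
      by_contra hne
      have hk2 : p k i0 = 2 := by omega
      apply hcon
      refine ⟨{k}, ?_, by simpa using hk2⟩
      intro i
      rw [Finset.sum_singleton]
      by_cases hi : i = i0
      · rw [hi, hk2]
      · have := htwo k i i0 hi
        rw [hk2] at this
        have h0 := abs_nonneg (p k i)
        have : |p k i| = 0 := by
          rw [abs_of_pos (by norm_num : (0 : ℤ) < 2)] at this; omega
        rw [abs_eq_zero.mp this]; simp
    obtain ⟨c, hc, hc2, -, -, hz⟩ := hother k i0 (by omega)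
    refine ⟨{k}, ?_⟩
    simp only [T, Finset.mem_filter, Finset.mem_univ, true_and, Finset.sum_singleton]
    exact ⟨hk1, c, hc, hc2, fun j hj hjc => by rw [hz j hj hjc]; simp⟩
  obtain ⟨I, hI, hmax⟩ := Finset.exists_max_image T Finset.card hTne
  simp only [T, Finset.mem_filter, Finset.mem_univ, true_and] at hI
  obtain ⟨hI1, b, hb, hbodd, hev⟩ := hI
  have hcomp : ∃ k ∉ I, ¬ (2 : ℤ) ∣ p k b := by
    by_contra! hno
    have h2 : (2 : ℤ) ∣ ∑ k ∈ Iᶜ, p k b :=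
      Finset.dvd_sum fun k hk => hno k (by simpa using hk)
    have h3 := heven b
    rw [← Finset.sum_add_sum_compl I] at h3
    omega
  obtain ⟨k, hkI, hk⟩ := hcomp
  obtain ⟨c, hcb, hc2, hb1, hc1, hz⟩ := hother k b hk
  have hins : ∀ j, ∑ x ∈ insert k I, p x j = p k j + ∑ x ∈ I, p x j :=
    fun j => Finset.sum_insert hkI
  by_cases hci : c = i0
  · subst hci
    apply hcon
    refine ⟨insert k I, ?_, ?_⟩
    · intro j
      rw [hins]
      by_cases hjb : j = b
      · subst hjb; omega
      by_cases hjc : j = c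
      · subst hjc; omega
      rw [hz j hjb hjc, zero_add]
      exact hev j hjc hjb
    · rw [hins, hI1]
      rw [abs_of_nonneg (hpos k)] at hc1
      omega
  · have hmem : insert k I ∈ T := by
      simp only [T, Finset.mem_filter, Finset.mem_univ, true_and]
      refine ⟨?_, c, hci, ?_, ?_⟩
      · rw [hins, hz i0 hb.symm (Ne.symm hci), hI1]; norm_num
      · rw [hins]
        have := hev c hci hcb
        omega
      · intro j hj hjc
        rw [hins]
        by_cases hjb : j = b
        · subst hjb; omega
        · rw [hz j hjb hjc, zero_add]
          exact hev j hj hjb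
    have := hmax _ hmem
    rw [Finset.card_insert_of_notMem hkI] at this
    omega

lemma sub_between {ℓ : ℕ} (q : Fin ℓ → ℤ) (x y : ℤ) (hq : ∑ k, q k = y - x)
    (hc : ∀ k, |q k| ≤ |y - x| ∧ 0 ≤ q k * (y - x)) (I : Finset (Fin ℓ)) :
    min x y ≤ x + ∑ k ∈ I, q k ∧ x + ∑ k ∈ I, q k ≤ max x y := by
  have hs := Finset.sum_add_sum_compl I q
  rcases lt_trichotomy x y with h | h | h
  · have hp : ∀ k, 0 ≤ q k := fun k => by
      have := (hc k).2
      exact nonneg_of_mul_nonneg_left this (by omega)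
    have h1 := Finset.sum_nonneg (s := I) fun k _ => hp k
    have h2 := Finset.sum_nonneg (s := Iᶜ) fun k _ => hp k
    omega
  · have hp : ∀ k, q k = 0 := fun k => by
      have := (hc k).1
      rw [h, sub_self, abs_zero] at this
      exact abs_nonpos_iff.mp this
    simp [hp]
  · have hp : ∀ k, q k ≤ 0 := fun k => by
      have := (hc k).2
      by_contra! hh
      nlinarith
    have h1 := Finset.sum_nonpos (s := I) fun k _ => hp k
    have h2 := Finset.sum_nonpos (s := Iᶜ) fun k _ => hp k
    omega

lemma exchange {m : ℕ} (f : (Fin m → ℤ) → EReal)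
    (hrange : ∀ z, f z = ⊤ ∨ ∃ q : ℚ, f z = ((q : ℝ) : EReal))
    (hf : SBOJumpMConvex f) (x y : Fin m → ℤ) (hx : f x ≠ ⊤) (hy : f y ≠ ⊤)
    (hpar : ∀ i, (2 : ℤ) ∣ y i - x i) (i0 : Fin m) (h0 : x i0 < y i0) :
    ∃ x' y' : Fin m → ℤ, f x' ≠ ⊤ ∧ f y' ≠ ⊤ ∧
      (f x').toReal + (f y').toReal ≤ (f x).toReal + (f y).toReal ∧
      (∀ i, x' i + y' i = x i + y i) ∧
      (∀ i, (2 : ℤ) ∣ x' i - x i) ∧ x' i0 = x i0 + 2 ∧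
      (∀ i, min (x i) (y i) ≤ x' i ∧ x' i ≤ max (x i) (y i)) := by
  obtain ⟨ℓ, p, g, ⟨hp, hps⟩, hfy, hI⟩ := hf x y hx.lt_top hy.lt_top
  obtain ⟨I, hIe, hI2⟩ := graph_aux p (fun k => (hp k).1) i0
    (fun k => by
      have := ((hp k).2 i0).2
      exact nonneg_of_mul_nonneg_left this (by simpa using h0))
    (fun i => by rw [hps i]; exact hpar i) (by rw [hps i0]; simpa using h0)
  have hbet := fun i (J : Finset (Fin ℓ)) => sub_between (fun k => p k i) (x i) (y i) (hps i)
    (fun k => (hp k).2 i) J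
  have hs := fun i => Finset.sum_add_sum_compl I (fun k => p k i)
  have hg := Finset.sum_add_sum_compl I g
  have hA := hI I
  have hB := hI Iᶜ
  obtain ⟨a, ha⟩ := (hrange x).resolve_left hx
  obtain ⟨b, hb⟩ := (hrange y).resolve_left hy
  rw [ha, ← EReal.coe_add] at hA hB
  have hA' := (hA.trans_lt (EReal.coe_lt_top _)).ne
  have hB' := (hB.trans_lt (EReal.coe_lt_top _)).ne
  refine ⟨_, _, hA', hB', ?_, ?_, ?_, ?_, ?_⟩
  · obtain ⟨a', ha'⟩ := (hrange _).resolve_left hA'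
    obtain ⟨b', hb'⟩ := (hrange _).resolve_left hB'
    rw [ha'] at hA ⊢
    rw [hb'] at hB ⊢
    rw [ha, hb, ← EReal.coe_add] at hfy
    rw [ha, hb]
    simp only [EReal.toReal_coe]
    have e1 := EReal.coe_le_coe_iff.mp hA
    have e2 := EReal.coe_le_coe_iff.mp hB
    have e3 := EReal.coe_eq_coe_iff.mp hfy
    linarith
  · intro i
    have h1 := hs i
    have h2 := hps i
    dsimp only at h1 h2 ⊢
    omega
  · intro i
    simpa using hIe i
  · simp [hI2]
  · intro i; exact hbet i I

lemma finite_core {m : ℕ} (f : (Fin m → ℤ) → EReal)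
    (hrange : ∀ z, f z = ⊤ ∨ ∃ q : ℚ, f z = ((q : ℝ) : EReal))
    (hf : SBOJumpMConvex f) (r : Fin m → ℤ) (N : ℤ) (S : Finset (Fin m → ℤ))
    (hS : ∀ x, x ∈ S ↔ (∀ i, -N ≤ x i ∧ x i ≤ N) ∧ (∀ i, (2 : ℤ) ∣ x i - r i) ∧ f x ≠ ⊤)
    (w0 : S → ℝ) (hw0 : w0 ∈ stdSimplex ℝ S) (z : Fin m → ℤ)
    (hz : ∀ i, ∑ s, w0 s * ((s.1 i : ℤ) : ℝ) = z i) (hzpar : ∀ i, (2 : ℤ) ∣ z i - r i) :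
    f z ≠ ⊤ ∧ (f z).toReal ≤ ∑ s, w0 s * (f s.1).toReal := by
  classical
  let L : (S → ℝ) → (S → ℝ) → ℝ := fun h w => ∑ s, w s * h s
  have hL : ∀ h, Continuous (L h) := fun h => by fun_prop
  let K : Set (S → ℝ) := stdSimplex ℝ S ∩
    ({w | ∀ i, L (fun s => ((s.1 i : ℤ) : ℝ)) w = z i} ∩
     {w | L (fun s => (f s.1).toReal) w ≤ L (fun s => (f s.1).toReal) w0})
  have hKc : IsCompact K := by
    apply (isCompact_stdSimplex ℝ S).inter_right
    apply IsClosed.inter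
    · rw [Set.ofPred_forall]
      exact isClosed_iInter fun i => isClosed_eq (hL _) continuous_const
    · exact isClosed_le (hL _) continuous_const
  have hKne : K.Nonempty := ⟨w0, hw0, hz, le_refl (L (fun s => (f s.1).toReal) w0)⟩
  let q : S → ℝ := fun s => ∑ i, ((s.1 i : ℤ) : ℝ) ^ 2
  obtain ⟨w, ⟨⟨hwn, hws⟩, hwz, hwF⟩, hmin⟩ := hKc.exists_isMinOn hKne (hL q).continuousOn
  have hall : ∀ s : S, w s ≠ 0 → s.1 = z := by
    by_contra! hne
    obtain ⟨s, hs, hsz⟩ := hne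
    obtain ⟨i, hi⟩ := Function.ne_iff.mp hsz
    have hzero : ∑ s : S, w s * (((s.1 i : ℤ) : ℝ) - z i) = 0 := by
      simp only [mul_sub, Finset.sum_sub_distrib, ← Finset.sum_mul, hws]
      have := hwz i
      simp only [L] at this
      rw [this]; ring
    have hnz : w s * (((s.1 i : ℤ) : ℝ) - z i) ≠ 0 :=
      mul_ne_zero hs (sub_ne_zero.mpr (by exact_mod_cast hi))
    obtain ⟨y, -, hy⟩ := Finset.exists_pos_of_sum_zero_of_exists_nonzero _ hzero
      ⟨s, Finset.mem_univ _, hnz⟩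
    obtain ⟨x, -, hx⟩ := Finset.exists_pos_of_sum_zero_of_exists_nonzero
      (s := Finset.univ) (fun s : S => -(w s * (((s.1 i : ℤ) : ℝ) - z i)))
      (by rw [Finset.sum_neg_distrib, hzero, neg_zero])
      ⟨s, Finset.mem_univ _, neg_ne_zero.mpr hnz⟩
    have hyw : 0 < w y := (hwn y).lt_of_ne (by rintro h; rw [← h] at hy; simp at hy)
    have hxw : 0 < w x := (hwn x).lt_of_ne (by rintro h; rw [← h] at hx; simp at hx)
    have hyz : z i < y.1 i := by
      have : (z i : ℝ) < y.1 i := by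
        have := pos_of_mul_pos_right hy hyw.le
        linarith
      exact_mod_cast this
    have hxz : x.1 i < z i := by
      have : (x.1 i : ℝ) < z i := by
        by_contra! hh
        have := mul_nonneg hxw.le (sub_nonneg.mpr hh)
        linarith
      exact_mod_cast this
    obtain ⟨hxN, hxr, hxf⟩ := (hS x).mp x.2
    obtain ⟨hyN, hyr, hyf⟩ := (hS y).mp y.2
    obtain ⟨x', y', hxf', hyf', hF, hsum, hpar', hi0, hbet⟩ := exchange f hrange hf x y hxf hyf
      (fun i => by have := hxr i; have := hyr i; omega) i (by omega)
    have hx'S : x' ∈ S := (hS x').mpr ⟨fun j => by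
        have := hbet j; have := hxN j; have := hyN j; omega,
      fun j => by have := hpar' j; have := hxr j; omega, hxf'⟩
    have hy'S : y' ∈ S := (hS y').mpr ⟨fun j => by
        have := hbet j; have := hxN j; have := hyN j; have := hsum j; omega,
      fun j => by
        have := hpar' j; have := hxr j; have := hyr j; have := hsum j; omega, hyf'⟩
    have hxy : x ≠ y := by rintro rfl; omega
    set ε := min (w x) (w y) with hε
    have hεpos : 0 < ε := lt_min hxw hyw
    let w' : S → ℝ := fun s => w s + ε * ((Pi.single ⟨x', hx'S⟩ 1 : S → ℝ) s
      + (Pi.single ⟨y', hy'S⟩ 1 : S → ℝ) s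
      - (Pi.single x 1 : S → ℝ) s - (Pi.single y 1 : S → ℝ) s)
    have hw'L : ∀ h, L h w' = L h w + ε * (h ⟨x', hx'S⟩ + h ⟨y', hy'S⟩ - h x - h y) := by
      intro h
      have e : ∀ a : S, ∑ s, (Pi.single a (1:ℝ) : S → ℝ) s * h s = h a := by
        intro a
        simp [Pi.single_apply]
      rw [← e ⟨x', hx'S⟩, ← e ⟨y', hy'S⟩, ← e x, ← e y]
      simp only [L, w', ← Finset.sum_add_distrib, ← Finset.sum_sub_distrib, Finset.mul_sum]
      exact Finset.sum_congr rfl fun s _ => by ring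
    have hw'n : ∀ s, 0 ≤ w' s := by
      intro s
      have hsn : ∀ a : S, 0 ≤ (Pi.single a (1:ℝ) : S → ℝ) s := by
        intro a
        simp only [Pi.single_apply]; split_ifs <;> norm_num
      have h1 := mul_nonneg hεpos.le (hsn ⟨x', hx'S⟩)
      have h2 := mul_nonneg hεpos.le (hsn ⟨y', hy'S⟩)
      have h3 : ε * ((Pi.single x (1:ℝ) : S → ℝ) s + (Pi.single y (1:ℝ) : S → ℝ) s) ≤ w s := by
        by_cases hsx : s = x
        · subst hsx
          simp [Pi.single_apply, hxy, hε]
        by_cases hsy : s = y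
        · subst hsy
          simp [Pi.single_apply, hsx, hε]
        simpa [Pi.single_apply, hsx, hsy] using hwn s
      simp only [w']
      linarith
    have hw'K : w' ∈ K := by
      refine ⟨⟨hw'n, ?_⟩, ?_, ?_⟩
      · have := hw'L (fun _ => 1)
        simp only [L, mul_one] at this
        rw [this, hws]; ring
      · intro j
        rw [hw'L, hwz j]
        have : (x' j : ℝ) + y' j = x.1 j + y.1 j := by exact_mod_cast hsum j
        dsimp only
        rw [this]; ring
      · change L _ w' ≤ _
        rw [hw'L]
        refine le_trans ?_ hwF
        have := mul_nonneg hεpos.le (sub_nonneg.mpr hF)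
        dsimp only
        linarith
    have hm : L q w ≤ L q w' := hmin hw'K
    rw [hw'L] at hm
    have hqlt : ∑ j, (x' j ^ 2 + y' j ^ 2) < ∑ j, (x.1 j ^ 2 + y.1 j ^ 2) := by
      apply Finset.sum_lt_sum
      · intro j _
        have h1 := hsum j
        have h2 := hbet j
        have h3 : y' j = x.1 j + y.1 j - x' j := by omega
        have h4 : 0 ≤ (x' j - x.1 j) * (y.1 j - x' j) := by
          rcases le_total (x.1 j) (y.1 j) with h | h
          · exact mul_nonneg (by omega) (by omega)
          · exact mul_nonneg_of_nonpos_of_nonpos (by omega) (by omega)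
        rw [h3]
        nlinarith
      · refine ⟨i, Finset.mem_univ _, ?_⟩
        have h1 := hsum i
        have h3 : y' i = y.1 i - 2 := by omega
        have h4 : x.1 i + 4 ≤ y.1 i := by
          have := hxr i; have := hyr i; have := hzpar i; omega
        rw [h3, hi0]
        nlinarith
    have hqlt' : q ⟨x', hx'S⟩ + q ⟨y', hy'S⟩ < q x + q y := by
      simp only [q, ← Finset.sum_add_distrib]
      exact_mod_cast hqlt
    have := mul_pos hεpos (sub_pos.mpr hqlt')
    linarith
  have hex : ∃ s : S, w s ≠ 0 := by
    by_contra! hh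
    simp [hh] at hws
  obtain ⟨s, hs⟩ := hex
  have hsz := hall s hs
  have hfz : f z ≠ ⊤ := by rw [← hsz]; exact ((hS s).mp s.2).2.2
  refine ⟨hfz, ?_⟩
  have e : L (fun s => (f s.1).toReal) w = (f z).toReal := by
    have : L (fun s => (f s.1).toReal) w = ∑ s, w s * (f z).toReal := by
      apply Finset.sum_congr rfl
      intro t _
      by_cases ht : w t = 0
      · simp [ht]
      · simp only [hall t ht]
    rw [this, ← Finset.sum_mul, hws, one_mul]
  have h2 : L (fun s => (f s.1).toReal) w ≤ L (fun s => (f s.1).toReal) w0 := hwF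
  rw [e] at h2
  exact h2

lemma coe_sum_ereal {ι : Type*} (s : Finset ι) (g : ι → ℝ) :
    ((∑ k ∈ s, g k : ℝ) : EReal) = ∑ k ∈ s, (g k : EReal) := by
  classical
  induction s using Finset.induction_on with
  | empty => simp
  | insert a s ha ih => rw [Finset.sum_insert ha, Finset.sum_insert ha, EReal.coe_add, ih]

lemma sum_ne_bot_ereal {ι : Type*} (s : Finset ι) (g : ι → EReal) (h : ∀ k ∈ s, g k ≠ ⊥) :
    ∑ k ∈ s, g k ≠ ⊥ := by
  classical
  induction s using Finset.induction_on with
  | empty => simp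
  | insert a s ha ih =>
    rw [Finset.sum_insert ha]
    rw [Ne, EReal.add_eq_bot_iff]
    push Not
    exact ⟨h a (by simp), ih fun k hk => h k (by simp [hk])⟩

theorem statement3 {m : ℕ} (f : (Fin m → ℤ) → EReal)
    (hrange : ∀ z, f z = ⊤ ∨ ∃ q : ℚ, f z = ((q : ℝ) : EReal))
    (hf : SBOJumpMConvex f)
    (r : Fin m → ℤ) (ℓ : ℕ) (hℓ : 1 ≤ ℓ)
    (zs : Fin ℓ → Fin m → ℤ)
    (hpar : ∀ k i, (2 : ℤ) ∣ (zs k i - r i))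
    (lam : Fin ℓ → ℝ) (hlam : ∀ k, 0 ≤ lam k)
    (hsum : ∑ k, lam k = 1)
    (z : Fin m → ℤ)
    (hz : ∀ i, (z i : ℝ) = ∑ k, lam k * (zs k i : ℝ))
    (hzpar : ∀ i, (2 : ℤ) ∣ (z i - r i)) :
    f z ≤ ∑ k, ((lam k : EReal) * f (zs k)) := by
  classical
  by_cases htop : ∃ k, 0 < lam k ∧ f (zs k) = ⊤
  · obtain ⟨k, hk, hfk⟩ := htop
    have : ∑ k, ((lam k : EReal) * f (zs k)) = ⊤ := by
      rw [← Finset.add_sum_erase _ _ (Finset.mem_univ k), hfk, EReal.coe_mul_top_of_pos hk]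
      apply EReal.top_add_of_ne_bot
      apply sum_ne_bot_ereal
      intro j _
      rcases hrange (zs j) with h | ⟨q, h⟩
      · rw [h]
        rcases (hlam j).eq_or_lt with h0 | h0
        · rw [← h0]; simp
        · rw [EReal.coe_mul_top_of_pos h0]; simp
      · rw [h, ← EReal.coe_mul]; exact EReal.coe_ne_bot _
    rw [this]; exact le_top
  push Not at htop
  let N : ℤ := ∑ k, ∑ i, |zs k i|
  have hN : ∀ k i, |zs k i| ≤ N := by
    intro k i
    calc |zs k i| ≤ ∑ i, |zs k i| := Finset.single_le_sum (f := fun i => |zs k i|)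
          (fun j _ => abs_nonneg _) (Finset.mem_univ i)
      _ ≤ N := Finset.single_le_sum (f := fun k => ∑ i, |zs k i|)
          (fun j _ => Finset.sum_nonneg fun _ _ => abs_nonneg _) (Finset.mem_univ k)
  let S : Finset (Fin m → ℤ) := (Fintype.piFinset fun _ : Fin m => Finset.Icc (-N) N).filter
    fun x => (∀ i, (2 : ℤ) ∣ x i - r i) ∧ f x ≠ ⊤
  have hS : ∀ x, x ∈ S ↔ (∀ i, -N ≤ x i ∧ x i ≤ N) ∧ (∀ i, (2 : ℤ) ∣ x i - r i) ∧ f x ≠ ⊤ := by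
    intro x
    simp [S, Fintype.mem_piFinset]
  have hzS : ∀ k, lam k ≠ 0 → zs k ∈ S := fun k hk => (hS _).mpr
    ⟨fun i => abs_le.mp (hN k i), hpar k, htop k ((hlam k).lt_of_ne hk.symm)⟩
  let w0 : S → ℝ := fun s => ∑ k, if zs k = s.1 then lam k else 0
  have hw : ∀ h : (Fin m → ℤ) → ℝ, ∑ s, w0 s * h s.1 = ∑ k, lam k * h (zs k) := by
    intro h
    simp only [w0, Finset.sum_mul]
    rw [Finset.sum_comm]
    apply Finset.sum_congr rfl
    intro k _
    by_cases hk : lam k = 0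
    · simp [hk]
    · rw [Finset.sum_eq_single ⟨zs k, hzS k hk⟩]
      · simp
      · intro b _ hb
        rw [if_neg, zero_mul]
        intro h
        exact hb (Subtype.ext h.symm)
      · simp
  have hw1 := hw (fun _ => 1)
  simp only [mul_one, hsum] at hw1
  obtain ⟨h1, h2⟩ := finite_core f hrange hf r N S hS w0
    ⟨fun s => Finset.sum_nonneg fun k _ => by split_ifs; exacts [hlam k, le_refl _], hw1⟩ z
    (fun i => by rw [hz i]; exact hw (fun x => (x i : ℝ))) hzpar
  rw [hw (fun x => (f x).toReal)] at h2
  have e : ∑ k, ((lam k : EReal) * f (zs k))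
      = ((∑ k, lam k * (f (zs k)).toReal : ℝ) : EReal) := by
    rw [coe_sum_ereal]
    apply Finset.sum_congr rfl
    intro k _
    by_cases hk : lam k = 0
    · simp [hk]
    · obtain ⟨q, h⟩ := (hrange (zs k)).resolve_left ((hS _).mp (hzS k hk)).2.2
      rw [h, EReal.toReal_coe, EReal.coe_mul]
  rw [e]
  obtain ⟨q, h⟩ := (hrange z).resolve_left h1
  rw [h] at h2 ⊢
  rw [EReal.toReal_coe] at h2
  exact EReal.coe_le_coe_iff.mpr h2
end

section
/- Let m, n ≥ 1, let M ∈ {0,1}^{m×n} be the incidence matrix of a simple graph, let c ∈ ℤ^n, let r ∈ ℤ^m and let U ∈ ℕ. Define S ⊆ ℝ × ℝ^m as the set of all pairs (ω, z) such that z has integer entries, z ≡ r (mod 2) componentwise, ‖z‖_∞ ≤ U, and there exists x ∈ ℤ^n with x ≥ 0, Mx = z and cᵀx ≤ ω. If (ω, z) ∈ ℝ × ℝ^m lies in the convex hull of S, z has integer entries and z ≡ r (mod 2), then there exists x ∈ ℤ^n with x ≥ 0, Mx = z and cᵀx ≤ ω. -/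
open Matrix BigOperators

/-- `h` lies coordinatewise between `0` and `g`. -/
def Btw0 (h g : ℤ) : Prop := (0 ≤ h ∧ h ≤ g) ∨ (g ≤ h ∧ h ≤ 0)

/-- Alternating-trail argument in a bidirected graph with a distinguished loop `l` at `i`. -/
lemma walk_aux {V E : Type*} [DecidableEq V] [Fintype E] [DecidableEq E] (A : V → E → ℤ)
    (hA : ∀ e v, A v e ≠ 0 → ∃ ε t : ℤ, ∃ w : V, (ε = 1 ∨ ε = -1) ∧ (t = 1 ∨ t = -1) ∧
      0 < ε * A v e ∧ ∀ v', A v' e = (if v' = v then ε else 0) + (if v' = w then t else 0))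
    (g : E → ℤ) (hg : ∀ v, ∑ e, A v e * g e = 0) (i : V) (l : E)
    (hl : ∀ v, A v l = if v = i then -2 else 0) (hgl : 0 < g l) :
    ∀ (N : ℕ) (h : E → ℤ) (v : V) (s : ℤ), (s = 1 ∨ s = -1) → (∀ e, Btw0 (h e) (g e)) →
      h l = 0 →
      (∀ v', ∑ e, A v' e * h e = (if v' = i then 1 else 0) + (if v' = v then s else 0)) →
      ∑ e, (g e - h e).natAbs < N →
      ∃ h' : E → ℤ, (∀ e, Btw0 (h' e) (g e)) ∧ (∀ v', ∑ e, A v' e * h' e = 0) ∧ h' l = 1 := by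
  intro N
  induction N with
  | zero => intro h v s _ _ _ _ hN; omega
  | succ N ih =>
    intro h v s hs hc hhl hh hN
    have hadd : ∀ (e : E) (δ : ℤ) (v' : V), ∑ e', A v' e' * (h + Pi.single e δ : E → ℤ) e' =
        ∑ e', A v' e' * h e' + A v' e * δ := by
      intro e δ v'
      simp [mul_add, Finset.sum_add_distrib, Pi.single_apply]
    by_cases hfin : v = i ∧ s = 1
    · obtain ⟨rfl, rfl⟩ := hfin
      refine ⟨h + Pi.single l 1, ?_, ?_, ?_⟩
      · intro e
        by_cases he : e = l
        · subst he
          simp only [Pi.add_apply, Pi.single_eq_same, Btw0]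
          omega
        · simpa [Pi.single_apply, he] using hc e
      · intro v'
        rw [hadd, hh, hl]
        split_ifs <;> norm_num
      · simp [hhl]
    · have hsum : ∑ e, A v e * (g e - h e) = -(if v = i then 1 else 0) - s := by
        have h1 := hg v
        have h2 := hh v
        simp only [mul_sub, Finset.sum_sub_distrib, h1, h2]
        simp
        ring
      have hneg : ∑ e ∈ Finset.univ.erase l, s * (A v e * (g e - h e)) < 0 := by
        rw [← Finset.mul_sum]
        have h3 := Finset.add_sum_erase Finset.univ (fun e => A v e * (g e - h e))
          (Finset.mem_univ l)
        simp only [hsum, hl, hhl] at h3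
        by_cases hvi : v = i
        · have : s = -1 := by tauto
          subst this
          simp only [hvi, if_true] at h3 ⊢
          linarith
        · simp only [hvi, if_false] at h3
          rcases hs with rfl | rfl <;> linarith
      obtain ⟨e, he, hlt⟩ := Finset.exists_lt_of_sum_lt (s := Finset.univ.erase l)
        (f := fun e => s * (A v e * (g e - h e))) (g := fun _ => 0) (by simpa using hneg)
      have hel : e ≠ l := Finset.ne_of_mem_erase he
      have hAne : A v e ≠ 0 := by
        intro h0
        simp [h0] at hlt
      obtain ⟨ε, t, w, hε, ht, hpos, hcol⟩ := hA e v hAne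
      have key : ∃ δ : ℤ, (δ = 1 ∨ δ = -1) ∧ 0 < δ * (g e - h e) ∧ δ * ε = -s := by
        rcases lt_trichotomy (g e - h e) 0 with hn | hn | hn
        · refine ⟨-1, Or.inr rfl, by linarith, ?_⟩
          rcases hε with rfl | rfl <;> rcases hs with rfl | rfl <;> first | (norm_num; done) | (exfalso; nlinarith)
        · rw [hn] at hlt
          simp at hlt
        · refine ⟨1, Or.inl rfl, by linarith, ?_⟩
          rcases hε with rfl | rfl <;> rcases hs with rfl | rfl <;> first | (norm_num; done) | (exfalso; nlinarith)
      obtain ⟨δ, hδ, hδg, hδε⟩ := key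
      refine ih (h + Pi.single e δ) w (δ * t) ?_ ?_ ?_ ?_ ?_
      · rcases hδ with rfl | rfl <;> rcases ht with rfl | rfl <;> norm_num
      · intro e'
        by_cases he' : e' = e
        · subst he'
          have := hc e'
          simp only [Pi.add_apply, Pi.single_eq_same, Btw0] at this ⊢
          rcases hδ with rfl | rfl <;> omega
        · simpa [Pi.single_apply, he'] using hc e'
      · simp [Pi.single_apply, hel.symm, hhl]
      · intro v'
        rw [hadd, hh, hcol]
        have : s = -(δ * ε) := by linarith
        subst this
        split_ifs <;> ring
      · have : ∑ e', (g e' - (h + Pi.single e δ : E → ℤ) e').natAbs < ∑ e', (g e' - h e').natAbs := by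
          refine Finset.sum_lt_sum ?_ ⟨e, Finset.mem_univ _, ?_⟩
          · intro e' _
            by_cases he' : e' = e
            · subst he'
              simp only [Pi.add_apply, Pi.single_eq_same]
              rcases hδ with rfl | rfl <;> omega
            · simp [Pi.single_apply, he']
          · simp only [Pi.add_apply, Pi.single_eq_same]
            rcases hδ with rfl | rfl <;> omega
        omega

lemma exchange_aux {m n : ℕ} (M : Matrix (Fin m) (Fin n) ℤ) (hM : IsIncidenceOfSimpleGraph M)
    (g : Fin n → ℤ) (D : Fin m → ℤ) (hD : ∀ v, M.mulVec g v = 2 * D v) (i : Fin m)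
    (hi : 0 < D i) :
    ∃ (h : Fin n → ℤ) (u : Fin m → ℤ), (∀ j, Btw0 (h j) (g j)) ∧ (∀ v, Btw0 (u v) (D v)) ∧
      (∀ v, M.mulVec h v = 2 * u v) ∧ u i = 1 := by
  obtain ⟨hM1, hM2, -⟩ := hM
  obtain ⟨h', hc, hz, h1⟩ := walk_aux (V := Fin m) (E := Fin n ⊕ Fin m)
    (fun v e => Sum.elim (fun j => M v j) (fun k => if v = k then -2 else 0) e) (by
      rintro (j | k) v hne
      · simp only [Sum.elim_inl] at hne ⊢
        have hv : M v j = 1 := by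
          rcases hM1 v j with h | h
          · exact absurd h hne
          · exact h
        obtain ⟨a, b, hab, hS⟩ := Finset.card_eq_two.mp (hM2 j)
        have hmem : ∀ v', M v' j = 1 ↔ v' = a ∨ v' = b := by
          intro v'
          have : v' ∈ Finset.univ.filter (fun i => M i j = 1) ↔ v' ∈ ({a, b} : Finset (Fin m)) := by
            rw [hS]
          simpa using this
        have hval : ∀ v', M v' j = (if v' = a then 1 else 0) + (if v' = b then 1 else 0) := by
          intro v'
          have h1 := hmem v'
          have h2 := hM1 v' j
          by_cases ha : v' = a
          · have hb : v' ≠ b := fun h => hab (ha.symm.trans h)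
            simp [ha, hab]
            rw [← ha]
            exact h1.2 (Or.inl ha)
          · by_cases hb : v' = b
            · simp [hb, hab.symm]
              rw [← hb]
              exact h1.2 (Or.inr hb)
            · simp [ha, hb]
              tauto
        rcases (hmem v).1 hv with rfl | rfl
        · exact ⟨1, 1, b, Or.inl rfl, Or.inl rfl, by rw [hv]; norm_num, hval⟩
        · exact ⟨1, 1, a, Or.inl rfl, Or.inl rfl, by rw [hv]; norm_num,
            fun v' => by rw [hval v', add_comm]⟩
      · simp only [Sum.elim_inr] at hne ⊢
        have hvk : v = k := by
          by_contra h
          simp [h] at hne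
        subst hvk
        refine ⟨-1, -1, v, Or.inr rfl, Or.inr rfl, by simp, ?_⟩
        intro v'
        split_ifs <;> norm_num)
    (Sum.elim g D) (by
      intro v
      have := hD v
      simp only [Matrix.mulVec, dotProduct] at this
      simp [Fintype.sum_sum_type, this]) i (Sum.inr i)
    (by intro v; simp) (by simpa using hi)
    (∑ e, (Sum.elim g D e - 0).natAbs + 1) 0 i (-1) (Or.inr rfl)
    (by intro e; simp only [Pi.zero_apply, Btw0]; omega) rfl
    (by intro v'; simp; split_ifs <;> norm_num) (by simp)
  refine ⟨fun j => h' (Sum.inl j), fun k => h' (Sum.inr k), fun j => hc (Sum.inl j),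
    fun k => hc (Sum.inr k), ?_, h1⟩
  intro v
  have := hz v
  simp [Fintype.sum_sum_type] at this
  simp only [Matrix.mulVec, dotProduct]
  linarith

lemma pair_aux {m n : ℕ} (M : Matrix (Fin m) (Fin n) ℤ) (hM : IsIncidenceOfSimpleGraph M)
    (r : Fin m → ℤ) (U : ℤ) (x x' : Fin n → ℤ)
    (hx : (∀ j, 0 ≤ x j) ∧ (∀ i, (2 : ℤ) ∣ M.mulVec x i - r i) ∧ ∀ i, M.mulVec x i ≤ U)
    (hx' : (∀ j, 0 ≤ x' j) ∧ (∀ i, (2 : ℤ) ∣ M.mulVec x' i - r i) ∧ ∀ i, M.mulVec x' i ≤ U)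
    (i : Fin m) (hi : M.mulVec x' i + 4 ≤ M.mulVec x i) :
    ∃ y y' : Fin n → ℤ,
      ((∀ j, 0 ≤ y j) ∧ (∀ i, (2 : ℤ) ∣ M.mulVec y i - r i) ∧ ∀ i, M.mulVec y i ≤ U) ∧
      ((∀ j, 0 ≤ y' j) ∧ (∀ i, (2 : ℤ) ∣ M.mulVec y' i - r i) ∧ ∀ i, M.mulVec y' i ≤ U) ∧
      y + y' = x + x' ∧
      ∑ k, ((M.mulVec y k)^2 + (M.mulVec y' k)^2) <
        ∑ k, ((M.mulVec x k)^2 + (M.mulVec x' k)^2) := by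
  obtain ⟨h0, hp, hU⟩ := hx
  obtain ⟨h0', hp', hU'⟩ := hx'
  have hD : ∀ v, M.mulVec (x - x') v = 2 * ((M.mulVec x v - M.mulVec x' v) / 2) := by
    intro v
    have := hp v
    have := hp' v
    rw [Matrix.mulVec_sub, Pi.sub_apply]
    omega
  obtain ⟨h, u, hc, hu, hMh, hui⟩ := exchange_aux M hM (x - x') _ hD i (by omega)
  have e1 : ∀ v, M.mulVec (x - h) v = M.mulVec x v - 2 * u v := by
    intro v
    rw [Matrix.mulVec_sub, Pi.sub_apply, hMh]
  have e2 : ∀ v, M.mulVec (x' + h) v = M.mulVec x' v + 2 * u v := by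
    intro v
    rw [Matrix.mulVec_add, Pi.add_apply, hMh]
  have hD' : ∀ v, ∃ d, M.mulVec x v = M.mulVec x' v + 2 * d ∧ Btw0 (u v) d := by
    intro v
    refine ⟨_, ?_, hu v⟩
    have := hD v
    rw [Matrix.mulVec_sub, Pi.sub_apply] at this
    omega
  refine ⟨x - h, x' + h, ⟨?_, ?_, ?_⟩, ⟨?_, ?_, ?_⟩, ?_, ?_⟩
  · intro j
    have := hc j; have := h0 j; have := h0' j
    simp only [Btw0, Pi.sub_apply] at *
    omega
  · intro v
    have := hp v
    rw [e1]; omega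
  · intro v
    obtain ⟨d, h1, h2⟩ := hD' v
    have := hU v; have := hU' v
    rw [e1]
    simp only [Btw0] at h2
    omega
  · intro j
    have := hc j; have := h0 j; have := h0' j
    simp only [Btw0, Pi.sub_apply, Pi.add_apply] at *
    omega
  · intro v
    have := hp' v
    rw [e2]; omega
  · intro v
    obtain ⟨d, h1, h2⟩ := hD' v
    have := hU v; have := hU' v
    rw [e2]
    simp only [Btw0] at h2
    omega
  · abel
  · have hform : ∀ a d u : ℤ, (a + 2 * d)^2 + a^2 - ((a + 2 * d - 2 * u)^2 + (a + 2 * u)^2)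
        = 8 * (u * (d - u)) := by intros; ring
    refine Finset.sum_lt_sum ?_ ⟨i, Finset.mem_univ _, ?_⟩
    · intro v _
      obtain ⟨d, h1, h2⟩ := hD' v
      rw [e1, e2, h1]
      have h3 := hform (M.mulVec x' v) d (u v)
      have : 0 ≤ u v * (d - u v) := by
        rcases h2 with ⟨h4, h5⟩ | ⟨h4, h5⟩
        · exact mul_nonneg h4 (by linarith)
        · exact mul_nonneg_of_nonpos_of_nonpos h5 (by linarith)
      linarith
    · obtain ⟨d, h1, h2⟩ := hD' i
      rw [e1, e2, h1]
      have h3 := hform (M.mulVec x' i) d (u i)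
      have : 0 < u i * (d - u i) := by
        rw [hui]
        omega
      linarith

lemma feas_finite {m n : ℕ} (M : Matrix (Fin m) (Fin n) ℤ) (hM : IsIncidenceOfSimpleGraph M)
    (r : Fin m → ℤ) (U : ℤ) :
    {x : Fin n → ℤ | (∀ j, 0 ≤ x j) ∧ (∀ i, (2 : ℤ) ∣ M.mulVec x i - r i) ∧
      ∀ i, M.mulVec x i ≤ U}.Finite := by
  refine (Set.finite_Icc (0 : Fin n → ℤ) (fun _ => U)).subset ?_
  rintro x ⟨h0, -, hU⟩
  refine ⟨h0, fun j => ?_⟩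
  have hne : (Finset.univ.filter (fun i => M i j = 1)).Nonempty := by
    rw [← Finset.card_pos, hM.2.1 j]; norm_num
  obtain ⟨v, hv⟩ := hne
  have hv : M v j = 1 := by simpa using hv
  refine le_trans ?_ (hU v)
  have : M v j * x j ≤ ∑ k, M v k * x k :=
    Finset.single_le_sum (f := fun k => M v k * x k) (fun k _ => by
      have := h0 k
      rcases hM.1 v k with h | h <;> simp [h, this]) (Finset.mem_univ j)
  rw [hv, one_mul] at this
  exact this

/-- Minimizing a potential over the weights: the support consists of pairwise unimprovable
elements. -/
lemma weight_aux {X : Type*} [Fintype X] {I : Type*} (f : I → X → ℝ) (b : I → ℝ)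
    (C : X → ℝ) (ω : ℝ) (q : X → ℝ)
    (hne : ∃ w ∈ stdSimplex ℝ X, (∀ k, ∑ x, w x * f k x = b k) ∧ ∑ x, w x * C x ≤ ω) :
    ∃ w ∈ stdSimplex ℝ X, ((∀ k, ∑ x, w x * f k x = b k) ∧ ∑ x, w x * C x ≤ ω) ∧
      ∀ x x' y y', 0 < w x → 0 < w x' → x ≠ x' → (∀ k, f k y + f k y' = f k x + f k x') →
        C y + C y' = C x + C x' → q x + q x' ≤ q y + q y' := by
  classical
  have hK : IsCompact (stdSimplex ℝ X ∩
      {w | (∀ k, ∑ x, w x * f k x = b k) ∧ ∑ x, w x * C x ≤ ω}) := by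
    refine (isCompact_stdSimplex ℝ X).inter_right ?_
    have : {w : X → ℝ | (∀ k, ∑ x, w x * f k x = b k) ∧ ∑ x, w x * C x ≤ ω} =
      (⋂ k, {w : X → ℝ | ∑ x, w x * f k x = b k}) ∩ {w : X → ℝ | ∑ x, w x * C x ≤ ω} := by
      ext w; simp
    rw [this]
    refine IsClosed.inter (isClosed_iInter fun k => ?_) ?_
    · exact isClosed_eq (by fun_prop) continuous_const
    · exact isClosed_le (by fun_prop) continuous_const
  obtain ⟨w0, hw0, hw0'⟩ := hne
  obtain ⟨w, ⟨hw, hw'⟩, hmin⟩ := hK.exists_isMinOn ⟨w0, hw0, hw0'⟩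
    (f := fun w : X → ℝ => ∑ x, w x * q x) (by fun_prop)
  refine ⟨w, hw, hw', ?_⟩
  intro x x' y y' hx hx' hxx hf hC
  by_contra hlt
  push Not at hlt
  set μ := min (w x) (w x') with hμ
  have hμ0 : 0 < μ := lt_min hx hx'
  let w' : X → ℝ := w + Pi.single y μ + Pi.single y' μ - Pi.single x μ - Pi.single x' μ
  have hlin : ∀ F : X → ℝ, ∑ e, w' e * F e =
      ∑ e, w e * F e + μ * (F y + F y' - (F x + F x')) := by
    intro F
    simp only [w', Pi.add_apply, Pi.sub_apply, add_mul, sub_mul, Finset.sum_add_distrib,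
      Finset.sum_sub_distrib, Pi.single_apply, ite_mul, zero_mul, Finset.sum_ite_eq',
      Finset.mem_univ, if_true]
    ring
  have hmem : w' ∈ stdSimplex ℝ X := by
    constructor
    · intro e
      have h1 : 0 ≤ (Pi.single y μ : X → ℝ) e := by
        rw [Pi.single_apply]; split_ifs <;> linarith
      have h2 : 0 ≤ (Pi.single y' μ : X → ℝ) e := by
        rw [Pi.single_apply]; split_ifs <;> linarith
      have h3 : (Pi.single x μ : X → ℝ) e + (Pi.single x' μ : X → ℝ) e ≤ w e := by
        rw [Pi.single_apply, Pi.single_apply]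
        have := hw.1 e
        have := min_le_left (w x) (w x')
        have := min_le_right (w x) (w x')
        by_cases ha : e = x
        · subst ha
          simp [hxx, hμ]
        · by_cases hb : e = x'
          · subst hb
            simp [ha, hμ]
          · simp [ha, hb]; assumption
      simp only [w', Pi.add_apply, Pi.sub_apply]
      linarith
    · have := hlin (fun _ => 1)
      simp only [mul_one] at this
      rw [this, hw.2]; ring
  have := hmin (a := w') ⟨hmem, fun k => by rw [hlin, hf, hw'.1]; ring, by
    rw [hlin, hC]; simpa using hw'.2⟩
  simp only [Set.mem_ofPred_eq, hlin] at this
  nlinarith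

theorem statement4 {m n : ℕ} (hm : 1 ≤ m) (hn : 1 ≤ n)
    (M : Matrix (Fin m) (Fin n) ℤ) (hM : IsIncidenceOfSimpleGraph M)
    (c : Fin n → ℤ) (r : Fin m → ℤ) (U : ℕ)
    (S : Set (ℝ × (Fin m → ℝ)))
    (hS : S = {p : ℝ × (Fin m → ℝ) | ∃ z : Fin m → ℤ,
      (∀ i, p.2 i = (z i : ℝ)) ∧
      (∀ i, (2 : ℤ) ∣ (z i - r i)) ∧
      (∀ i, |z i| ≤ (U : ℤ)) ∧
      ∃ x : Fin n → ℤ, (∀ j, 0 ≤ x j) ∧ M.mulVec x = z ∧ ((c ⬝ᵥ x : ℤ) : ℝ) ≤ p.1})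
    (ω : ℝ) (zR : Fin m → ℝ) (hmem : (ω, zR) ∈ convexHull ℝ S)
    (z : Fin m → ℤ) (hzR : ∀ i, zR i = (z i : ℝ))
    (hzpar : ∀ i, (2 : ℤ) ∣ (z i - r i)) :
    ∃ x : Fin n → ℤ, (∀ j, 0 ≤ x j) ∧ M.mulVec x = z ∧ ((c ⬝ᵥ x : ℤ) : ℝ) ≤ ω := by
  classical
  let F : Set (Fin n → ℤ) := {x : Fin n → ℤ | (∀ j, 0 ≤ x j) ∧
    (∀ i, (2 : ℤ) ∣ M.mulVec x i - r i) ∧ ∀ i, M.mulVec x i ≤ (U : ℤ)}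
  have hF : F.Finite := feas_finite M hM r U
  haveI : Fintype F := hF.fintype
  have hex : ∃ w ∈ stdSimplex ℝ F,
      (∀ k, ∑ x : F, w x * ((M.mulVec x.1 k : ℤ) : ℝ) = zR k) ∧
        ∑ x : F, w x * ((c ⬝ᵥ x.1 : ℤ) : ℝ) ≤ ω := by
    let T : Set (ℝ × (Fin m → ℝ)) := {p | ∃ w ∈ stdSimplex ℝ F,
      (∀ k, ∑ x : F, w x * ((M.mulVec x.1 k : ℤ) : ℝ) = p.2 k) ∧
        ∑ x : F, w x * ((c ⬝ᵥ x.1 : ℤ) : ℝ) ≤ p.1}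
    have hT : Convex ℝ T := by
      rintro p ⟨w, hw, h1, h2⟩ p' ⟨w', hw', h1', h2'⟩ a b ha hb hab
      refine ⟨a • w + b • w', convex_stdSimplex ℝ F hw hw' ha hb hab, ?_, ?_⟩
      · intro k
        simp only [Pi.add_apply, Pi.smul_apply, smul_eq_mul, add_mul, mul_assoc,
          Finset.sum_add_distrib, ← Finset.mul_sum, h1, h1', Prod.snd_add, Prod.smul_snd]
      · simp only [Pi.add_apply, Pi.smul_apply, smul_eq_mul, add_mul, mul_assoc,
          Finset.sum_add_distrib, ← Finset.mul_sum, Prod.fst_add, Prod.smul_fst]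
        exact add_le_add (mul_le_mul_of_nonneg_left h2 ha) (mul_le_mul_of_nonneg_left h2' hb)
    have hST : S ⊆ T := by
      rw [hS]
      rintro p ⟨z', hz1, hz2, hz3, x, hx0, hxz, hxc⟩
      have hxF : x ∈ F := ⟨hx0, fun i => by rw [hxz]; exact hz2 i,
        fun i => by rw [hxz]; exact (le_abs_self _).trans (hz3 i)⟩
      refine ⟨Pi.single ⟨x, hxF⟩ 1, single_mem_stdSimplex ℝ _, ?_, ?_⟩
      · intro k
        simp [Pi.single_apply, hxz, hz1]
      · simpa [Pi.single_apply] using hxc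
    exact convexHull_min hST hT hmem
  obtain ⟨w, hw, ⟨hwz, hwc⟩, hopt⟩ := weight_aux
    (fun (k : Fin m) (x : F) => ((M.mulVec x.1 k : ℤ) : ℝ)) zR
    (fun x : F => ((c ⬝ᵥ x.1 : ℤ) : ℝ)) ω
    (fun x : F => ((∑ k, (M.mulVec x.1 k)^2 : ℤ) : ℝ)) hex
  have hclose : ∀ x x' : F, 0 < w x → 0 < w x' → ∀ i,
      M.mulVec x.1 i < M.mulVec x'.1 i + 4 := by
    intro x x' hx hx' i
    by_contra hlt
    push Not at hlt
    obtain ⟨y, y', hy, hy', hsum, hq⟩ := pair_aux M hM r U x.1 x'.1 x.2 x'.2 i hlt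
    have hne : x ≠ x' := by
      rintro rfl
      omega
    have := hopt x x' ⟨y, hy⟩ ⟨y', hy'⟩ hx hx' hne (by
      intro k
      have : M.mulVec (y + y') k = M.mulVec (x.1 + x'.1) k := by rw [hsum]
      simp only [Matrix.mulVec_add, Pi.add_apply] at this
      exact_mod_cast this) (by
      have : c ⬝ᵥ (y + y') = c ⬝ᵥ (x.1 + x'.1) := by rw [hsum]
      simp only [dotProduct_add] at this
      exact_mod_cast this)
    simp only [Finset.sum_add_distrib] at hq
    have h2 : (∑ k, (M.mulVec x.1 k)^2) + (∑ k, (M.mulVec x'.1 k)^2) ≤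
        (∑ k, (M.mulVec y k)^2) + (∑ k, (M.mulVec y' k)^2) := by exact_mod_cast this
    linarith
  have hzero : ∀ i, ∑ x : F, w x * (((M.mulVec x.1 i : ℤ) : ℝ) - z i) = 0 := by
    intro i
    simp only [mul_sub, Finset.sum_sub_distrib, hwz, ← Finset.sum_mul, hw.2, hzR]
    ring
  have hEq : ∀ x : F, 0 < w x → M.mulVec x.1 = z := by
    intro x hx
    funext i
    rcases lt_trichotomy (M.mulVec x.1 i) (z i) with hlt | heq | hgt
    · exfalso
      have : ∑ x : F, w x * (((M.mulVec x.1 i : ℤ) : ℝ) - z i) < ∑ x : F, (0:ℝ) := by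
        refine Finset.sum_lt_sum ?_ ⟨x, Finset.mem_univ _, ?_⟩
        · intro x' _
          rcases (hw.1 x').eq_or_lt with h0 | h0
          · simp [← h0]
          · have h1 := hclose x' x h0 hx i
            have h2 := x.2.2.1 i
            have h3 := x'.2.2.1 i
            have h4 := hzpar i
            have h5 : M.mulVec x'.1 i ≤ z i := by omega
            have h6 : ((M.mulVec x'.1 i : ℤ) : ℝ) ≤ z i := by exact_mod_cast h5
            nlinarith
        · have h6 : ((M.mulVec x.1 i : ℤ) : ℝ) < z i := by exact_mod_cast hlt
          nlinarith
      rw [hzero i] at this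
      simp at this
    · exact heq
    · exfalso
      have : ∑ x : F, (0:ℝ) < ∑ x : F, w x * (((M.mulVec x.1 i : ℤ) : ℝ) - z i) := by
        refine Finset.sum_lt_sum ?_ ⟨x, Finset.mem_univ _, ?_⟩
        · intro x' _
          rcases (hw.1 x').eq_or_lt with h0 | h0
          · simp [← h0]
          · have h1 := hclose x x' hx h0 i
            have h2 := x.2.2.1 i
            have h3 := x'.2.2.1 i
            have h4 := hzpar i
            have h5 : z i ≤ M.mulVec x'.1 i := by omega
            have h6 : (z i : ℝ) ≤ ((M.mulVec x'.1 i : ℤ) : ℝ) := by exact_mod_cast h5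
            nlinarith
        · have h6 : (z i : ℝ) < ((M.mulVec x.1 i : ℤ) : ℝ) := by exact_mod_cast hgt
          nlinarith
      rw [hzero i] at this
      simp at this
  by_contra hno
  push Not at hno
  have hbig : ∀ x : F, 0 < w x → ω < ((c ⬝ᵥ x.1 : ℤ) : ℝ) := fun x hx =>
    hno x.1 x.2.1 (hEq x hx)
  have hpos : ∃ x : F, 0 < w x := by
    by_contra h
    push Not at h
    have h1 : ∑ x : F, w x ≤ 0 := Finset.sum_nonpos fun x _ => h x
    rw [hw.2] at h1
    linarith
  obtain ⟨x, hx⟩ := hpos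
  have : ∑ x : F, w x * ω < ∑ x : F, w x * ((c ⬝ᵥ x.1 : ℤ) : ℝ) := by
    refine Finset.sum_lt_sum ?_ ⟨x, Finset.mem_univ _, mul_lt_mul_of_pos_left (hbig x hx) hx⟩
    intro x' _
    rcases (hw.1 x').eq_or_lt with h0 | h0
    · simp [← h0]
    · exact (mul_lt_mul_of_pos_left (hbig x' h0) h0).le
  rw [← Finset.sum_mul, hw.2, one_mul] at this
  linarith
end

section
/- Let Δ ≥ 1 and let A be the (h+m) × (p+n) integer block matrix A = [[C, W], [T, M]], where C ∈ ℤ^{h×p}, W ∈ ℤ^{h×n} and T ∈ ℤ^{m×p} have all entries of absolute value at most Δ, and M ∈ ℤ^{m×n} has every column of 1-norm at most 2. Let r be the rank of A (as a matrix over ℚ). Then every circuit g of A satisfies ‖g‖_∞ ≤ (Δ·(r+1))^{p+h} · 2^{2p+3h+3}. -/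
open Matrix BigOperators

/-- A circuit of an integer matrix `A`: a nonzero integer kernel vector with
inclusion-minimal support among nonzero integer kernel vectors, whose entries
have greatest common divisor `1`. -/
def IsCircuit {s t : Type*} [Fintype s] [Fintype t] (A : Matrix s t ℤ) (g : t → ℤ) : Prop :=
  g ≠ 0 ∧ A.mulVec g = 0 ∧
  (∀ g' : t → ℤ, g' ≠ 0 → A.mulVec g' = 0 →
    {j | g' j ≠ 0} ⊆ {j | g j ≠ 0} → {j | g' j ≠ 0} = {j | g j ≠ 0}) ∧
  Finset.univ.gcd g = 1

theorem rk_add_le {a b : Type*} [Fintype a] [Fintype b] {F : Type*} [Field F]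
    (A B : Matrix a b F) : (A + B).rank ≤ A.rank + B.rank := by
  unfold Matrix.rank
  refine le_trans ?_ (Submodule.finrank_add_le_finrank_add_finrank _ _)
  apply Submodule.finrank_mono
  rintro _ ⟨x, rfl⟩
  rw [Matrix.mulVecLin_add, LinearMap.add_apply]
  exact Submodule.add_mem_sup ⟨x, rfl⟩ ⟨x, rfl⟩

/-- zero row and zero column can be removed -/
theorem rk_pad {s : ℕ} {F : Type*} [Field F] (Z : Matrix (Fin (s+1)) (Fin (s+1)) F)
    (i j : Fin (s+1)) (hi : ∀ k, Z i k = 0) (hj : ∀ k, Z k j = 0) :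
    Z.rank ≤ (Z.submatrix i.succAbove j.succAbove).rank := by
  let P : Matrix (Fin (s+1)) (Fin s) F := .of fun a b => if a = i.succAbove b then 1 else 0
  let P' : Matrix (Fin s) (Fin (s+1)) F := .of fun b a => if j.succAbove b = a then 1 else 0
  have : Z = P * (Z.submatrix i.succAbove j.succAbove) * P' := by
    ext x y
    rw [Matrix.mul_apply]
    simp only [Matrix.mul_apply, Matrix.submatrix_apply, P, P', Matrix.of_apply]
    rcases Fin.eq_self_or_eq_succAbove j y with rfl | ⟨y, rfl⟩
    · simp [hj, Fin.succAbove_ne]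
    · rcases Fin.eq_self_or_eq_succAbove i x with rfl | ⟨x, rfl⟩
      · simp [hi, (Fin.succAbove_ne _ _).symm]
      · simp
  calc Z.rank = _ := congrArg Matrix.rank this
    _ ≤ _ := Matrix.rank_mul_le_left _ _
    _ ≤ _ := Matrix.rank_mul_le_right _ _

theorem rk_minor {s : ℕ} {F : Type*} [Field F] (X : Matrix (Fin (s+1)) (Fin (s+1)) F)
    (i j : Fin (s+1)) :
    X.rank ≤ (X.submatrix i.succAbove j.succAbove).rank + 2 := by
  let Z : Matrix (Fin (s+1)) (Fin (s+1)) F := .of fun a b => if a = i ∨ b = j then 0 else X a b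
  have h : X = (Z + vecMulVec (Pi.single i 1) (X i)) +
      vecMulVec (fun a => if a = i then 0 else X a j) (Pi.single j 1) := by
    ext a b
    by_cases ha : a = i <;> by_cases hb : b = j <;>
      simp [Z, vecMulVec_apply, ha, hb]
  have hZ : Z.submatrix i.succAbove j.succAbove = X.submatrix i.succAbove j.succAbove := by
    ext a b
    simp [Z, Fin.succAbove_ne]
  have h1 := rk_pad Z i j (by simp [Z]) (by simp [Z])
  rw [hZ] at h1
  have h2 := rk_add_le (Z + vecMulVec (Pi.single i 1) (X i))
    (vecMulVec (fun a => if a = i then 0 else X a j) (Pi.single j 1))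
  have h3 := rk_add_le Z (vecMulVec (Pi.single i 1) (X i))
  have h4 := Matrix.rank_vecMulVec_le (Pi.single i 1) (X i)
  have h5 := Matrix.rank_vecMulVec_le (fun a => if a = i then 0 else X a j) (Pi.single j (1:F))
  rw [← h] at h2
  omega

theorem rk_updateCol {s : ℕ} {F : Type*} [Field F] (X : Matrix (Fin s) (Fin s) F)
    (k : Fin s) (b : Fin s → F) : (X.updateCol k b).rank ≤ X.rank + 1 := by
  have h : X.updateCol k b = X + vecMulVec (fun a => b a - X a k) (Pi.single k 1) := by
    ext x y
    by_cases hy : y = k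
    · subst hy; simp [vecMulVec_apply]
    · simp [vecMulVec_apply, hy]
  have h5 := Matrix.rank_vecMulVec_le (fun a => b a - X a k) (Pi.single k (1:F))
  have := rk_add_le X (vecMulVec (fun a => b a - X a k) (Pi.single k 1))
  rw [← h] at this
  omega

/-- rank modulo two of an integer matrix -/
noncomputable def rk2 {s : ℕ} (X : Matrix (Fin s) (Fin s) ℤ) : ℕ :=
  (X.map (Int.cast : ℤ → ZMod 2)).rank

/-- fraction-free pivot -/
def pv {s : ℕ} (X : Matrix (Fin (s+1)) (Fin (s+1)) ℤ) (i j : Fin (s+1)) :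
    Matrix (Fin s) (Fin s) ℤ :=
  .of fun a b => X i j * X (i.succAbove a) (j.succAbove b)
    - X (i.succAbove a) j * X i (j.succAbove b)

theorem pv_det {s : ℕ} (X : Matrix (Fin (s+1)) (Fin (s+1)) ℤ) (i j : Fin (s+1)) :
    X i j ^ s * X.det = (-1) ^ (i + j : ℕ) * X i j * (pv X i j).det := by
  let c : Fin (s+1) → ℤ := fun a => if a = i then 1 else X i j
  let Y : Matrix (Fin (s+1)) (Fin (s+1)) ℤ := .of fun a b => c a * X a b
  let B : Matrix (Fin (s+1)) (Fin (s+1)) ℤ :=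
    .of fun a b => if a = i then X i b else X i j * X a b - X a j * X i b
  have h1 : Y.det = X i j ^ s * X.det := by
    rw [show Y.det = _ from Matrix.det_mul_column c X, Fin.prod_univ_succAbove _ i]
    simp [c, Fin.succAbove_ne]
  have h2 : Y.det = B.det := by
    apply Matrix.det_eq_of_forall_row_eq_smul_add_const (fun a => if a = i then 0 else X a j) i
    · simp
    · intro a b
      by_cases ha : a = i <;> simp [Y, B, c, ha]
  rw [← h1, h2, Matrix.det_succ_column B j, Fin.sum_univ_succAbove _ i,
    Finset.sum_eq_zero, add_zero]
  · have : B.submatrix i.succAbove j.succAbove = pv X i j := by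
      ext a b
      simp [B, pv, Fin.succAbove_ne]
    rw [this]
    simp [B]
  · intro a _
    simp only [B, Matrix.of_apply, Fin.succAbove_ne, if_false]
    ring

theorem pv_rk {s : ℕ} (X : Matrix (Fin (s+1)) (Fin (s+1)) ℤ) (i j : Fin (s+1))
    (hX : ((X i j : ℤ) : ZMod 2) = 1) : rk2 X ≤ rk2 (pv X i j) + 1 := by
  unfold rk2
  set Y := X.map (Int.cast : ℤ → ZMod 2) with hY
  have e : Y i j = 1 := hX
  let Z : Matrix (Fin (s+1)) (Fin (s+1)) (ZMod 2) := .of fun a b => Y a b - Y a j * Y i b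
  have h : Y = Z + vecMulVec (fun a => Y a j) (Y i) := by
    ext a b; simp [Z, vecMulVec_apply]
  have hZ : Z.submatrix i.succAbove j.succAbove = (pv X i j).map (Int.cast : ℤ → ZMod 2) := by
    ext a b
    simp [Z, pv, hX, hY]
  have h1 := rk_pad Z i j (by simp [Z, e]) (by simp [Z, e])
  rw [hZ] at h1
  have h3 := rk_add_le Z (vecMulVec (fun a => Y a j) (Y i))
  have h4 := Matrix.rank_vecMulVec_le (fun a => Y a j) (Y i)
  rw [← h] at h3
  omega

theorem pv_rk' {s : ℕ} (X : Matrix (Fin (s+1)) (Fin (s+1)) ℤ) (i j : Fin (s+1))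
    (hX : ((X i j : ℤ) : ZMod 2) = 1) : rk2 (pv X i j) + 1 ≤ rk2 X := by
  unfold rk2
  set Y := X.map (Int.cast : ℤ → ZMod 2) with hY
  have e : Y i j = 1 := hX
  let Z : Matrix (Fin (s+1)) (Fin (s+1)) (ZMod 2) := .of fun a b => Y a b - Y a j * Y i b
  have h : Z = Y - vecMulVec (fun a => Y a j) (Y i) := by
    ext a b; simp [Z, vecMulVec_apply]
  have hZ : Z.submatrix i.succAbove j.succAbove = (pv X i j).map (Int.cast : ℤ → ZMod 2) := by
    ext a b
    simp [Z, pv, hX, hY]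
  have h1 := Matrix.rank_submatrix_le Z i.succAbove j.succAbove
  rw [hZ] at h1
  have hcol : Y *ᵥ Pi.single j 1 = fun a => Y a j := by
    ext a; simp
  have h2 : Z.rank < Y.rank := by
    unfold Matrix.rank
    apply Submodule.finrank_lt_finrank_of_lt
    rw [SetLike.lt_iff_le_and_exists]
    constructor
    · rintro _ ⟨x, rfl⟩
      refine ⟨x - (Y i ⬝ᵥ x) • Pi.single j 1, ?_⟩
      simp only [Matrix.mulVecLin_apply]
      rw [h, Matrix.sub_mulVec, Matrix.mulVec_sub, Matrix.mulVec_smul, hcol,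
        Matrix.vecMulVec_mulVec]
      ext a
      simp
    · refine ⟨fun a => Y a j, ⟨Pi.single j 1, hcol⟩, ?_⟩
      rintro ⟨x, hx⟩
      have := congrFun hx i
      simp only [Matrix.mulVecLin_apply, Matrix.mulVec, dotProduct, e] at this
      simp [Z, e] at this
  omega

theorem rk2_zero {s : ℕ} (X : Matrix (Fin s) (Fin s) ℤ)
    (h : ∀ i j, ((X i j : ℤ) : ZMod 2) = 0) : rk2 X = 0 := by
  unfold rk2
  have : X.map (Int.cast : ℤ → ZMod 2) = 0 := by ext i j; simp [h]
  rw [this, Matrix.rank_zero]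

theorem zmod2_cases (x : ZMod 2) : x = 0 ∨ x = 1 := by
  revert x; decide

theorem dvd_det : ∀ (s : ℕ) (X : Matrix (Fin s) (Fin s) ℤ), (2:ℤ) ^ s ∣ X.det * 2 ^ rk2 X := by
  intro s
  induction s with
  | zero => intro X; simp
  | succ s ih =>
    intro X
    by_cases h : ∀ i j, ((X i j : ℤ) : ZMod 2) = 0
    · rw [rk2_zero X h]
      have h' : ∀ i j, ∃ y, X i j = 2 * y := by
        intro i j
        exact (ZMod.intCast_zmod_eq_zero_iff_dvd (X i j) 2).1 (h i j)
      choose Y hY using h'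
      have : X = (2:ℤ) • (Matrix.of Y) := by
        ext i j; simp [hY]
      rw [this, Matrix.det_smul]
      simp
    · push Not at h
      obtain ⟨i, j, hij⟩ := h
      have h1 := (zmod2_cases _).resolve_left hij
      have h2 := pv_det X i j
      have h4 := ih (pv X i j)
      have hodd : IsCoprime ((2:ℤ)^(s+1)) (X i j ^ s) := by
        apply IsCoprime.pow
        rw [Int.isCoprime_iff_gcd_eq_one]
        have : ¬ (2:ℤ) ∣ X i j := by
          intro hd
          exact hij ((ZMod.intCast_zmod_eq_zero_iff_dvd (X i j) 2).2 hd)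
        exact (Int.isCoprime_iff_gcd_eq_one.1
          ((Int.prime_two.coprime_iff_not_dvd).2 this))
      have h5 := pv_rk' X i j h1
      refine hodd.dvd_of_dvd_mul_left ?_
      rw [← mul_assoc, h2]
      have h6 : (2:ℤ) ^ (s+1) ∣ (pv X i j).det * 2 ^ rk2 X := by
        calc (2:ℤ) ^ (s+1) = 2 ^ s * 2 := pow_succ _ _
          _ ∣ (pv X i j).det * 2 ^ rk2 (pv X i j) * 2 := mul_dvd_mul_right h4 _
          _ = (pv X i j).det * 2 ^ (rk2 (pv X i j) + 1) := by ring
          _ ∣ _ := mul_dvd_mul_left _ (pow_dvd_pow _ h5)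
      rw [mul_assoc]
      exact h6.mul_left _

theorem abs_det_le {s : ℕ} (X : Matrix (Fin s) (Fin s) ℤ) :
    |X.det| ≤ ∏ j, ∑ i, |X i j| := by
  classical
  rw [Matrix.det_apply]
  refine (Finset.abs_sum_le_sum_abs _ _).trans ?_
  rw [Finset.prod_univ_sum]
  have : ∀ σ : Equiv.Perm (Fin s), |Equiv.Perm.sign σ • ∏ i, X (σ i) i| = ∏ i, |X (σ i) i| := by
    intro σ
    rw [← Finset.abs_prod]
    rcases Int.units_eq_one_or (Equiv.Perm.sign σ) with h | h <;> simp [h]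
  simp only [this]
  rw [← Finset.sum_image (s := Finset.univ) (g := fun σ : Equiv.Perm (Fin s) => (σ : Fin s → Fin s))
    (f := fun f => ∏ i, |X (f i) i|)]
  · apply Finset.sum_le_sum_of_subset_of_nonneg
    · intro f _; simp
    · intros; positivity
  · intro a _ b _ h
    exact DFunLike.coe_injective h

theorem base_bound : ∀ (s : ℕ) (X : Matrix (Fin s) (Fin s) ℤ), (∀ j, ∑ i, |X i j| ≤ 2) →
    |X.det| * 2 ^ rk2 X ≤ 2 ^ s := by
  intro s
  induction s with
  | zero => 
    intro X _
    have : rk2 X = 0 := rk2_zero X (fun i => i.elim0)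
    simp [this]
  | succ s ih =>
    intro X hX
    by_cases h : ∀ i j, ((X i j : ℤ) : ZMod 2) = 0
    · rw [rk2_zero X h, pow_zero, mul_one]
      refine (abs_det_le X).trans ?_
      refine (Finset.prod_le_prod (fun j _ => by positivity) (fun j _ => hX j)).trans ?_
      simp
    · push Not at h
      obtain ⟨i, j, hij⟩ := h
      have h1 := (zmod2_cases _).resolve_left hij
      have h2 := pv_det X i j
      have h3 := pv_rk X i j h1
      have hs : ∀ k, |X i k| + ∑ a, |X (i.succAbove a) k| ≤ 2 := by
        intro k
        rw [← Fin.sum_univ_succAbove (fun a => |X a k|) i]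
        exact hX k
      have ha : |X i j| = 1 := by
        have h5 : 0 ≤ ∑ a, |X (i.succAbove a) j| := by positivity
        have h6 := hs j
        have h7 : ¬ (2:ℤ) ∣ X i j := by
          intro hd
          exact hij ((ZMod.intCast_zmod_eq_zero_iff_dvd (X i j) 2).2 hd)
        have h8 : |X i j| ≤ 2 := by linarith
        rw [abs_le] at h8
        rw [abs_eq (by norm_num)]
        omega
      have h4 := ih (pv X i j) (by
        intro k
        have h5 : ∀ a, |pv X i j a k| ≤ |X (i.succAbove a) (j.succAbove k)| +
            |X (i.succAbove a) j| * |X i (j.succAbove k)| := by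
          intro a
          simp only [pv, Matrix.of_apply]
          refine (abs_sub _ _).trans ?_
          rw [abs_mul, abs_mul, ha, one_mul]
        refine (Finset.sum_le_sum fun a _ => h5 a).trans ?_
        rw [Finset.sum_add_distrib, ← Finset.sum_mul]
        have h6 := hs j
        have h7 := hs (j.succAbove k)
        rw [ha] at h6
        have h8 := abs_nonneg (X i (j.succAbove k))
        nlinarith)
      have h5 : |X.det| = |(pv X i j).det| := by
        have := congrArg abs h2
        simpa [abs_mul, abs_pow, ha] using this
      rw [h5]
      calc |(pv X i j).det| * 2 ^ rk2 X ≤ |(pv X i j).det| * 2 ^ (rk2 (pv X i j) + 1) := by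
            gcongr; norm_num
        _ = |(pv X i j).det| * 2 ^ (rk2 (pv X i j)) * 2 := by ring
        _ ≤ 2 ^ s * 2 := by gcongr
        _ = _ := by ring

/-- number of rows (columns) of left type -/
def nl {s : ℕ} {α β : Type*} (f : Fin s → α ⊕ β) : ℕ :=
  (Finset.univ.filter (fun x => (f x).isLeft = true)).card

theorem nl_succAbove {s : ℕ} {α β : Type*} (f : Fin (s+1) → α ⊕ β) (i : Fin (s+1)) :
    nl f = nl (f ∘ i.succAbove) + (if (f i).isLeft = true then 1 else 0) := by
  unfold nl
  simp only [Finset.card_filter, Function.comp]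
  rw [Fin.sum_univ_succAbove _ i, add_comm]

theorem nl_le {s a : ℕ} {β : Type*} (f : Fin s → Fin a ⊕ β) (hf : Function.Injective f) :
    nl f ≤ a := by
  classical
  unfold nl
  calc _ ≤ (Finset.univ.image (Sum.inl : Fin a → Fin a ⊕ β)).card := by
        apply Finset.card_le_card_of_injOn f
        · intro x hx
          simp only [Finset.coe_filter, Finset.mem_univ, true_and, Set.mem_ofPred_eq] at hx
          obtain ⟨y, hy⟩ := Sum.isLeft_iff.1 hx
          simp [hy]
        · exact hf.injOn
    _ ≤ a := by
        refine Finset.card_image_le.trans ?_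
        simp

theorem nl_zero {s : ℕ} {α β : Type*} (f : Fin s → α ⊕ β) (h : nl f = 0) :
    ∀ x, ∃ y, f x = Sum.inr y := by
  intro x
  unfold nl at h
  rw [Finset.card_eq_zero, Finset.filter_eq_empty_iff] at h
  have := h (Finset.mem_univ x)
  rcases hx : f x with y | y
  · simp [hx] at this
  · exact ⟨y, rfl⟩

theorem nl_pos {s : ℕ} {α β : Type*} (f : Fin s → α ⊕ β) (h : nl f ≠ 0) :
    ∃ x, (f x).isLeft = true := by
  unfold nl at h
  obtain ⟨x, hx⟩ := Finset.card_ne_zero.1 h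
  exact ⟨x, (Finset.mem_filter.1 hx).2⟩

theorem rk2_minor {s : ℕ} (X : Matrix (Fin (s+1)) (Fin (s+1)) ℤ) (i j : Fin (s+1)) :
    rk2 X ≤ rk2 (X.submatrix i.succAbove j.succAbove) + 2 := by
  exact rk_minor (X.map (Int.cast : ℤ → ZMod 2)) i j

theorem step_bound {s : ℕ} (X : Matrix (Fin (s+1)) (Fin (s+1)) ℤ) (i j : Fin (s+1))
    (Δ : ℕ) (K : ℤ) (hX : |X i j| ≤ Δ)
    (hK : |(X.submatrix i.succAbove j.succAbove).det| *
      2 ^ rk2 (X.submatrix i.succAbove j.succAbove) ≤ K) :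
    |(-1) ^ (i + j : ℕ) * X i j * (X.submatrix i.succAbove j.succAbove).det| * 2 ^ rk2 X
      ≤ Δ * (4 * K) := by
  rw [abs_mul, abs_mul, abs_pow, abs_neg, abs_one, one_pow, one_mul, mul_assoc]
  refine mul_le_mul hX ?_ (by positivity) (by positivity)
  calc _ ≤ |(X.submatrix i.succAbove j.succAbove).det| *
      2 ^ (rk2 (X.submatrix i.succAbove j.succAbove) + 2) := by
        gcongr
        · norm_num
        · exact rk2_minor X i j
    _ = 4 * (|(X.submatrix i.succAbove j.succAbove).det| *
      2 ^ rk2 (X.submatrix i.succAbove j.succAbove)) := by ring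
    _ ≤ _ := by gcongr

theorem sum_bound {s N Δ k : ℕ} (hs : s + 1 ≤ N) (F : Fin (s+1) → ℤ) (R : ℕ)
    (hF : ∀ a, |F a| * 2 ^ R ≤ Δ * (4 * (((N:ℤ) * Δ) ^ k * 2 ^ (k + s)))) :
    |∑ a, F a| * 2 ^ R ≤ ((N:ℤ) * Δ) ^ (k+1) * 2 ^ ((k + 1) + (s+1)) := by
  calc |∑ a, F a| * 2 ^ R ≤ (∑ a, |F a|) * 2 ^ R := by
        gcongr; exact Finset.abs_sum_le_sum_abs _ _
    _ = ∑ a, |F a| * 2 ^ R := by rw [Finset.sum_mul]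
    _ ≤ ∑ a : Fin (s+1), (Δ:ℤ) * (4 * (((N:ℤ) * Δ) ^ k * 2 ^ (k + s))) :=
        Finset.sum_le_sum fun a _ => hF a
    _ = ((s+1 : ℕ) : ℤ) * (Δ * (4 * (((N:ℤ) * Δ) ^ k * 2 ^ (k + s)))) := by
        simp
    _ ≤ (N : ℤ) * (Δ * (4 * (((N:ℤ) * Δ) ^ k * 2 ^ (k + s)))) := by
        gcongr
    _ = _ := by ring

theorem main_bound {h p m n : ℕ} (Δ N : ℕ)
    (A : Matrix (Fin h ⊕ Fin m) (Fin p ⊕ Fin n) ℤ)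
    (hN : 1 ≤ (N:ℤ) * Δ) (hrow : ∀ i j, |A (Sum.inl i) j| ≤ (Δ : ℤ))
    (hcol : ∀ i j, |A i (Sum.inl j)| ≤ (Δ : ℤ))
    (hM : ∀ j, (∑ i, |A (Sum.inr i) (Sum.inr j)|) ≤ 2) :
    ∀ (k s : ℕ) (f : Fin s → Fin h ⊕ Fin m) (c : Fin s → Fin p ⊕ Fin n),
      s ≤ N → Function.Injective f → nl f + nl c ≤ k →
      |(A.submatrix f c).det| * 2 ^ rk2 (A.submatrix f c) ≤
        ((N:ℤ) * Δ) ^ k * 2 ^ (k + s) := by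
  intro k
  induction k with
  | zero =>
    intro s f c _ hf hk
    have h1 := nl_zero f (by omega)
    have h2 := nl_zero c (by omega)
    choose f' hf' using h1
    choose c' hc' using h2
    simp only [pow_zero, one_mul, zero_add]
    apply base_bound
    intro j
    have hinj : Function.Injective f' := by
      intro x y hxy
      apply hf
      rw [hf', hf', hxy]
    calc ∑ i, |A.submatrix f c i j| = ∑ i, |A (Sum.inr (f' i)) (Sum.inr (c' j))| := by
          simp [hf', hc']
      _ = ∑ i ∈ Finset.univ.map ⟨f', hinj⟩, |A (Sum.inr i) (Sum.inr (c' j))| := by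
          rw [Finset.sum_map]; rfl
      _ ≤ ∑ i, |A (Sum.inr i) (Sum.inr (c' j))| :=
          Finset.sum_le_sum_of_subset_of_nonneg (Finset.subset_univ _) (by intros; positivity)
      _ ≤ 2 := hM _
  | succ k ih =>
    intro s f c hs hf hk
    have mono : ((N:ℤ) * Δ) ^ k * 2 ^ (k + s) ≤ ((N:ℤ) * Δ) ^ (k+1) * 2 ^ (k + 1 + s) := by
      gcongr
      · omega
      · norm_num
      · omega
    by_cases hz : nl f + nl c ≤ k
    · exact (ih s f c hs hf hz).trans mono
    rcases s with _ | s
    · exact absurd (show nl f + nl c ≤ k by unfold nl; simp) hz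
    by_cases hfz : nl f = 0
    · by_cases hcz : nl c = 0
      · omega
      · obtain ⟨j, hj⟩ := nl_pos c hcz
        rw [Matrix.det_succ_column _ j]
        apply sum_bound hs
        intro i
        apply step_bound
        · obtain ⟨y, hy⟩ := Sum.isLeft_iff.1 hj
          rw [Matrix.submatrix_apply, hy]
          exact hcol _ _
        · have e1 := nl_succAbove f i
          have e2 := nl_succAbove c j
          rw [if_pos hj] at e2
          exact ih s (f ∘ i.succAbove) (c ∘ j.succAbove) (by omega)
            (hf.comp Fin.succAbove_right_injective) (by omega)
    · obtain ⟨i, hi⟩ := nl_pos f hfz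
      rw [Matrix.det_succ_row _ i]
      apply sum_bound hs
      intro j
      apply step_bound
      · obtain ⟨y, hy⟩ := Sum.isLeft_iff.1 hi
        rw [Matrix.submatrix_apply, hy]
        exact hrow _ _
      · have e1 := nl_succAbove f i
        have e2 := nl_succAbove c j
        rw [if_pos hi] at e1
        exact ih s (f ∘ i.succAbove) (c ∘ j.succAbove) (by omega)
          (hf.comp Fin.succAbove_right_injective) (by omega)

theorem exists_rows {α : Type*} [Fintype α] {s : ℕ} (B : Matrix α (Fin s) ℚ)
    (hB : LinearIndependent ℚ B.col) :
    ∃ f : Fin s → α, Function.Injective f ∧ (B.submatrix f id).det ≠ 0 := by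
  classical
  obtain ⟨κ, a, ha, hspan, hli⟩ := exists_linearIndependent' ℚ B.row
  have : Finite κ := Finite.of_injective a ha
  have := Fintype.ofFinite κ
  have h1 : B.rank = s := by
    rw [← Matrix.rank_transpose]
    have := LinearIndependent.rank_matrix (M := Bᵀ) hB
    simpa using this
  have h2 : Fintype.card κ = s := by
    rw [Matrix.rank_eq_finrank_span_row, ← hspan] at h1
    rw [← h1]
    exact linearIndependent_iff_card_eq_finrank_span.1 hli
  let e : Fin s ≃ κ := (Fintype.equivFinOfCardEq h2).symm
  refine ⟨a ∘ e, ha.comp e.injective, ?_⟩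
  have h3 : LinearIndependent ℚ (B.submatrix (a ∘ e) id).row := hli.comp e e.injective
  rw [Matrix.linearIndependent_rows_iff_isUnit, Matrix.isUnit_iff_isUnit_det] at h3
  exact h3.ne_zero

theorem gcd_one_dvd {ι : Type*} [Fintype ι] (g : ι → ℤ) (hg : Finset.univ.gcd g = 1) (a b : ℤ)
    (h : ∀ k, a ∣ b * g k) : a ∣ b := by
  have h1 : a ∣ Finset.univ.gcd (fun k => b * g k) := Finset.dvd_gcd fun k _ => h k
  rw [Finset.gcd_mul_left, hg, mul_one] at h1
  exact h1.trans (by rw [normalize_dvd_iff])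

theorem circuit_cols {α β : Type*} [Fintype α] [Fintype β] (A : Matrix α β ℤ) (g : β → ℤ)
    (hg : IsCircuit A g) (j0 : β) (hj0 : g j0 ≠ 0) (s : ℕ) (c : Fin s → β)
    (hc : Function.Injective c) (hc' : ∀ x, g (c x) ≠ 0 ∧ c x ≠ j0) :
    LinearIndependent ℚ ((A.map (Int.cast : ℤ → ℚ)).submatrix id c).col := by
  classical
  rw [← LinearIndependent.iff_fractionRing ℤ ℚ, Fintype.linearIndependent_iff]
  intro q hq
  by_contra hne
  push Not at hne
  obtain ⟨x0, hx0⟩ := hne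
  let g' : β → ℤ := Function.extend c q 0
  have e1 : ∀ x, g' (c x) = q x := fun x => hc.extend_apply _ _ _
  have e2 : ∀ y, (¬ ∃ x, c x = y) → g' y = 0 := fun y hy => by
    simp only [g', Function.extend_apply' _ _ _ hy, Pi.zero_apply]
  have h1 : g' ≠ 0 := by
    intro h0
    exact hx0 (by rw [← e1, h0]; rfl)
  have h2 : A.mulVec g' = 0 := by
    ext i
    have := congrFun hq i
    rw [Finset.sum_apply, Pi.zero_apply] at this
    have h3' : ∑ x, ((q x : ℚ) * (A i (c x) : ℚ)) = 0 := by
      rw [← this]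
      apply Finset.sum_congr rfl
      intro x _
      rw [Pi.smul_apply, zsmul_eq_mul]
      rfl
    have h3 : ∑ x, q x * A i (c x) = 0 := by exact_mod_cast h3'
    rw [Matrix.mulVec, dotProduct, Pi.zero_apply, ← h3]
    symm
    calc ∑ x, q x * A i (c x) = ∑ y ∈ Finset.univ.map ⟨c, hc⟩, A i y * g' y := by
          rw [Finset.sum_map]
          apply Finset.sum_congr rfl
          intro x _
          simp [e1, mul_comm]
      _ = _ := by
          apply Finset.sum_subset (Finset.subset_univ _)
          intro y _ hy
          rw [e2 y, mul_zero]
          rintro ⟨x, rfl⟩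
          simp at hy
  have h3 := hg.2.2.1 g' h1 h2 (by
    intro y hy
    by_cases hx : ∃ x, c x = y
    · obtain ⟨x, rfl⟩ := hx
      exact (hc' x).1
    · exact absurd (e2 y hx) hy)
  have h4 : j0 ∈ {j | g' j ≠ 0} := by rw [h3]; exact hj0
  apply h4
  apply e2
  rintro ⟨x, hx⟩
  exact (hc' x).2 hx

theorem statement5 {h p m n : ℕ} (Δ : ℕ) (hΔ : 1 ≤ Δ)
    (C : Matrix (Fin h) (Fin p) ℤ) (W : Matrix (Fin h) (Fin n) ℤ)
    (T : Matrix (Fin m) (Fin p) ℤ) (M : Matrix (Fin m) (Fin n) ℤ)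
    (hC : ∀ i j, |C i j| ≤ (Δ : ℤ)) (hW : ∀ i j, |W i j| ≤ (Δ : ℤ))
    (hT : ∀ i j, |T i j| ≤ (Δ : ℤ)) (hM : ∀ j, (∑ i, |M i j|) ≤ 2)
    (r : ℕ)
    (hr : r = ((Matrix.fromBlocks C W T M).map (Int.cast : ℤ → ℚ)).rank)
    (g : Fin p ⊕ Fin n → ℤ) (hg : IsCircuit (Matrix.fromBlocks C W T M) g) :
    ∀ j, |g j| ≤ ((Δ : ℤ) * ((r : ℤ) + 1)) ^ (p + h) * 2 ^ (2 * p + 3 * h + 3) := by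
  classical
  set A := Matrix.fromBlocks C W T M with hA
  obtain ⟨j0, hj0⟩ : ∃ j0, g j0 ≠ 0 := by
    by_contra hne
    push Not at hne
    exact hg.1 (funext hne)
  let S := {j // g j ≠ 0 ∧ j ≠ j0}
  let s := Fintype.card S
  let e : Fin s ≃ S := (Fintype.equivFin S).symm
  let c : Fin s → Fin p ⊕ Fin n := fun x => (e x).1
  have hc : Function.Injective c := Subtype.val_injective.comp e.injective
  have hli := circuit_cols A g hg j0 hj0 s c hc (fun x => (e x).2)
  obtain ⟨f, hf, hdet⟩ := exists_rows _ hli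
  set B := A.submatrix f c with hB
  set b : Fin s → ℤ := fun x => A (f x) j0 with hb
  have hBQ : (((A.map (Int.cast : ℤ → ℚ)).submatrix id c).submatrix f id) =
      B.map (Int.cast : ℤ → ℚ) := by ext; rfl
  rw [hBQ] at hdet
  have hdB : B.det ≠ 0 := by
    intro h0
    apply hdet
    have := Int.cast_det (R := ℚ) B
    rw [← this, h0, Int.cast_zero]
  have hsr : s ≤ r := by
    have h1 : (B.map (Int.cast : ℤ → ℚ)).rank = s := by
      rw [Matrix.rank_of_isUnit]
      · simp
      · rw [Matrix.isUnit_iff_isUnit_det]; exact hdet.isUnit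
    rw [hr, ← h1]
    exact Matrix.rank_submatrix_le (A.map (Int.cast : ℤ → ℚ)) f c
  -- Cramer
  have hker : B *ᵥ (g ∘ c) = (-g j0) • b := by
    ext x
    have h1 := congrFun hg.2.1 (f x)
    rw [Matrix.mulVec, dotProduct, Pi.zero_apply] at h1
    have h2 : ∑ y, A (f x) y * g y = A (f x) j0 * g j0 + ∑ z, A (f x) (c z) * g (c z) := by
      have h3 : ∑ z, A (f x) (c z) * g (c z) =
          ∑ y ∈ Finset.univ.map ⟨c, hc⟩, A (f x) y * g y := by
        rw [Finset.sum_map]; rfl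
      have h4 : j0 ∉ Finset.univ.map ⟨c, hc⟩ := by
        simp only [Finset.mem_map, Finset.mem_univ, true_and, Function.Embedding.coeFn_mk]
        rintro ⟨z, hz⟩
        exact (e z).2.2 hz
      rw [h3, ← Finset.sum_insert (f := fun y => A (f x) y * g y) h4]
      symm
      apply Finset.sum_subset (Finset.subset_univ _)
      intro y _ hy
      by_cases hgy : g y = 0
      · rw [hgy, mul_zero]
      · exfalso
        apply hy
        by_cases hyj : y = j0
        · rw [hyj]; exact Finset.mem_insert_self _ _
        · apply Finset.mem_insert_of_mem
          simp only [Finset.mem_map, Finset.mem_univ, true_and, Function.Embedding.coeFn_mk]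
          refine ⟨e.symm ⟨y, hgy, hyj⟩, ?_⟩
          simp [c]
    rw [h2] at h1
    simp only [Matrix.mulVec, dotProduct, hB, Matrix.submatrix_apply, Function.comp, Pi.smul_apply,
      smul_eq_mul, hb]
    linarith
  have hcr : ∀ k, B.det * g (c k) = -g j0 * (B.updateCol k b).det := by
    intro k
    have h1 : B.adjugate *ᵥ (B *ᵥ (g ∘ c)) = B.det • (g ∘ c) := by
      rw [Matrix.mulVec_mulVec, Matrix.adjugate_mul, Matrix.smul_mulVec, Matrix.one_mulVec]
    rw [hker, Matrix.mulVec_smul, ← Matrix.cramer_eq_adjugate_mulVec] at h1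
    have h2 := congrFun h1 k
    simp only [Pi.smul_apply, smul_eq_mul, Matrix.cramer_apply, Function.comp] at h2
    exact h2.symm
  have hcase : ∀ y, g y = 0 ∨ y = j0 ∨ ∃ k, c k = y := by
    intro y
    by_cases hgy : g y = 0
    · exact Or.inl hgy
    by_cases hyj : y = j0
    · exact Or.inr (Or.inl hyj)
    · exact Or.inr (Or.inr ⟨e.symm ⟨y, hgy, hyj⟩, by simp [c]⟩)
  have hdv : g j0 ∣ B.det := by
    apply gcd_one_dvd g hg.2.2.2
    intro y
    rcases hcase y with h1 | rfl | ⟨k, rfl⟩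
    · rw [h1, mul_zero]; exact dvd_zero _
    · exact dvd_mul_left _ _
    · rw [hcr k]
      exact (dvd_neg.2 (dvd_refl (g j0))).mul_right _
  obtain ⟨lam, hlam⟩ := hdv
  have hlam0 : lam ≠ 0 := by
    rintro rfl
    exact hdB (by rw [hlam, mul_zero])
  have hlk : ∀ k, lam * g (c k) = -(B.updateCol k b).det := by
    intro k
    have h1 := hcr k
    rw [hlam] at h1
    apply mul_left_cancel₀ hj0
    linarith
  -- the columns of the exchanged matrix
  have hupd : ∀ k, B.updateCol k b = A.submatrix f (Function.update c k j0) := by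
    intro k
    ext x y
    by_cases hy : y = k
    · subst hy; simp [hb]
    · simp [hB, hy]
  have hupdinj : ∀ k, Function.Injective (Function.update c k j0) := by
    intro k x y hxy
    by_cases hx : x = k <;> by_cases hy : y = k
    · rw [hx, hy]
    · subst hx
      simp only [Function.update_self, Function.update_of_ne hy] at hxy
      exact absurd hxy.symm (e y).2.2
    · subst hy
      simp only [Function.update_self, Function.update_of_ne hx] at hxy
      exact absurd hxy (e x).2.2
    · simp only [Function.update_of_ne hx, Function.update_of_ne hy] at hxy
      exact hc hxy
  set K : ℤ := (((r+1 : ℕ) : ℤ) * Δ) ^ (p + h) * 2 ^ (p + h + s) with hK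
  have hbound : ∀ c' : Fin s → Fin p ⊕ Fin n, Function.Injective c' →
      |(A.submatrix f c').det| * 2 ^ rk2 (A.submatrix f c') ≤ K := by
    intro c' hc'
    apply main_bound Δ (r+1) A
    · have : (1:ℤ) ≤ Δ := by exact_mod_cast hΔ
      push_cast
      nlinarith [Int.natCast_nonneg r]
    · rintro i (j | j)
      · exact hC i j
      · exact hW i j
    · rintro (i | i) j
      · exact hC i j
      · exact hT i j
    · exact hM
    · omega
    · exact hf
    · have h1 := nl_le f hf
      have h2 := nl_le c' hc'
      omega
  set ρ := rk2 B + 1 with hρ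
  have hrk1 : ∀ k, rk2 (B.updateCol k b) ≤ ρ := by
    intro k
    have := rk_updateCol (B.map (Int.cast : ℤ → ZMod 2)) k (fun x => (b x : ZMod 2))
    have h2 : (B.updateCol k b).map (Int.cast : ℤ → ZMod 2) =
        (B.map (Int.cast : ℤ → ZMod 2)).updateCol k (fun x => (b x : ZMod 2)) := by
      rw [Matrix.map_updateCol]; rfl
    unfold rk2 at *
    rw [h2]
    exact this
  have hrk2 : ∀ k, ρ ≤ rk2 (B.updateCol k b) + 2 := by
    intro k
    have := rk_updateCol ((B.updateCol k b).map (Int.cast : ℤ → ZMod 2)) k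
      (fun x => (B x k : ZMod 2))
    have h2 : ((B.updateCol k b).map (Int.cast : ℤ → ZMod 2)).updateCol k
      (fun x => (B x k : ZMod 2)) = B.map (Int.cast : ℤ → ZMod 2) := by
      ext x y
      by_cases hy : y = k
      · subst hy; simp
      · simp [hy]
    rw [h2] at this
    have h3 : rk2 B ≤ rk2 (B.updateCol k b) + 1 := this
    omega
  have key : ∀ D : Matrix (Fin s) (Fin s) ℤ, rk2 D ≤ ρ → (2:ℤ) ^ s ∣ D.det * 2 ^ ρ := by
    intro D hD
    exact (dvd_det s D).trans (mul_dvd_mul_left _ (pow_dvd_pow _ hD))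
  have key2 : ∀ D : Matrix (Fin s) (Fin s) ℤ, ρ ≤ rk2 D + 2 → |D.det| * 2 ^ rk2 D ≤ K →
      |D.det| * 2 ^ ρ ≤ 4 * K := by
    intro D hD hD2
    calc |D.det| * 2 ^ ρ ≤ |D.det| * 2 ^ (rk2 D + 2) := by
          gcongr; norm_num
      _ = 4 * (|D.det| * 2 ^ rk2 D) := by ring
      _ ≤ _ := by gcongr
  have hl2 : (2:ℤ) ^ s ∣ lam * 2 ^ ρ := by
    apply gcd_one_dvd g hg.2.2.2
    intro y
    rcases hcase y with h1 | rfl | ⟨k, rfl⟩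
    · rw [h1, mul_zero]; exact dvd_zero _
    · have := key B (by omega)
      rw [hlam] at this
      convert this using 1
      ring
    · have := (dvd_neg.2 (key _ (hrk1 k)))
      have h5 : lam * 2 ^ ρ * g (c k) = -((B.updateCol k b).det * 2 ^ ρ) := by
        rw [mul_right_comm, hlk]
        ring
      rw [h5]
      exact this
  have hl3 : (2:ℤ) ^ s ≤ |lam| * 2 ^ ρ := by
    have h1 : |lam| * 2 ^ ρ = |lam * 2 ^ ρ| := by
      rw [abs_mul, abs_of_nonneg (a := (2:ℤ) ^ ρ) (by positivity)]
    rw [h1]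
    apply Int.le_of_dvd
    · rw [abs_pos]; positivity
    · rwa [dvd_abs]
  have hfin : ∀ y, |lam * g y| * 2 ^ ρ ≤ 4 * K := by
    intro y
    rcases hcase y with h1 | rfl | ⟨k, rfl⟩
    · rw [h1, mul_zero, abs_zero, zero_mul]; positivity
    · rw [mul_comm lam, ← hlam]
      exact key2 B (by omega) (hbound c hc)
    · rw [hlk, abs_neg]
      apply key2 _ (hrk2 k)
      rw [hupd k]
      exact hbound _ (hupdinj k)
  intro y
  have h1 : (2:ℤ) ^ s * |g y| ≤ 2 ^ s *
      (((Δ : ℤ) * ((r : ℤ) + 1)) ^ (p + h) * 2 ^ (p + h + 2)) := by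
    calc (2:ℤ) ^ s * |g y| ≤ (|lam| * 2 ^ ρ) * |g y| := by gcongr
      _ = |lam * g y| * 2 ^ ρ := by rw [abs_mul]; ring
      _ ≤ 4 * K := hfin y
      _ = _ := by rw [hK]; push_cast; rw [mul_comm (Δ:ℤ)]; ring
  have h2 := le_of_mul_le_mul_left h1 (by positivity)
  refine h2.trans ?_
  apply mul_le_mul_of_nonneg_left _ (by positivity)
  exact pow_le_pow_right₀ (by norm_num) (by omega)
end

section
/- Let Δ ≥ 1 and let A = [[C, W], [T, M]] be as follows: C ∈ ℤ^{h×p}, W ∈ ℤ^{h×n}, T ∈ ℤ^{m×p} have all entries of absolute value at most Δ, and M ∈ ℤ^{m×n} has every column of 1-norm at most 2. Let a ∈ ℤ^p, c ∈ ℤ^n, d ∈ ℤ^h, b ∈ ℤ^m, and let e, g ∈ ℤ^p and l, u ∈ ℤ^n be finite bound vectors. Let P_I = {(y,x) ∈ ℤ^p × ℤ^n : Cy + Wx = d, Ty + Mx = b, e ≤ y ≤ g, l ≤ x ≤ u} and let P_R be the same set with (y,x) ranging over ℝ^p × ℝ^n. Suppose (y*, x*) ∈ P_R minimizes aᵀy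 + cᵀx over P_R, and suppose P_I is nonempty. Then there exists (y, x) ∈ P_I minimizing aᵀy + cᵀx over P_I such that ‖(y*, x*) − (y, x)‖_∞ ≤ (p+n) · (Δ·(m+h+1))^{p+h} · 2^{2p+3h+3}. -/
open Matrix BigOperators

theorem peel_col {ι : Type*} [Fintype ι] [DecidableEq ι] [Nonempty ι] (k : ℤ) (hk : 0 ≤ k) (v : ι → ℤ)
    (hv : ∑ i, |v i| ≤ k + 1) :
    ∃ (i : ι) (s : ℤ), (s = -1 ∨ s = 0 ∨ s = 1) ∧ ∑ x, |v x - (if x = i then s else 0)| ≤ k := by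
  by_cases h0 : ∀ i, v i = 0
  · refine ⟨Classical.arbitrary ι, 0, by simp, ?_⟩
    simp [h0, hk]
  · push Not at h0
    obtain ⟨i, hi⟩ := h0
    have key : ∀ s : ℤ, |v i - s| + 1 = |v i| →
        ∑ x, |v x - (if x = i then s else 0)| ≤ k := by
      intro s hs
      rw [← Finset.add_sum_erase _ _ (Finset.mem_univ i)] at hv ⊢
      have : ∑ x ∈ Finset.univ.erase i, |v x - (if x = i then s else 0)|
          = ∑ x ∈ Finset.univ.erase i, |v x| := by
        apply Finset.sum_congr rfl
        intro x hx
        simp [Finset.ne_of_mem_erase hx]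
      rw [this]
      simp only [if_true]
      linarith
    rcases lt_or_gt_of_ne hi with h | h
    · refine ⟨i, -1, by simp, key _ ?_⟩
      rw [abs_of_neg h, abs_of_nonpos (by omega)]; ring
    · refine ⟨i, 1, by simp, key _ ?_⟩
      rw [abs_of_pos h, abs_of_nonneg (by omega)]; ring

theorem col_class {ι : Type*} [Fintype ι] [DecidableEq ι] [Nonempty ι] (v : ι → ℤ)
    (hv : ∑ i, |v i| ≤ 2) :
    ∃ (i i' : ι) (s t : ℤ), (s = -1 ∨ s = 0 ∨ s = 1) ∧ (t = -1 ∨ t = 0 ∨ t = 1) ∧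
      ∀ y : ι → ℝ, ∑ x, y x * (v x : ℝ) = s * y i + t * y i' := by
  obtain ⟨i, s, hs, h1⟩ := peel_col 1 (by norm_num) v (by linarith)
  obtain ⟨i', t, ht, h2⟩ := peel_col 0 (by norm_num) _ (h1.trans (by norm_num))
  refine ⟨i, i', s, t, hs, ht, fun y => ?_⟩
  have h3 : ∀ x, v x = (if x = i then s else 0) + (if x = i' then t else 0) := by
    intro x
    have := (Finset.sum_eq_zero_iff_of_nonneg (fun x _ => abs_nonneg _)).1
      (le_antisymm h2 (Finset.sum_nonneg (fun x _ => abs_nonneg _))) x (Finset.mem_univ x)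
    rw [abs_eq_zero] at this
    linarith
  simp only [h3]
  push_cast
  simp [mul_add, Finset.sum_add_distrib]
  ring

theorem half_inv {ι : Type*} [Fintype ι] [DecidableEq ι] (N : Matrix ι ι ℤ)
    (hN : ∀ j, ∑ i, |N i j| ≤ 2) (hdet : (N.map (Int.cast : ℤ → ℝ)).det ≠ 0)
    (y : ι → ℝ) (j : ι) (hy : y ᵥ* (N.map (Int.cast : ℤ → ℝ)) = Pi.single j 1) :
    ∃ a : ℝ, (a = 1 / 2 ∨ a = 1) ∧ ∀ i, y i = 0 ∨ y i = a ∨ y i = -a := by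
  have : Nonempty ι := ⟨j⟩
  have hinj : ∀ z : ι → ℝ, z ᵥ* (N.map (Int.cast : ℤ → ℝ)) = 0 → z = 0 :=
    fun z hz => Matrix.eq_zero_of_vecMul_eq_zero hdet hz
  have hvm : ∀ (z : ι → ℝ) (j'), (z ᵥ* (N.map (Int.cast : ℤ → ℝ))) j' = ∑ x, z x * (N x j' : ℝ) := by
    intro z j'; simp [Matrix.vecMul, dotProduct]
  have hy0 : y ≠ 0 := by
    rintro rfl
    have := congrFun hy j
    simp at this
  obtain ⟨i0, hi0⟩ := Function.ne_iff.1 hy0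
  simp only [Pi.zero_apply] at hi0
  set α := |y i0| with hα
  have hαpos : 0 < α := abs_pos.2 hi0
  set z : ι → ℝ := fun i => if |y i| = α then y i else 0 with hz
  have hz0 : ∀ j', j' ≠ j → (z ᵥ* (N.map (Int.cast : ℤ → ℝ))) j' = 0 := by
    intro j' hj'
    have h1 := congrFun hy j'
    rw [hvm, Pi.single_eq_of_ne hj'] at h1
    rw [hvm]
    obtain ⟨i, i', s, t, hs, ht, H⟩ := col_class (fun x => N x j') (hN j')
    rw [H] at h1 ⊢
    simp only [hz]
    rcases hs with rfl | rfl | rfl <;> rcases ht with rfl | rfl | rfl <;> push_cast at h1 ⊢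
    · have : y i' = - y i := by linarith
      rw [this, abs_neg]; split_ifs <;> simp
    · have : y i = 0 := by linarith
      simp [this]
    · have : y i' = y i := by linarith
      rw [this]; split_ifs <;> simp
    · have : y i' = 0 := by linarith
      simp [this]
    · simp
    · have : y i' = 0 := by linarith
      simp [this]
    · have : y i' = y i := by linarith
      rw [this]; split_ifs <;> simp
    · have : y i = 0 := by linarith
      simp [this]
    · have : y i' = - y i := by linarith
      rw [this, abs_neg]; split_ifs <;> simp
  set β := (z ᵥ* (N.map (Int.cast : ℤ → ℝ))) j with hβ
  have hzy : z - β • y = 0 := by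
    apply hinj
    rw [Matrix.sub_vecMul, Matrix.smul_vecMul, hy]
    ext j'
    by_cases h : j' = j
    · subst h; simp [hβ]
    · simp [hz0 j' h, h]
  have hzy' : ∀ i, z i = β * y i := by
    intro i
    have := congrFun hzy i
    simp at this
    linarith
  have hβ1 : β = 1 := by
    have := hzy' i0
    simp only [hz, ← hα, if_true] at this
    have h2 : (β - 1) * y i0 = 0 := by linarith
    rcases mul_eq_zero.1 h2 with h | h
    · linarith
    · exact absurd h hi0
  have hall : ∀ i, y i = 0 ∨ y i = α ∨ y i = -α := by
    intro i
    have := hzy' i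
    rw [hβ1, one_mul] at this
    simp only [hz] at this
    split_ifs at this with h
    · right
      exact (abs_eq hαpos.le).1 h
    · left; exact this.symm
  refine ⟨α, ?_, hall⟩
  have h1 := congrFun hy j
  rw [hvm, Pi.single_eq_same] at h1
  obtain ⟨i, i', s, t, hs, ht, H⟩ := col_class (fun x => N x j) (hN j)
  rw [H] at h1
  rcases hs with rfl | rfl | rfl <;> rcases ht with rfl | rfl | rfl <;> push_cast at h1 <;>
    rcases hall i with h | h | h <;> rcases hall i' with h' | h' | h' <;> rw [h, h'] at h1 <;>
    first
    | (left; linarith)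
    | (right; linarith)

theorem bord_det {ρ γ : Type*} (A : Matrix ρ γ ℝ) {k : ℕ} (f : Fin k → ρ) (g : Fin k → γ)
    (hdet : (A.submatrix f g).det ≠ 0) (i : ρ) (j : γ) :
    (A.submatrix (Sum.elim f (fun _ : Unit => i)) (Sum.elim g (fun _ : Unit => j))).det =
      (A.submatrix f g).det *
      (A i j - (fun x => A i (g x)) ⬝ᵥ ((A.submatrix f g)⁻¹ *ᵥ (fun x => A (f x) j))) := by
  have e : A.submatrix (Sum.elim f (fun _ : Unit => i)) (Sum.elim g (fun _ : Unit => j)) =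
      Matrix.fromBlocks (A.submatrix f g) (Matrix.of fun x _ => A (f x) j)
        (Matrix.of fun _ x => A i (g x)) (Matrix.of fun _ _ => A i j) := by
    ext x y
    rcases x with x | x <;> rcases y with y | y <;> rfl
  let _ := Matrix.invertibleOfIsUnitDet _ (isUnit_iff_ne_zero.2 hdet)
  rw [e, Matrix.det_fromBlocks₁₁, Matrix.invOf_eq_nonsing_inv, Matrix.det_unique (n := Unit)]
  congr 1
  rw [Matrix.mul_assoc]
  simp [Matrix.mul_apply, Matrix.mulVec, dotProduct]

theorem exists_max_minor {ρ γ : Type*} [Fintype ρ] [Fintype γ] (A : Matrix ρ γ ℝ)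
    (μ : ∀ k : ℕ, (Fin k → ρ) → (Fin k → γ) → ℕ) :
    ∃ (k : ℕ) (f : Fin k → ρ) (g : Fin k → γ), (A.submatrix f g).det ≠ 0 ∧
      ∀ (k' : ℕ) (f' : Fin k' → ρ) (g' : Fin k' → γ), (A.submatrix f' g').det ≠ 0 →
        μ k' f' g' ≤ μ k f g := by
  classical
  let X := Σ k : Fin (Fintype.card ρ + 1), (Fin k → ρ) × (Fin k → γ)
  let Y := {x : X // (A.submatrix x.2.1 x.2.2).det ≠ 0}
  have h00 : (A.submatrix (Fin.elim0 : Fin 0 → ρ) (Fin.elim0 : Fin 0 → γ)).det ≠ 0 := by simp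
  have : Nonempty Y := ⟨⟨⟨⟨0, Nat.succ_pos _⟩, (Fin.elim0, Fin.elim0)⟩, h00⟩⟩
  obtain ⟨⟨⟨k, f, g⟩, h⟩, hm⟩ := Finite.exists_max (fun y : Y => μ y.1.1 y.1.2.1 y.1.2.2)
  refine ⟨k, f, g, h, fun k' f' g' h' => ?_⟩
  have hf' : Function.Injective f' := by
    intro a b hab
    by_contra hne
    exact h' (Matrix.det_zero_of_row_eq hne (by ext x; simp [hab]))
  have hk : k' < Fintype.card ρ + 1 := by
    have := Fintype.card_le_of_injective f' hf'
    simp at this; omega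
  exact hm ⟨⟨⟨k', hk⟩, (f', g')⟩, h'⟩

theorem det_bord_fin {ρ γ : Type*} {k : ℕ} (f : Fin k → ρ) (g : Fin k → γ)
    (i : ρ) (j : γ) : ∃ (f' : Fin (k + 1) → ρ) (g' : Fin (k + 1) → γ),
    ∀ B : Matrix ρ γ ℝ, (B.submatrix f' g').det =
    (B.submatrix (Sum.elim f (fun _ : Unit => i)) (Sum.elim g (fun _ : Unit => j))).det := by
  let e : Fin (k + 1) ≃ Fin k ⊕ Unit :=
    finSumFinEquiv.symm.trans (Equiv.sumCongr (Equiv.refl _) (Equiv.ofUnique _ _))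
  refine ⟨(Sum.elim f (fun _ : Unit => i)) ∘ e, (Sum.elim g (fun _ : Unit => j)) ∘ e, fun B => ?_⟩
  rw [← Matrix.submatrix_submatrix, Matrix.det_submatrix_equiv_self]

/-- `N` is a minor that captures everything: `A = A_{.,g} N⁻¹ A_{f,.}`. -/
def SchurZero {ρ γ : Type*} (A : Matrix ρ γ ℝ) {k : ℕ} (f : Fin k → ρ) (g : Fin k → γ) : Prop :=
  ∀ i j, A i j = (fun x => A i (g x)) ⬝ᵥ ((A.submatrix f g)⁻¹ *ᵥ (fun x => A (f x) j))

theorem exists_schur_zero {ρ γ : Type*} [Fintype ρ] [Fintype γ] (A : Matrix ρ γ ℝ) :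
    ∃ (k : ℕ) (f : Fin k → ρ) (g : Fin k → γ), (A.submatrix f g).det ≠ 0 ∧ SchurZero A f g := by
  obtain ⟨k, f, g, h, hm⟩ := exists_max_minor A (fun k _ _ => k)
  refine ⟨k, f, g, h, fun i j => ?_⟩
  by_contra hne
  obtain ⟨f', g', H⟩ := det_bord_fin f g i j
  have := hm (k + 1) f' g' (by
    rw [H, bord_det A f g h]
    exact mul_ne_zero h (sub_ne_zero.2 hne))
  omega

theorem submatrix_col {ρ γ : Type*} [Fintype ρ] (A : Matrix ρ γ ℤ) (hA : ∀ j, ∑ i, |A i j| ≤ 2)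
    {ι κ : Type*} [Fintype ι] (f : ι → ρ) (hf : Function.Injective f) (g : κ → γ) (j : κ) :
    ∑ i, |(A.submatrix f g) i j| ≤ 2 := by
  classical
  refine le_trans ?_ (hA (g j))
  simp only [Matrix.submatrix_apply]
  rw [← Finset.sum_image (s := Finset.univ) (g := f) (f := fun x => |A x (g j)|)
    (fun a _ b _ h => hf h)]
  exact Finset.sum_le_sum_of_subset_of_nonneg (Finset.subset_univ _) (fun _ _ _ => abs_nonneg _)

theorem inj_of_det {ρ γ : Type*} (A : Matrix ρ γ ℝ) {ι : Type*} [Fintype ι] [DecidableEq ι]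
    (f : ι → ρ) (g : ι → γ) (h : (A.submatrix f g).det ≠ 0) :
    Function.Injective f ∧ Function.Injective g := by
  constructor
  · intro a b hab
    by_contra hne
    exact h (Matrix.det_zero_of_row_eq hne (by ext x; simp [hab]))
  · intro a b hab
    by_contra hne
    exact h (Matrix.det_zero_of_column_eq hne (by intro x; simp [hab]))

theorem det_cast {ι : Type*} [Fintype ι] [DecidableEq ι] (A : Matrix ι ι ℤ) :
    (A.map (Int.cast : ℤ → ℝ)).det = ((A.det : ℤ) : ℝ) := by
  have := RingHom.map_det (Int.castRingHom ℝ) A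
  simp only [eq_intCast] at this
  rw [this]; rfl

theorem bord_abs {ρ γ : Type*} [Fintype ρ] (A : Matrix ρ γ ℤ) (hA : ∀ j, ∑ i, |A i j| ≤ 2)
    {k : ℕ} (f : Fin k → ρ) (g : Fin k → γ)
    (hdet : ((A.map (Int.cast : ℤ → ℝ)).submatrix f g).det ≠ 0) (i : ρ) (j : γ)
    (hb : ((A.map (Int.cast : ℤ → ℝ)).submatrix (Sum.elim f (fun _ : Unit => i))
      (Sum.elim g (fun _ : Unit => j))).det ≠ 0) :
    |((A.map (Int.cast : ℤ → ℝ)).submatrix f g).det| ≤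
    |((A.map (Int.cast : ℤ → ℝ)).submatrix (Sum.elim f (fun _ : Unit => i))
      (Sum.elim g (fun _ : Unit => j))).det| := by
  set Ar := A.map (Int.cast : ℤ → ℝ) with hAr
  have hbd := bord_det Ar f g hdet i j
  set N := Ar.submatrix f g with hN
  set r : Fin k → ℝ := fun x => Ar i (g x) with hr
  set c : Fin k → ℝ := fun x => Ar (f x) j with hc
  set σ : ℝ := Ar i j - r ⬝ᵥ (N⁻¹ *ᵥ c) with hσ
  have hσ0 : σ ≠ 0 := by
    intro h; rw [h, mul_zero] at hbd; exact hb hbd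
  let y : Fin k ⊕ Unit → ℝ := Sum.elim (fun x => -(1/σ) * (r ᵥ* N⁻¹) x) (fun _ => 1/σ)
  have hy : y ᵥ* ((A.submatrix (Sum.elim f (fun _ : Unit => i))
      (Sum.elim g (fun _ : Unit => j))).map (Int.cast : ℤ → ℝ)) = Pi.single (Sum.inr ()) 1 := by
    have hfst : ∀ v : Fin k → ℝ, (∑ x, -(1/σ) * (r ᵥ* N⁻¹) x * v x) = -(1/σ) * (r ⬝ᵥ (N⁻¹ *ᵥ v)) := by
      intro v
      rw [Matrix.dotProduct_mulVec]
      simp only [dotProduct, Finset.mul_sum, mul_assoc]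
    ext z
    rcases z with z | z
    · have h1 : (N⁻¹ *ᵥ (fun x => N x z)) = Pi.single z 1 := by
        have : (fun x => N x z) = N *ᵥ Pi.single z 1 := by
          ext x; simp
        rw [this, Matrix.mulVec_mulVec, Matrix.nonsing_inv_mul _ (isUnit_iff_ne_zero.2 hdet),
          Matrix.one_mulVec]
      have h2 := hfst (fun x => N x z)
      rw [h1] at h2
      simp only [Matrix.vecMul, dotProduct, Fintype.sum_sum_type, y, Sum.elim_inl, Sum.elim_inr]
      have h3 : (∑ x, -(1/σ) * (r ᵥ* N⁻¹) x * N x z) + 1/σ * r z = 0 := by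
        rw [h2]; simp
      simpa [hN, hAr, hr, Matrix.vecMul, dotProduct] using h3
    · have h2 := hfst c
      have h3 : (∑ x, -(1/σ) * (r ᵥ* N⁻¹) x * c x) + 1/σ * Ar i j = 1 := by
        rw [h2]
        have : Ar i j = σ + r ⬝ᵥ (N⁻¹ *ᵥ c) := by rw [hσ]; ring
        rw [this]
        field_simp
        ring
      simpa [y, hAr, hc, Matrix.vecMul, dotProduct] using h3
  have hinj := (inj_of_det Ar _ _ hb).1
  obtain ⟨α, hα, H⟩ := half_inv _ (submatrix_col A hA _ hinj _) hb y _ hy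
  have h1 : y (Sum.inr ()) = 1/σ := rfl
  have h2 : |1/σ| ≤ 1 := by
    rw [← h1]
    rcases H (Sum.inr ()) with h | h | h <;> rw [h] <;> rcases hα with rfl | rfl <;> norm_num
  rw [hbd, abs_mul]
  rw [abs_div, abs_one, div_le_one (abs_pos.2 hσ0)] at h2
  exact le_mul_of_one_le_right (abs_nonneg _) h2

theorem exists_schur_zero_max {ρ γ : Type*} [Fintype ρ] [Fintype γ] (A : Matrix ρ γ ℤ)
    (hA : ∀ j, ∑ i, |A i j| ≤ 2) :
    ∃ (k : ℕ) (f : Fin k → ρ) (g : Fin k → γ),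
      ((A.map (Int.cast : ℤ → ℝ)).submatrix f g).det ≠ 0 ∧
      SchurZero (A.map (Int.cast : ℤ → ℝ)) f g ∧
      ∀ (k' : ℕ) (f' : Fin k' → ρ) (g' : Fin k' → γ),
        |(A.submatrix f' g').det| ≤ |(A.submatrix f g).det| := by
  set Ar := A.map (Int.cast : ℤ → ℝ) with hAr
  have hcast : ∀ (k : ℕ) (f : Fin k → ρ) (g : Fin k → γ),
      (Ar.submatrix f g).det = (((A.submatrix f g).det : ℤ) : ℝ) := fun k f g =>
    det_cast (A.submatrix f g)
  set c := Fintype.card ρ + 1 with hc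
  have hkc : ∀ (k : ℕ) (f : Fin k → ρ) (g : Fin k → γ), (Ar.submatrix f g).det ≠ 0 → k < c := by
    intro k f g h
    have := Fintype.card_le_of_injective f (inj_of_det Ar f g h).1
    simp at this; omega
  obtain ⟨k, f, g, h, hm⟩ := exists_max_minor Ar
    (fun k f g => (A.submatrix f g).det.natAbs * c + k)
  refine ⟨k, f, g, h, fun i j => ?_, fun k' f' g' => ?_⟩
  · by_contra hne
    obtain ⟨f', g', H⟩ := det_bord_fin f g i j
    have h0 : (Ar.submatrix f' g').det ≠ 0 := by
      rw [H, bord_det Ar f g h]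
      exact mul_ne_zero h (sub_ne_zero.2 hne)
    have h1 := hm (k + 1) f' g' h0
    have h2 := bord_abs A hA f g h i j (by rw [← H]; exact h0)
    rw [← H, hcast, hcast] at h2
    have h3 : (A.submatrix f g).det.natAbs ≤ (A.submatrix f' g').det.natAbs := by
      have : |(A.submatrix f g).det| ≤ |(A.submatrix f' g').det| := by exact_mod_cast h2
      rw [Int.abs_eq_natAbs, Int.abs_eq_natAbs] at this
      exact_mod_cast this
    have := Nat.mul_le_mul_right c h3
    omega
  · by_cases h0 : (Ar.submatrix f' g').det = 0
    · rw [hcast] at h0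
      have : (A.submatrix f' g').det = 0 := by exact_mod_cast h0
      rw [this]; simp
    · have h1 := hm k' f' g' h0
      have h2 := hkc k f g h
      have h3 : (A.submatrix f' g').det.natAbs < (A.submatrix f g).det.natAbs + 1 := by
        by_contra hcon
        push Not at hcon
        have := Nat.mul_le_mul_right c hcon
        rw [Nat.add_mul] at this
        omega
      rw [Int.abs_eq_natAbs, Int.abs_eq_natAbs]
      exact_mod_cast Nat.lt_succ_iff.1 h3

theorem det_bound {ρ γ : Type*} (A : Matrix ρ γ ℤ) (top : ρ → Bool) (left : γ → Bool)
    (Δ L : ℕ) (hΔL : 1 ≤ Δ * L)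
    (hA : ∀ i j, (top i = true ∨ left j = true) → |A i j| ≤ (Δ : ℤ)) (D : ℤ)
    (hD : ∀ (k : ℕ) (f : Fin k → ρ) (g : Fin k → γ), (∀ i, top (f i) = false) →
      (∀ j, left (g j) = false) → |(A.submatrix f g).det| ≤ D) (u : ℕ) :
    ∀ (s : ℕ) (f : Fin s → ρ) (g : Fin s → γ), s ≤ L →
      (∑ i, if top (f i) = true then 1 else 0) + (∑ j, if left (g j) = true then 1 else 0) ≤ u →
      |(A.submatrix f g).det| ≤ ((Δ * L : ℕ) : ℤ) ^ u * D := by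
  have hD0 : 0 ≤ D := (abs_nonneg _).trans
    (hD 0 Fin.elim0 Fin.elim0 (fun i => i.elim0) (fun i => i.elim0))
  have hΔL' : (1 : ℤ) ≤ ((Δ * L : ℕ) : ℤ) := by exact_mod_cast hΔL
  induction u with
  | zero =>
    intro s f g hs hc
    rw [pow_zero, one_mul]
    have h1 : ∑ i, (if top (f i) = true then 1 else 0) = 0 := by omega
    have h2 : ∑ i, (if left (g i) = true then 1 else 0) = 0 := by omega
    apply hD
    · intro i
      have := Finset.sum_eq_zero_iff.1 h1 i (Finset.mem_univ i)
      simpa using this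
    · intro i
      have := Finset.sum_eq_zero_iff.1 h2 i (Finset.mem_univ i)
      simpa using this
  | succ u ih =>
    intro s f g hs hc
    have fin_step : ∀ (s' : ℕ) (q w : Fin (s' + 1) → ℤ) , s' + 1 ≤ L → (∀ i, |q i| ≤ (Δ : ℤ)) →
        (∀ i, |w i| ≤ ((Δ * L : ℕ) : ℤ) ^ u * D) →
        ∀ ε : Fin (s' + 1) → ℤ, (∀ i, |ε i| = 1) →
        |∑ i, ε i * q i * w i| ≤ ((Δ * L : ℕ) : ℤ) ^ (u + 1) * D := by
      intro s' q w hs' hq hw ε hε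
      calc |∑ i, ε i * q i * w i| ≤ ∑ i, |ε i * q i * w i| := Finset.abs_sum_le_sum_abs _ _
        _ ≤ ∑ i : Fin (s' + 1), (Δ : ℤ) * (((Δ * L : ℕ) : ℤ) ^ u * D) := by
          apply Finset.sum_le_sum
          intro i _
          rw [abs_mul, abs_mul, hε, one_mul]
          exact mul_le_mul (hq i) (hw i) (abs_nonneg _) (by positivity)
        _ = ((s' + 1 : ℕ) : ℤ) * ((Δ : ℤ) * (((Δ * L : ℕ) : ℤ) ^ u * D)) := by
          simp
        _ ≤ (L : ℤ) * ((Δ : ℤ) * (((Δ * L : ℕ) : ℤ) ^ u * D)) := by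
          apply mul_le_mul_of_nonneg_right (by exact_mod_cast hs')
          positivity
        _ = _ := by push_cast; ring
    have drop : ∀ (s' : ℕ) (c : Fin (s' + 1) → ℕ) (i : Fin (s' + 1)),
        ∑ x, c (i.succAbove x) + c i = ∑ x, c x := by
      intro s' c i
      rw [Fin.sum_univ_succAbove c i, add_comm]
    have hsgn : ∀ a : ℕ, |(-1 : ℤ) ^ a| = 1 := by intro a; simp
    by_cases hl : ∃ j, left (g j) = true
    · obtain ⟨j, hj⟩ := hl
      obtain ⟨s', rfl⟩ : ∃ s', s = s' + 1 := ⟨s - 1, by have := j.2; omega⟩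
      rw [Matrix.det_succ_column _ j]
      apply fin_step s' (fun i => A (f i) (g j)) _ hs (fun i => hA _ _ (Or.inr hj)) _ _
        (fun i => hsgn _)
      intro i
      rw [Matrix.submatrix_submatrix]
      apply ih s' _ _ (by omega)
      have h1 := drop s' (fun x => if top (f x) = true then 1 else 0) i
      have h2 := drop s' (fun x => if left (g x) = true then 1 else 0) j
      simp only [hj, if_true] at h2
      simp only [Function.comp_apply]
      omega
    · by_cases ht : ∃ i, top (f i) = true
      · obtain ⟨j, hj⟩ := ht
        obtain ⟨s', rfl⟩ : ∃ s', s = s' + 1 := ⟨s - 1, by have := j.2; omega⟩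
        rw [Matrix.det_succ_row _ j]
        apply fin_step s' (fun i => A (f j) (g i)) _ hs (fun i => hA _ _ (Or.inl hj)) _ _
          (fun i => hsgn _)
        intro i
        rw [Matrix.submatrix_submatrix]
        apply ih s' _ _ (by omega)
        have h1 := drop s' (fun x => if top (f x) = true then 1 else 0) j
        have h2 := drop s' (fun x => if left (g x) = true then 1 else 0) i
        simp only [hj, if_true] at h1
        simp only [Function.comp_apply]
        omega
      · push Not at hl ht
        refine (hD s f g (by simpa using ht) (by simpa using hl)).trans ?_
        exact le_mul_of_one_le_left hD0 (one_le_pow₀ hΔL')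

theorem half_int_inv {ι : Type*} [Fintype ι] [DecidableEq ι] (N : Matrix ι ι ℤ)
    (hN : ∀ j, ∑ i, |N i j| ≤ 2) (hdet : (N.map (Int.cast : ℤ → ℝ)).det ≠ 0) :
    ∃ N2 : Matrix ι ι ℤ, N2.map (Int.cast : ℤ → ℝ) = (2 : ℝ) • (N.map (Int.cast : ℤ → ℝ))⁻¹ := by
  have hu := isUnit_iff_ne_zero.2 hdet
  have : ∀ i j, ∃ z : ℤ, (z : ℝ) = 2 * (N.map (Int.cast : ℤ → ℝ))⁻¹ i j := by
    intro i j
    have hy : ((N.map (Int.cast : ℤ → ℝ))⁻¹ i) ᵥ* (N.map (Int.cast : ℤ → ℝ)) = Pi.single i 1 := by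
      have := Matrix.nonsing_inv_mul _ hu
      ext x
      have h := congrFun (congrFun this i) x
      rw [Matrix.mul_apply] at h
      rw [Matrix.vecMul, dotProduct, h, Matrix.one_apply, Pi.single_apply]
      simp [eq_comm]
    obtain ⟨a, ha, H⟩ := half_inv N hN hdet _ i hy
    rcases H j with h | h | h <;> rw [h] <;> rcases ha with rfl | rfl
    · exact ⟨0, by norm_num⟩
    · exact ⟨0, by norm_num⟩
    · exact ⟨1, by norm_num⟩
    · exact ⟨2, by norm_num⟩
    · exact ⟨-1, by norm_num⟩
    · exact ⟨-2, by norm_num⟩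
  choose N2 h using this
  exact ⟨Matrix.of N2, by ext i j; simp [h]⟩

theorem int_solution {k t : ℕ} (N : Matrix (Fin k) (Fin k) ℤ) (F : Matrix (Fin k) (Fin t) ℤ)
    (G : Matrix (Fin t) (Fin k) ℤ) (E : Matrix (Fin t) (Fin t) ℤ)
    (hN : ∀ j, ∑ i, |N i j| ≤ 2) (hdet : (N.map (Int.cast : ℤ → ℝ)).det ≠ 0)
    (b1 : Fin k → ℤ) (b2 : Fin t → ℤ) (x1 : Fin k → ℝ) (x2 : Fin t → ℝ)
    (h1 : N.map (Int.cast : ℤ → ℝ) *ᵥ x1 + F.map (Int.cast : ℤ → ℝ) *ᵥ x2 = fun i => (b1 i : ℝ))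
    (h2 : G.map (Int.cast : ℤ → ℝ) *ᵥ x1 + E.map (Int.cast : ℤ → ℝ) *ᵥ x2 = fun i => (b2 i : ℝ)) :
    ∃ τ : Matrix (Fin t) (Fin t) ℤ,
      τ.map (Int.cast : ℤ → ℝ) = (2 : ℝ) • (E.map (Int.cast : ℤ → ℝ) -
        G.map (Int.cast : ℤ → ℝ) * (N.map (Int.cast : ℤ → ℝ))⁻¹ * F.map (Int.cast : ℤ → ℝ)) ∧
      N.det * τ.det = 2 ^ t * (Matrix.fromBlocks N F G E).det ∧
      (∀ j, ∃ z : ℤ, (z : ℝ) = 2 * τ.det * x2 j) ∧ ∀ j, ∃ z : ℤ, (z : ℝ) = 2 * τ.det * x1 j := by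
  obtain ⟨N2, hN2⟩ := half_int_inv N hN hdet
  have hu := isUnit_iff_ne_zero.2 hdet
  have mapmul : ∀ {a b c : ℕ} (X : Matrix (Fin a) (Fin b) ℤ) (Y : Matrix (Fin b) (Fin c) ℤ),
      (X * Y).map (Int.cast : ℤ → ℝ) = X.map (Int.cast : ℤ → ℝ) * Y.map (Int.cast : ℤ → ℝ) := by
    intro a b c X Y
    ext i j; simp [Matrix.mul_apply]
  have mapvec : ∀ {a b : ℕ} (X : Matrix (Fin a) (Fin b) ℤ) (y : Fin b → ℤ),
      X.map (Int.cast : ℤ → ℝ) *ᵥ (fun i => (y i : ℝ)) = fun i => ((X *ᵥ y) i : ℝ) := by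
    intro a b X y
    ext i; simp [Matrix.mulVec, dotProduct]
  let τ : Matrix (Fin t) (Fin t) ℤ := (2 : ℤ) • E - G * N2 * F
  have hτ : τ.map (Int.cast : ℤ → ℝ) = (2 : ℝ) • E.map (Int.cast : ℤ → ℝ) -
      G.map (Int.cast : ℤ → ℝ) * N2.map (Int.cast : ℤ → ℝ) * F.map (Int.cast : ℤ → ℝ) := by
    rw [← mapmul, ← mapmul]
    ext i j
    simp only [τ, Matrix.map_apply, Matrix.sub_apply, Matrix.smul_apply, smul_eq_mul]
    push_cast
    rfl
  have hτ2 : τ.map (Int.cast : ℤ → ℝ) = (2 : ℝ) • (E.map (Int.cast : ℤ → ℝ) -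
        G.map (Int.cast : ℤ → ℝ) * (N.map (Int.cast : ℤ → ℝ))⁻¹ * F.map (Int.cast : ℤ → ℝ)) := by
    rw [hτ, hN2, smul_sub, Matrix.mul_smul, Matrix.smul_mul]
  have hNN : N2.map (Int.cast : ℤ → ℝ) * N.map (Int.cast : ℤ → ℝ) = (2 : ℝ) • 1 := by
    rw [hN2, Matrix.smul_mul, Matrix.nonsing_inv_mul _ hu]
  -- N2 (b1 - F x2) = 2 x1
  have e1 : N2.map (Int.cast : ℤ → ℝ) *ᵥ (fun i => (b1 i : ℝ)) -
      N2.map (Int.cast : ℤ → ℝ) *ᵥ (F.map (Int.cast : ℤ → ℝ) *ᵥ x2) = (2 : ℝ) • x1 := by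
    rw [← h1, Matrix.mulVec_add, Matrix.mulVec_mulVec, hNN, Matrix.smul_mulVec,
      Matrix.one_mulVec]
    simp
  let β : Fin t → ℤ := (2 : ℤ) • b2 - G *ᵥ (N2 *ᵥ b1)
  have e2 : τ.map (Int.cast : ℤ → ℝ) *ᵥ x2 = fun i => (β i : ℝ) := by
    have : (fun i => (β i : ℝ)) = (2 : ℝ) • (fun i => (b2 i : ℝ)) -
        G.map (Int.cast : ℤ → ℝ) *ᵥ (N2.map (Int.cast : ℤ → ℝ) *ᵥ (fun i => (b1 i : ℝ))) := by
      rw [mapvec, mapvec]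
      ext i; simp [β]
    rw [this, sub_eq_iff_eq_add.1 e1, ← h2, hτ, Matrix.sub_mulVec, Matrix.mulVec_add,
      Matrix.smul_mulVec, Matrix.mulVec_mulVec, Matrix.mulVec_mulVec,
      Matrix.mulVec_smul, smul_add]
    abel
  have e3 : ((τ.det : ℤ) : ℝ) • x2 = fun i => ((τ.adjugate *ᵥ β) i : ℝ) := by
    rw [← mapvec, ← e2, Matrix.mulVec_mulVec, ← mapmul, Matrix.adjugate_mul]
    ext i
    have : ((τ.det • (1 : Matrix (Fin t) (Fin t) ℤ)).map (Int.cast : ℤ → ℝ)) =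
        ((τ.det : ℤ) : ℝ) • (1 : Matrix (Fin t) (Fin t) ℝ) := by
      ext a b
      simp only [Matrix.map_apply, Matrix.smul_apply, Matrix.one_apply, smul_eq_mul, Int.cast_mul]
      split_ifs <;> simp
    rw [this, Matrix.smul_mulVec, Matrix.one_mulVec]
  refine ⟨τ, hτ2, ?_, ?_, ?_⟩
  · have hd : ((Matrix.fromBlocks N F G E).map (Int.cast : ℤ → ℝ)).det =
        (N.map (Int.cast : ℤ → ℝ)).det * (E.map (Int.cast : ℤ → ℝ) -
        G.map (Int.cast : ℤ → ℝ) * (N.map (Int.cast : ℤ → ℝ))⁻¹ * F.map (Int.cast : ℤ → ℝ)).det := by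
      let _ := Matrix.invertibleOfIsUnitDet _ hu
      rw [Matrix.fromBlocks_map, Matrix.det_fromBlocks₁₁, Matrix.invOf_eq_nonsing_inv]
    have hd2 : (τ.map (Int.cast : ℤ → ℝ)).det = 2 ^ t * (E.map (Int.cast : ℤ → ℝ) -
        G.map (Int.cast : ℤ → ℝ) * (N.map (Int.cast : ℤ → ℝ))⁻¹ * F.map (Int.cast : ℤ → ℝ)).det := by
      rw [hτ2, Matrix.det_smul]; simp
    have : (N.map (Int.cast : ℤ → ℝ)).det * (τ.map (Int.cast : ℤ → ℝ)).det =
        2 ^ t * ((Matrix.fromBlocks N F G E).map (Int.cast : ℤ → ℝ)).det := by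
      rw [hd, hd2]; ring
    rw [det_cast, det_cast, det_cast] at this
    exact_mod_cast this
  · intro j
    refine ⟨2 * (τ.adjugate *ᵥ β) j, ?_⟩
    have := congrFun e3 j
    simp only [Pi.smul_apply, smul_eq_mul] at this
    rw [Int.cast_mul, ← this, Int.cast_ofNat]; ring
  · intro j
    refine ⟨(τ.det • (N2 *ᵥ b1) - N2 *ᵥ (F *ᵥ (τ.adjugate *ᵥ β))) j, ?_⟩
    have := congrArg (fun v => ((τ.det : ℤ) : ℝ) • v) e1
    simp only [smul_sub] at this
    rw [← Matrix.mulVec_smul (N2.map (Int.cast : ℤ → ℝ)) _ (F.map (Int.cast : ℤ → ℝ) *ᵥ x2),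
      ← Matrix.mulVec_smul (F.map (Int.cast : ℤ → ℝ)) _ x2, e3, mapvec, mapvec, mapvec] at this
    have := congrFun this j
    simp only [Pi.sub_apply, Pi.smul_apply, smul_eq_mul] at this
    simp only [Pi.sub_apply, Pi.smul_apply, smul_eq_mul]
    rw [Int.cast_sub, Int.cast_mul, this]; ring

theorem ext_equiv {k s t : ℕ} (ht : t = s - k) (φ : Fin k → Fin s) (hφ : Function.Injective φ) :
    ∃ e : Fin k ⊕ Fin t ≃ Fin s, ∀ i, e (Sum.inl i) = φ i := by
  subst ht
  classical
  have hc : Fintype.card ↥(Set.range φ)ᶜ = s - k := by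
    rw [Fintype.card_compl_set, Set.card_range_of_injective hφ]; simp
  let e2 : Fin (s - k) ≃ ↥(Set.range φ)ᶜ := (Fintype.equivFinOfCardEq hc).symm
  let e1 : Fin k ≃ ↥(Set.range φ) := Equiv.ofInjective φ hφ
  refine ⟨(Equiv.sumCongr e1 e2).trans (Equiv.Set.sumCompl _), fun i => ?_⟩
  simp [e1]

theorem count_left {s : ℕ} {a : ℕ} {β : Type*} (φ : Fin s → Fin a ⊕ β)
    (hφ : Function.Injective φ) :
    (∑ i, if (φ i).isLeft = true then 1 else 0) ≤ a := by
  classical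
  rw [← Finset.card_filter]
  have h : ∀ i ∈ Finset.univ.filter (fun i => (φ i).isLeft = true), φ i ∈
      (Finset.univ : Finset (Fin a)).map ⟨Sum.inl, Sum.inl_injective⟩ := by
    intro i hi
    simp only [Finset.mem_filter, Finset.mem_univ, true_and] at hi
    obtain ⟨y, hy⟩ := Sum.isLeft_iff.1 hi
    simp [hy]
  have := Finset.card_le_card_of_injOn φ h (fun x _ y _ h => hφ h)
  simpa using this

theorem colR {h p m n : ℕ} (A : Matrix (Fin h ⊕ Fin m) (Fin p ⊕ Fin n) ℤ)
    (hM : ∀ j, ∑ i, |A (Sum.inr i) (Sum.inr j)| ≤ 2) {ι : Type*} [Fintype ι]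
    (f : ι → Fin h ⊕ Fin m) (hf : Function.Injective f) (hr : ∀ i, (f i).isRight = true)
    (w : Fin p ⊕ Fin n) (hw : w.isRight = true) : ∑ i, |A (f i) w| ≤ 2 := by
  obtain ⟨w', rfl⟩ := Sum.isRight_iff.1 hw
  have : ∀ i, ∃ y, f i = Sum.inr y := fun i => Sum.isRight_iff.1 (hr i)
  choose f' hf' using this
  have := submatrix_col (Matrix.of fun i j => A (Sum.inr i) (Sum.inr j)) hM f'
    (fun a b hab => hf (by rw [hf', hf', hab])) id w'
  simpa [hf'] using this

theorem perm_count {h p : ℕ} {t : ℕ} {α β : Type*} (τ : Matrix (Fin t) (Fin t) ℤ) (hτ : τ.det ≠ 0)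
    (φ : Fin t → Fin h ⊕ α) (hφ : Function.Injective φ)
    (ψ : Fin t → Fin p ⊕ β) (hψ : Function.Injective ψ)
    (hz : ∀ i j, (φ i).isRight = true → (ψ j).isRight = true → τ i j = 0) : t ≤ p + h := by
  classical
  rw [Matrix.det_apply] at hτ
  obtain ⟨σ, -, hσ⟩ := Finset.exists_ne_zero_of_sum_ne_zero hτ
  have hσ2 : ∀ i, τ (σ i) i ≠ 0 := by
    intro i hi
    apply hσ
    rw [Finset.prod_eq_zero (f := fun i => τ (σ i) i) (Finset.mem_univ i) hi, smul_zero]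
  have hor : ∀ i, (ψ i).isLeft = true ∨ (φ (σ i)).isLeft = true := by
    intro i
    by_contra hcon
    push Not at hcon
    exact hσ2 i (hz _ _ (by simpa using hcon.2) (by simpa using hcon.1))
  have h1 := count_left ψ hψ
  have h2 := count_left (φ ∘ σ) (hφ.comp σ.injective)
  have h3 : ∑ i : Fin t, 1 ≤ ∑ i, ((if (ψ i).isLeft = true then 1 else 0) +
      (if ((φ ∘ σ) i).isLeft = true then 1 else 0)) := by
    apply Finset.sum_le_sum
    intro i _
    rcases hor i with hh | hh <;> simp [hh]
  rw [Finset.sum_add_distrib] at h3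
  simp at h3 h1 h2
  omega

theorem scale {h p m n : ℕ} (Δ : ℕ) (hΔ : 1 ≤ Δ)
    (A : Matrix (Fin h ⊕ Fin m) (Fin p ⊕ Fin n) ℤ)
    (hA : ∀ i j, (i.isLeft = true ∨ j.isLeft = true) → |A i j| ≤ (Δ : ℤ))
    (hM : ∀ j, ∑ i, |A (Sum.inr i) (Sum.inr j)| ≤ 2) {s : ℕ}
    (f : Fin s → Fin h ⊕ Fin m) (g : Fin s → Fin p ⊕ Fin n) (j0 : Fin p ⊕ Fin n)
    (hj0 : ∀ x, g x ≠ j0) (hdet : (A.submatrix f g).det ≠ 0) (x : Fin s → ℝ)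
    (hx : ∀ i, ∑ y, (A (f i) (g y) : ℝ) * x y = (A (f i) j0 : ℝ)) :
    ∃ (d : ℤ) (z : Fin s → ℤ), d ≠ 0 ∧ (∀ j, (z j : ℝ) = d * x j) ∧
      |d| ≤ ((Δ * (m + h + 1) : ℕ) : ℤ) ^ (p + h) * 2 ^ (p + h + 2) ∧
      ∀ j, |z j| ≤ ((Δ * (m + h + 1) : ℕ) : ℤ) ^ (p + h) * 2 ^ (p + h + 2) := by
  classical
  have hdetR : ((A.map (Int.cast : ℤ → ℝ)).submatrix f g).det ≠ 0 := by
    have := det_cast (A.submatrix f g)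
    rw [Matrix.submatrix_map, this]
    exact_mod_cast hdet
  obtain ⟨hf, hg⟩ := inj_of_det _ f g hdetR
  let M' : Matrix {i : Fin s // (f i).isRight = true} {j : Fin s // (g j).isRight = true} ℤ :=
    Matrix.of fun i j => A (f i.1) (g j.1)
  have hM' : ∀ j, ∑ i, |M' i j| ≤ 2 := fun j =>
    colR A hM (fun i : {i : Fin s // (f i).isRight = true} => f i.1)
      (fun a b hab => Subtype.ext (hf hab)) (fun i => i.2) (g j.1) j.2
  obtain ⟨k, f', g', hNd, hSZ, hmax⟩ := exists_schur_zero_max M' hM'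
  obtain ⟨hf', hg'⟩ := inj_of_det _ f' g' hNd
  set N := M'.submatrix f' g' with hN
  have hNd' : (N.map (Int.cast : ℤ → ℝ)).det ≠ 0 := hNd
  have hND : N.det ≠ 0 := by
    rw [det_cast] at hNd'; exact_mod_cast hNd'
  obtain ⟨t, ht⟩ : ∃ t, t = s - k := ⟨_, rfl⟩
  obtain ⟨er, her⟩ := ext_equiv ht (fun i => (f' i).1) (fun a b hab => hf' (Subtype.ext hab))
  obtain ⟨ec, hec⟩ := ext_equiv ht (fun i => (g' i).1) (fun a b hab => hg' (Subtype.ext hab))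
  let F : Matrix (Fin k) (Fin t) ℤ := Matrix.of fun i j => A (f (er (Sum.inl i))) (g (ec (Sum.inr j)))
  let G : Matrix (Fin t) (Fin k) ℤ := Matrix.of fun i j => A (f (er (Sum.inr i))) (g (ec (Sum.inl j)))
  let E : Matrix (Fin t) (Fin t) ℤ := Matrix.of fun i j => A (f (er (Sum.inr i))) (g (ec (Sum.inr j)))
  have hNe : ∀ i j, N i j = A (f (er (Sum.inl i))) (g (ec (Sum.inl j))) := by
    intro i j; simp [hN, M', her, hec]
  have hblk : (A.submatrix f g).submatrix er ec = Matrix.fromBlocks N F G E := by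
    ext a b
    rcases a with a | a <;> rcases b with b | b <;> simp [hNe, F, G, E]
  have hblkdet : |(Matrix.fromBlocks N F G E).det| = |(A.submatrix f g).det| := by
    rw [← hblk]
    have h1 : (A.submatrix f g).submatrix er ec =
        ((A.submatrix f g).submatrix (er.symm.trans ec).symm id).submatrix ec ec := by
      ext a b; simp
    rw [h1, Matrix.det_submatrix_equiv_self, Matrix.det_permute, abs_mul]
    rcases Int.units_eq_one_or (Equiv.Perm.sign (er.symm.trans ec).symm) with hh | hh <;> simp [hh]
  have hsum : ∀ i, ∑ y, (A (f i) (g (ec (Sum.inl y))) : ℝ) * x (ec (Sum.inl y)) +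
      ∑ y, (A (f i) (g (ec (Sum.inr y))) : ℝ) * x (ec (Sum.inr y)) = (A (f i) j0 : ℝ) := by
    intro i
    rw [← hx i, ← Equiv.sum_comp ec, Fintype.sum_sum_type]
  obtain ⟨τ, hτ, hτdet, hz2, hz1⟩ := int_solution N F G E
    (submatrix_col M' hM' f' hf' g') hNd' (fun i => A (f (er (Sum.inl i))) j0)
    (fun i => A (f (er (Sum.inr i))) j0) (fun i => x (ec (Sum.inl i))) (fun i => x (ec (Sum.inr i)))
    (by
      ext i
      rw [← hsum]
      simp [Matrix.mulVec, dotProduct, hNe, F])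
    (by
      ext i
      rw [← hsum]
      simp [Matrix.mulVec, dotProduct, G, E])
  have hτ0 : τ.det ≠ 0 := by
    intro h0
    rw [h0, mul_zero] at hτdet
    have : (Matrix.fromBlocks N F G E).det = 0 := by
      rcases mul_eq_zero.1 hτdet.symm with hh | hh
      · exact absurd hh (by positivity)
      · exact hh
    rw [this, abs_zero] at hblkdet
    exact hdet (abs_eq_zero.1 hblkdet.symm)
  have htle : t ≤ p + h := by
    apply perm_count τ hτ0 (fun i => f (er (Sum.inr i)))
      (fun a b hab => Sum.inr_injective (er.injective (hf hab)))
      (fun i => g (ec (Sum.inr i)))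
      (fun a b hab => Sum.inr_injective (ec.injective (hg hab)))
    intro i j hi hj
    have h1 := hSZ ⟨_, hi⟩ ⟨_, hj⟩
    have h2 := congrFun (congrFun hτ i) j
    have h3 : (E.map (Int.cast : ℤ → ℝ) - G.map (Int.cast : ℤ → ℝ) *
        (N.map (Int.cast : ℤ → ℝ))⁻¹ * F.map (Int.cast : ℤ → ℝ)) i j = 0 := by
      rw [Matrix.sub_apply, sub_eq_zero, Matrix.mul_assoc, Matrix.mul_apply]
      rw [Matrix.map_apply, Matrix.submatrix_map] at h1
      have h4 : ((M' ⟨_, hi⟩ ⟨_, hj⟩ : ℤ) : ℝ) = E.map (Int.cast : ℤ → ℝ) i j := rfl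
      rw [h4] at h1
      rw [h1]
      simp only [dotProduct, Matrix.mulVec, Matrix.mul_apply, G, F, hN, M', Matrix.map_apply,
        Matrix.of_apply, her, hec]
    rw [Matrix.smul_apply, h3, smul_zero, Matrix.map_apply] at h2
    exact_mod_cast h2
  -- determinant bounds
  let Gc : Option (Fin s) → Fin p ⊕ Fin n := fun o => o.elim j0 g
  let At : Matrix (Fin s) (Option (Fin s)) ℤ := Matrix.of fun i o => A (f i) (Gc o)
  have hsL : s ≤ m + h + 1 := by
    have := Fintype.card_le_of_injective f hf
    simp at this; omega
  have hGinj : Function.Injective Gc := by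
    intro a b hab
    rcases a with _ | a <;> rcases b with _ | b
    · rfl
    · exact absurd hab.symm (hj0 b)
    · exact absurd hab (hj0 a)
    · exact congrArg some (hg hab)
  have hD : ∀ (k' : ℕ) (f'' : Fin k' → Fin s) (g'' : Fin k' → Option (Fin s)),
      (∀ i, (f (f'' i)).isLeft = false) → (∀ j, (Gc (g'' j)).isLeft = false) →
      |(At.submatrix f'' g'').det| ≤ 2 * |N.det| := by
    intro k' f'' g'' hl hr
    by_cases h0 : (At.submatrix f'' g'').det = 0
    · rw [h0, abs_zero]; positivity
    have h0R : ((At.map (Int.cast : ℤ → ℝ)).submatrix f'' g'').det ≠ 0 := by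
      have := det_cast (At.submatrix f'' g'')
      rw [Matrix.submatrix_map, this]
      exact_mod_cast h0
    obtain ⟨hfi, hgi⟩ := inj_of_det _ f'' g'' h0R
    have some_case : ∀ (k₂ : ℕ) (f₂ : Fin k₂ → Fin s) (g₂ : Fin k₂ → Option (Fin s)),
      (∀ i, (f (f₂ i)).isLeft = false) → (∀ j, (Gc (g₂ j)).isLeft = false) →
      (∀ j, g₂ j ≠ none) → |(At.submatrix f₂ g₂).det| ≤ |N.det| := by
      intro k₂ f₂ g₂ hl₂ hr₂ hn
      have : ∀ j, ∃ y, g₂ j = some y := fun j => Option.ne_none_iff_exists'.1 (hn j)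
      choose g₃ hg₃ using this
      have hr₃ : ∀ j, (g (g₃ j)).isRight = true := by
        intro j
        have := hr₂ j
        rw [hg₃] at this
        simpa [Gc] using this
      have := hmax k₂ (fun i => ⟨f₂ i, by simpa using hl₂ i⟩) (fun j => ⟨g₃ j, hr₃ j⟩)
      convert this using 3
      ext i j
      simp [At, M', Gc, hg₃]
    by_cases hnone : ∃ j, g'' j = none
    · obtain ⟨j, hj⟩ := hnone
      obtain ⟨k₁, rfl⟩ : ∃ k₁, k' = k₁ + 1 := ⟨k' - 1, by have := j.2; omega⟩
      rw [Matrix.det_succ_column _ j]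
      have hcol : ∑ i, |A (f (f'' i)) j0| ≤ 2 := by
        apply colR A hM (fun i => f (f'' i)) (hf.comp hfi) (fun i => by simpa using hl i)
        have := hr j
        rw [hj] at this
        simpa [Gc] using this
      calc _ ≤ ∑ i : Fin (k₁ + 1), |A (f (f'' i)) j0| * |N.det| := by
            refine (Finset.abs_sum_le_sum_abs _ _).trans (Finset.sum_le_sum fun i _ => ?_)
            rw [abs_mul, abs_mul]
            have e1 : |(-1 : ℤ) ^ ((i : ℕ) + (j : ℕ))| = 1 := by simp
            rw [e1, one_mul]
            have e2 : (At.submatrix f'' g'') i j = A (f (f'' i)) j0 := by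
              simp [At, Gc, hj]
            rw [e2]
            apply mul_le_mul_of_nonneg_left _ (abs_nonneg _)
            rw [Matrix.submatrix_submatrix]
            apply some_case _ _ _ (fun i => hl _) (fun i => hr _)
            intro y hy
            rw [← hj] at hy
            exact Fin.succAbove_ne j y (hgi hy)
        _ ≤ 2 * |N.det| := by
            rw [← Finset.sum_mul]
            exact mul_le_mul_of_nonneg_right hcol (abs_nonneg _)
    · push Not at hnone
      have := some_case k' f'' g'' hl hr hnone
      have h2 := abs_nonneg N.det
      linarith
  have hbd : ∀ g'' : Fin s → Option (Fin s), Function.Injective g'' →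
      |(At.submatrix id g'').det| ≤ ((Δ * (m + h + 1) : ℕ) : ℤ) ^ (p + h) * (2 * |N.det|) := by
    intro g'' hg''
    apply det_bound At (fun i => (f i).isLeft) (fun o => (Gc o).isLeft) Δ (m + h + 1)
      (Nat.mul_pos hΔ (by omega)) (fun i j hij => hA _ _ hij) _ hD _ s id g'' hsL
    have h1 := count_left f hf
    have h2 := count_left (fun j => Gc (g'' j)) (hGinj.comp hg'')
    simp only [id] at *
    omega
  have hNpos : 0 < |N.det| := abs_pos.2 hND
  set Lb : ℤ := ((Δ * (m + h + 1) : ℕ) : ℤ) ^ (p + h) with hLb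
  have hLb0 : 0 ≤ Lb := by positivity
  have fin2 : ∀ (w q : ℤ), |w| * |N.det| = 2 ^ (t + 1) * |q| → |q| ≤ Lb * (2 * |N.det|) →
      |w| ≤ Lb * 2 ^ (p + h + 2) := by
    intro w q h1 h2
    have h3 : |w| * |N.det| ≤ (Lb * 2 ^ (p + h + 2)) * |N.det| := by
      calc |w| * |N.det| = 2 ^ (t + 1) * |q| := h1
        _ ≤ 2 ^ (t + 1) * (Lb * (2 * |N.det|)) := by gcongr
        _ = (Lb * 2 ^ (t + 2)) * |N.det| := by ring
        _ ≤ _ := by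
          gcongr
          · norm_num
    exact le_of_mul_le_mul_right h3 hNpos
  have hz : ∀ j, ∃ z : ℤ, (z : ℝ) = 2 * τ.det * x j := by
    intro j
    obtain ⟨y, rfl⟩ := ec.surjective j
    rcases y with y | y
    · exact hz1 y
    · exact hz2 y
  choose z hz using hz
  have habs : |2 * τ.det| * |N.det| = 2 ^ (t + 1) * |(A.submatrix f g).det| := by
    rw [← hblkdet, abs_mul, mul_assoc, mul_comm |τ.det|, ← abs_mul, hτdet, abs_mul, abs_pow]
    simp only [abs_two]
    ring
  refine ⟨2 * τ.det, z, by simpa using hτ0, fun j => by rw [hz]; push_cast; ring, ?_, ?_⟩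
  · apply fin2 _ _ habs
    have := hbd some (Option.some_injective _)
    exact this
  · intro j
    have hcr : ((A.submatrix f g).det : ℝ) * x j =
        (((At.submatrix id (Function.update some j none)).det : ℤ) : ℝ) := by
      have h1 : (A.submatrix f g).map (Int.cast : ℤ → ℝ) *ᵥ x = fun i => (A (f i) j0 : ℝ) := by
        ext i
        rw [← hx i]
        simp [Matrix.mulVec, dotProduct]
      have h2 : Matrix.cramer ((A.submatrix f g).map (Int.cast : ℤ → ℝ)) (fun i => (A (f i) j0 : ℝ))
          = ((A.submatrix f g).det : ℝ) • x := by
        rw [← h1, Matrix.cramer_eq_adjugate_mulVec, Matrix.mulVec_mulVec, Matrix.adjugate_mul,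
          Matrix.smul_mulVec, Matrix.one_mulVec, det_cast]
      have h3 := congrFun h2 j
      rw [Matrix.cramer_apply] at h3
      simp only [Pi.smul_apply, smul_eq_mul] at h3
      rw [← h3, ← det_cast]
      congr 1
      ext a b
      by_cases hb : b = j
      · subst hb; simp [At, Gc]
      · simp [At, Gc, hb]
    apply fin2 _ _ _ (hbd (Function.update some j none) ?_)
    · have h1 : (z j) * (A.submatrix f g).det =
          2 * τ.det * (At.submatrix id (Function.update some j none)).det := by
        have : (z j : ℝ) * (A.submatrix f g).det =
          2 * τ.det * ((At.submatrix id (Function.update some j none)).det : ℝ) := by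
          rw [hz, ← hcr]; ring
        exact_mod_cast this
      have h2 : |z j| * |(A.submatrix f g).det| =
          |2 * τ.det| * |(At.submatrix id (Function.update some j none)).det| := by
        rw [← abs_mul, h1, abs_mul]
      have h3 : 0 < |(A.submatrix f g).det| := abs_pos.2 hdet
      apply mul_right_cancel₀ h3.ne'
      calc _ = (|z j| * |(A.submatrix f g).det|) * |N.det| := by ring
        _ = (|2 * τ.det| * |N.det|) * |(At.submatrix id (Function.update some j none)).det| := by
          rw [h2]; ring
        _ = _ := by rw [habs]; ring
    · intro a b hab
      by_cases ha : a = j <;> by_cases hb : b = j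
      · rw [ha, hb]
      · subst ha; simp [Function.update_of_ne hb] at hab
      · subst hb; simp [Function.update_of_ne ha] at hab
      · simpa [Function.update_of_ne ha, Function.update_of_ne hb] using hab

theorem key_circuit {h p m n : ℕ} (Δ : ℕ) (hΔ : 1 ≤ Δ)
    (A : Matrix (Fin h ⊕ Fin m) (Fin p ⊕ Fin n) ℤ)
    (hA : ∀ i j, (i.isLeft = true ∨ j.isLeft = true) → |A i j| ≤ (Δ : ℤ))
    (hM : ∀ j, ∑ i, |A (Sum.inr i) (Sum.inr j)| ≤ 2)
    (v : Fin p ⊕ Fin n → ℝ) (hv : A.map (Int.cast : ℤ → ℝ) *ᵥ v = 0) (hv0 : v ≠ 0) :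
    ∃ G : Fin p ⊕ Fin n → ℤ, G ≠ 0 ∧ A *ᵥ G = 0 ∧ (∀ j, v j = 0 → G j = 0) ∧
      ∀ j, |G j| ≤ ((Δ * (m + h + 1) : ℕ) : ℤ) ^ (p + h) * 2 ^ (p + h + 2) := by
  classical
  let S := {j : Fin p ⊕ Fin n // v j ≠ 0}
  let AS : Matrix (Fin h ⊕ Fin m) S ℝ := Matrix.of fun i j => (A i j.1 : ℝ)
  obtain ⟨s, f, g, hd, hSZ⟩ := exists_schur_zero AS
  obtain ⟨hf, hg⟩ := inj_of_det AS f g hd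
  have hex : ∃ j0 : S, ∀ x, g x ≠ j0 := by
    by_contra hcon
    push Not at hcon
    let e := Equiv.ofBijective g ⟨hg, hcon⟩
    have h1 : AS.submatrix f g *ᵥ (fun x => v (g x).1) = 0 := by
      ext i
      have h2 := congrFun hv (f i)
      simp only [Matrix.mulVec, dotProduct, Matrix.map_apply, Pi.zero_apply] at h2
      have h3 : ∑ j : S, (A (f i) j.1 : ℝ) * v j.1 = 0 := by
        refine Eq.trans ?_ h2
        rw [← Finset.sum_subtype (Finset.univ.filter (fun j => v j ≠ 0)) (by simp)
          (fun j => (A (f i) j : ℝ) * v j)]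
        apply Finset.sum_filter_of_ne
        intro j _ hj h0
        exact hj (by rw [h0, mul_zero])
      rw [← Equiv.sum_comp e] at h3
      have h4 : ∑ x, (A (f i) (g x).1 : ℝ) * v (g x).1 = 0 := h3
      simpa [Matrix.mulVec, dotProduct, AS] using h4
    have h2 := Matrix.eq_zero_of_mulVec_eq_zero hd h1
    obtain ⟨j, hj⟩ := Function.ne_iff.1 hv0
    obtain ⟨x, hx⟩ := hcon ⟨j, hj⟩
    have h3 := congrFun h2 x
    simp only [hx, Pi.zero_apply] at h3
    exact hj h3
  obtain ⟨j0, hj0⟩ := hex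
  let x : Fin s → ℝ := (AS.submatrix f g)⁻¹ *ᵥ (fun y => AS (f y) j0)
  have hx : ∀ i, ∑ y, (A i (g y).1 : ℝ) * x y = (A i j0.1 : ℝ) := by
    intro i
    have := hSZ i j0
    exact this.symm
  have hdZ : (A.submatrix f (fun y => (g y).1)).det ≠ 0 := by
    intro h0
    apply hd
    have h1 : AS.submatrix f g = (A.submatrix f (fun y => (g y).1)).map (Int.cast : ℤ → ℝ) := by
      ext a b; simp [AS]
    rw [h1, det_cast, h0, Int.cast_zero]
  obtain ⟨d, z, hd0, hz, hdb, hzb⟩ := scale Δ hΔ A hA hM f (fun y => (g y).1) j0.1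
    (fun y hy => hj0 y (Subtype.ext hy)) hdZ x (fun i => hx _)
  let G : Fin p ⊕ Fin n → ℤ := fun j => (if j = j0.1 then d else 0) -
    ∑ y, if j = (g y).1 then z y else 0
  have hG0 : G j0.1 = d := by
    have : ∀ y, ¬ (j0.1 = (g y).1) := fun y hy => hj0 y (Subtype.ext hy.symm)
    simp [G, this]
  have hG1 : ∀ y, G (g y).1 = - z y := by
    intro y
    have h1 : (g y).1 ≠ j0.1 := fun hy => hj0 y (Subtype.ext hy)
    have h2 : ∀ y', (g y).1 = (g y').1 ↔ y = y' :=
      fun y' => ⟨fun hh => hg (Subtype.ext hh), fun hh => by rw [hh]⟩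
    simp [G, h1, h2]
  have hG2 : ∀ j, j ≠ j0.1 → (∀ y, j ≠ (g y).1) → G j = 0 := by
    intro j h1 h2
    simp [G, h1, h2]
  refine ⟨G, fun h0 => hd0 (by rw [← hG0, h0]; rfl), ?_, ?_, ?_⟩
  · ext i
    have h1 : (A *ᵥ G) i = A i j0.1 * d - ∑ y, A i (g y).1 * z y := by
      simp only [Matrix.mulVec, dotProduct, G, mul_sub, Finset.sum_sub_distrib, Finset.mul_sum]
      rw [Finset.sum_comm]
      simp
    have h2 : ((A *ᵥ G) i : ℝ) = 0 := by
      rw [h1]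
      push_cast
      simp only [hz]
      rw [← hx i, Finset.sum_mul, ← Finset.sum_sub_distrib]
      apply Finset.sum_eq_zero
      intro y _
      ring
    exact_mod_cast h2
  · intro j hj
    apply hG2
    · rintro rfl; exact j0.2 hj
    · rintro y rfl; exact (g y).2 hj
  · intro j
    by_cases h1 : j = j0.1
    · rw [h1, hG0]; exact hdb
    · by_cases h2 : ∃ y, j = (g y).1
      · obtain ⟨y, rfl⟩ := h2
        rw [hG1, abs_neg]; exact hzb y
      · push Not at h2
        rw [hG2 j h1 h2, abs_zero]; positivity

open Classical in
/-- Size of the support. -/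
noncomputable def suppCard {ι : Type*} [Fintype ι] (z : ι → ℝ) : ℕ :=
  (Finset.univ.filter (fun j => z j ≠ 0)).card

theorem shrink {ι : Type*} [Fintype ι] (z g : ι → ℝ) (hs : ∀ j, z j = 0 → g j = 0)
    (hp : ∃ i, 0 < g i * z i) : ∃ c : ℝ, 0 < c ∧ suppCard (z - c • g) < suppCard z ∧
      ∀ j, 0 ≤ (z j - c * g j) * z j := by
  classical
  have hne : (Finset.univ.filter (fun i => 0 < g i * z i)).Nonempty := by
    obtain ⟨i, hi⟩ := hp
    exact ⟨i, by simpa using hi⟩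
  obtain ⟨i0, hi0, hmin⟩ := Finset.exists_min_image _ (fun i => z i / g i) hne
  simp only [Finset.mem_filter, Finset.mem_univ, true_and] at hi0 hmin
  have hg0 : g i0 ≠ 0 := fun h => by rw [h, zero_mul] at hi0; exact lt_irrefl _ hi0
  have hz0 : z i0 ≠ 0 := fun h => by rw [h, mul_zero] at hi0; exact lt_irrefl _ hi0
  have hcpos : 0 < z i0 / g i0 := by
    have : z i0 / g i0 = (g i0 * z i0) / (g i0 ^ 2) := by field_simp
    rw [this]; positivity
  refine ⟨z i0 / g i0, hcpos, ?_, ?_⟩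
  · apply Finset.card_lt_card
    rw [Finset.ssubset_iff_of_subset]
    · exact ⟨i0, by simpa using hz0, by simp [hg0]⟩
    · intro j hj
      simp only [Finset.mem_filter, Finset.mem_univ, true_and] at hj ⊢
      intro h
      apply hj
      simp [h, hs j h]
  · intro j
    by_cases h : 0 < g j * z j
    · have h1 := hmin j h
      have hgj : g j ≠ 0 := fun h' => by rw [h', zero_mul] at h; exact lt_irrefl _ h
      have h2 : (z j - z i0 / g i0 * g j) * z j = (g j * z j) * (z j / g j - z i0 / g i0) := by
        field_simp
      rw [h2]
      exact mul_nonneg h.le (by linarith)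
    · push Not at h
      nlinarith [sq_nonneg (z j)]

theorem conf_trans_s6 {a b c : ℝ} (h1 : 0 ≤ a * b) (h2 : 0 ≤ b * c) (h3 : b = 0 → a = 0) :
    0 ≤ a * c := by
  by_cases hb : b = 0
  · rw [h3 hb, zero_mul]
  · have : 0 < b ^ 2 := by positivity
    have h4 := mul_nonneg h1 h2
    have h5 : a * b * (b * c) = b ^ 2 * (a * c) := by ring
    rw [h5] at h4
    exact nonneg_of_mul_nonneg_right h4 this

theorem conformal {κ ι : Type*} [Fintype ι] (A : Matrix κ ι ℤ) (B : ℤ)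
    (K : ∀ v : ι → ℝ, A.map (Int.cast : ℤ → ℝ) *ᵥ v = 0 → v ≠ 0 →
      ∃ G : ι → ℤ, G ≠ 0 ∧ A *ᵥ G = 0 ∧ (∀ j, v j = 0 → G j = 0) ∧ ∀ j, |G j| ≤ B)
    (hcast : ∀ G : ι → ℤ, A *ᵥ G = 0 → A.map (Int.cast : ℤ → ℝ) *ᵥ (fun j => (G j : ℝ)) = 0) :
    ∀ (k : ℕ) (v : ι → ℝ), suppCard v < k → A.map (Int.cast : ℤ → ℝ) *ᵥ v = 0 → v ≠ 0 →
      ∃ G : ι → ℤ, G ≠ 0 ∧ A *ᵥ G = 0 ∧ (∀ j, v j = 0 → G j = 0) ∧ (∀ j, |G j| ≤ B) ∧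
        ∀ j, 0 ≤ (G j : ℝ) * v j := by
  intro k
  induction k with
  | zero => intro v h; omega
  | succ k ih =>
    intro v hk hv hv0
    have K' : ∃ G : ι → ℤ, G ≠ 0 ∧ A *ᵥ G = 0 ∧ (∀ j, v j = 0 → G j = 0) ∧ (∀ j, |G j| ≤ B) ∧
        ∃ i, 0 < (G i : ℝ) * v i := by
      obtain ⟨G, h1, h2, h3, h4⟩ := K v hv hv0
      obtain ⟨i, hi⟩ := Function.ne_iff.1 h1
      have hvi : v i ≠ 0 := fun h => hi (h3 i h)
      have hGi : (G i : ℝ) ≠ 0 := by exact_mod_cast hi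
      rcases lt_or_gt_of_ne (mul_ne_zero hGi hvi) with h | h
      · refine ⟨-G, by simpa using h1, by rw [Matrix.mulVec_neg, h2, neg_zero], ?_, ?_, i, ?_⟩
        · intro j hj; simp [h3 j hj]
        · intro j; simpa using h4 j
        · simp; linarith
      · exact ⟨G, h1, h2, h3, h4, i, h⟩
    obtain ⟨G, h1, h2, h3, h4, h5⟩ := K'
    by_cases hall : ∀ j, 0 ≤ (G j : ℝ) * v j
    · exact ⟨G, h1, h2, h3, h4, hall⟩
    push Not at hall
    obtain ⟨j1, hj1⟩ := hall
    obtain ⟨c, hc, hsc, hcf⟩ := shrink v (fun j => (G j : ℝ))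
      (fun j hj => by simp [h3 j hj]) h5
    obtain ⟨G', g1, g2, g3, g4, g5⟩ := ih (v - c • (fun j => (G j : ℝ))) (by omega)
      (by rw [Matrix.mulVec_sub, Matrix.mulVec_smul, hcast G h2, hv]; simp)
      (by
        intro h0
        have := congrFun h0 j1
        simp at this
        have hv1 : v j1 = c * G j1 := by linarith
        rw [hv1] at hj1
        nlinarith [mul_nonneg hc.le (sq_nonneg (G j1 : ℝ))])
    refine ⟨G', g1, g2, ?_, g4, ?_⟩
    · intro j hj
      apply g3
      simp [hj, h3 j hj]
    · intro j
      apply conf_trans_s6 (g5 j) (hcf j)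
      intro h
      rw [g3 j h]; simp

theorem decomp_s6 {κ ι : Type*} [Fintype ι] (A : Matrix κ ι ℤ) (B : ℤ) (hB : 0 ≤ B)
    (K : ∀ v : ι → ℝ, A.map (Int.cast : ℤ → ℝ) *ᵥ v = 0 → v ≠ 0 →
      ∃ G : ι → ℤ, G ≠ 0 ∧ A *ᵥ G = 0 ∧ (∀ j, v j = 0 → G j = 0) ∧ ∀ j, |G j| ≤ B)
    (hcast : ∀ G : ι → ℤ, A *ᵥ G = 0 → A.map (Int.cast : ℤ → ℝ) *ᵥ (fun j => (G j : ℝ)) = 0) :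
    ∀ (k : ℕ) (w : ι → ℝ), suppCard w ≤ k → A.map (Int.cast : ℤ → ℝ) *ᵥ w = 0 →
      (∃ G : ι → ℤ, G ≠ 0 ∧ A *ᵥ G = 0 ∧ ∀ j, 0 ≤ (G j : ℝ) * w j ∧ |(G j : ℝ)| ≤ |w j|) ∨
      ∀ j, |w j| ≤ k * B := by
  intro k
  induction k with
  | zero =>
    intro w hw _
    right
    intro j
    have : w j = 0 := by
      by_contra h
      have h1 : suppCard w = 0 := by omega
      unfold suppCard at h1
      rw [Finset.card_eq_zero] at h1
      have h2 : j ∈ (∅ : Finset ι) := by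
        rw [← h1]; simpa using h
      simp at h2
    simp [this]
  | succ k ih =>
    intro w hk hw
    by_cases hw0 : w = 0
    · right
      intro j
      rw [hw0, Pi.zero_apply, abs_zero]
      have : (0 : ℝ) ≤ B := by exact_mod_cast hB
      positivity
    obtain ⟨G, h1, h2, h3, h4, h5⟩ := conformal A B K hcast _ w (Nat.lt_succ_self _) hw hw0
    obtain ⟨i, hi⟩ := Function.ne_iff.1 h1
    have hpos : 0 < (G i : ℝ) * w i := by
      refine lt_of_le_of_ne (h5 i) (Ne.symm (mul_ne_zero (by exact_mod_cast hi) ?_))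
      intro h; exact hi (h3 i h)
    obtain ⟨c, hc, hsc, hcf⟩ := shrink w (fun j => (G j : ℝ))
      (fun j hj => by simp [h3 j hj]) ⟨i, hpos⟩
    by_cases hc1 : 1 ≤ c
    · left
      refine ⟨G, h1, h2, fun j => ⟨h5 j, ?_⟩⟩
      by_cases hwj : w j = 0
      · simp [hwj, h3 j hwj]
      · have hwp : 0 < |w j| := abs_pos.2 hwj
        have e1 := hcf j
        have e2 : |(G j : ℝ)| * |w j| = G j * w j := by rw [← abs_mul, abs_of_nonneg (h5 j)]
        have e3 : |w j| * |w j| = w j * w j := abs_mul_abs_self _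
        apply le_of_mul_le_mul_right _ hwp
        rw [e2, e3]
        nlinarith [mul_nonneg (sub_nonneg.2 hc1) (h5 j)]
    · push Not at hc1
      rcases ih (w - c • (fun j => (G j : ℝ))) (by omega)
        (by rw [Matrix.mulVec_sub, Matrix.mulVec_smul, hcast G h2, hw]; simp) with
        ⟨G', g1, g2, g3⟩ | hb
      · left
        refine ⟨G', g1, g2, fun j => ⟨?_, ?_⟩⟩
        · apply conf_trans_s6 (g3 j).1 (hcf j)
          intro h
          have h6 := (g3 j).2
          have h7 : (w - c • (fun j => (G j : ℝ))) j = 0 := h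
          rw [h7, abs_zero] at h6
          exact abs_eq_zero.1 (le_antisymm h6 (abs_nonneg _))
        · refine (g3 j).2.trans ?_
          simp only [Pi.sub_apply, Pi.smul_apply, smul_eq_mul]
          by_cases hwj : w j = 0
          · simp [hwj, h3 j hwj]
          · have hwp : 0 < |w j| := abs_pos.2 hwj
            have e1 := hcf j
            apply le_of_mul_le_mul_right _ hwp
            rw [← abs_mul, abs_of_nonneg e1, abs_mul_abs_self]
            nlinarith [mul_nonneg hc.le (h5 j)]
      · right
        intro j
        have e1 := hb j
        simp only [Pi.sub_apply, Pi.smul_apply, smul_eq_mul] at e1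
        have e2 : |c * (G j : ℝ)| ≤ B := by
          rw [abs_mul, abs_of_pos hc]
          have : |(G j : ℝ)| ≤ B := by exact_mod_cast h4 j
          nlinarith [abs_nonneg (G j : ℝ)]
        have e3 : |w j| ≤ |w j - c * G j| + |c * G j| := by
          have := abs_add_le (w j - c * G j) (c * G j)
          simpa using this
        push_cast
        linarith

theorem between {g w : ℝ} (h1 : 0 ≤ g * w) (h2 : |g| ≤ |w|) :
    (0 ≤ g ∧ g ≤ w) ∨ (w ≤ g ∧ g ≤ 0) := by
  rcases le_total 0 w with hw | hw
  · rw [abs_of_nonneg hw] at h2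
    have h3 := abs_le.1 h2
    rcases hw.eq_or_lt with h | h
    · left; constructor <;> linarith
    · left; exact ⟨nonneg_of_mul_nonneg_left h1 h, h3.2⟩
  · rw [abs_of_nonpos hw] at h2
    have h3 := abs_le.1 h2
    rcases hw.eq_or_lt with h | h
    · left; constructor <;> linarith
    · right
      refine ⟨by linarith, ?_⟩
      by_contra hg
      push Not at hg
      nlinarith

theorem prox {κ ι : Type*} [Fintype ι] (A : Matrix κ ι ℤ) (B : ℤ) (hB : 0 ≤ B)
    (K : ∀ v : ι → ℝ, A.map (Int.cast : ℤ → ℝ) *ᵥ v = 0 → v ≠ 0 →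
      ∃ G : ι → ℤ, G ≠ 0 ∧ A *ᵥ G = 0 ∧ (∀ j, v j = 0 → G j = 0) ∧ ∀ j, |G j| ≤ B)
    (r : κ → ℤ) (lo hi cost : ι → ℤ) (zs : ι → ℝ)
    (hzs : A.map (Int.cast : ℤ → ℝ) *ᵥ zs = fun i => (r i : ℝ))
    (hbd : ∀ j, (lo j : ℝ) ≤ zs j ∧ zs j ≤ hi j)
    (hopt : ∀ z : ι → ℝ, A.map (Int.cast : ℤ → ℝ) *ᵥ z = (fun i => (r i : ℝ)) →
      (∀ j, (lo j : ℝ) ≤ z j ∧ z j ≤ hi j) →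
      ∑ j, (cost j : ℝ) * zs j ≤ ∑ j, (cost j : ℝ) * z j)
    (hne : ∃ z : ι → ℤ, A *ᵥ z = r ∧ ∀ j, lo j ≤ z j ∧ z j ≤ hi j) :
    ∃ z : ι → ℤ, (A *ᵥ z = r ∧ ∀ j, lo j ≤ z j ∧ z j ≤ hi j) ∧
      (∀ z' : ι → ℤ, (A *ᵥ z' = r ∧ ∀ j, lo j ≤ z' j ∧ z' j ≤ hi j) →
        ∑ j, cost j * z j ≤ ∑ j, cost j * z' j) ∧
      ∀ j, |zs j - z j| ≤ (Fintype.card ι : ℝ) * B := by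
  classical
  have hc0 : ∀ G : ι → ℤ, A.map (Int.cast : ℤ → ℝ) *ᵥ (fun j => (G j : ℝ)) =
      fun i => (((A *ᵥ G) i : ℤ) : ℝ) := by
    intro G
    ext i
    simp [Matrix.mulVec, dotProduct]
  have hcast : ∀ G : ι → ℤ, A *ᵥ G = 0 →
      A.map (Int.cast : ℤ → ℝ) *ᵥ (fun j => (G j : ℝ)) = 0 := by
    intro G hG
    rw [hc0, hG]
    ext i
    simp
  let P : Set (ι → ℤ) := {z | A *ᵥ z = r ∧ ∀ j, lo j ≤ z j ∧ z j ≤ hi j}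
  have hPf : P.Finite := by
    apply (Set.finite_Icc lo hi).subset
    rintro z ⟨-, hz⟩
    exact ⟨fun j => (hz j).1, fun j => (hz j).2⟩
  obtain ⟨z0, hz0, hmin0⟩ := Set.exists_min_image P (fun z => ∑ j, cost j * z j) hPf hne
  let Q : Set (ι → ℤ) := {z | z ∈ P ∧ ∀ z' ∈ P, ∑ j, cost j * z j ≤ ∑ j, cost j * z' j}
  obtain ⟨z, ⟨hzP, hzo⟩, hmin⟩ := Set.exists_min_image Q (fun z => ∑ j, |zs j - z j|)
    (hPf.subset (fun z hz => hz.1)) ⟨z0, hz0, hmin0⟩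
  refine ⟨z, hzP, hzo, ?_⟩
  have hw : A.map (Int.cast : ℤ → ℝ) *ᵥ (zs - fun j => (z j : ℝ)) = 0 := by
    rw [Matrix.mulVec_sub, hzs, hc0, hzP.1, sub_self]
  rcases decomp_s6 A B hB K hcast (Fintype.card ι) (zs - fun j => (z j : ℝ))
    (Finset.card_le_univ _) hw with ⟨G, h1, h2, h3⟩ | h
  · exfalso
    have hb : ∀ j, ((0 : ℝ) ≤ G j ∧ (G j : ℝ) ≤ zs j - z j) ∨
        (zs j - z j ≤ G j ∧ (G j : ℝ) ≤ 0) := fun j => between (h3 j).1 (h3 j).2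
    have hzG : z + G ∈ P := by
      refine ⟨by rw [Matrix.mulVec_add, h2, hzP.1, add_zero], fun j => ?_⟩
      have b1 := hzP.2 j
      have b2 := hbd j
      have b3 : (lo j : ℝ) ≤ z j := by exact_mod_cast b1.1
      have b4 : (z j : ℝ) ≤ hi j := by exact_mod_cast b1.2
      have c1 : (lo j : ℝ) ≤ z j + G j ∧ (z j + G j : ℝ) ≤ hi j := by
        rcases hb j with h | h <;> constructor <;> linarith
      exact_mod_cast c1
    have hcG : ∑ j, (cost j : ℝ) * G j ≤ 0 := by
      have := hopt (zs - fun j => (G j : ℝ)) (by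
        rw [Matrix.mulVec_sub, hzs, hcast G h2, sub_zero]) (fun j => by
        have b1 := hzP.2 j
        have b2 := hbd j
        have b3 : (lo j : ℝ) ≤ z j := by exact_mod_cast b1.1
        have b4 : (z j : ℝ) ≤ hi j := by exact_mod_cast b1.2
        simp only [Pi.sub_apply]
        rcases hb j with h | h <;> constructor <;> linarith)
      simp only [Pi.sub_apply, mul_sub, Finset.sum_sub_distrib] at this
      linarith
    have hcG' : ∑ j, cost j * G j ≤ 0 := by exact_mod_cast hcG
    have hQ : z + G ∈ Q := by
      refine ⟨hzG, fun z' hz' => ?_⟩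
      have := hzo z' hz'
      simp only [Pi.add_apply, mul_add, Finset.sum_add_distrib]
      linarith
    have hm := hmin _ hQ
    obtain ⟨i, hi⟩ := Function.ne_iff.1 h1
    have hGi : (G i : ℝ) ≠ 0 := by exact_mod_cast hi
    have hlt : ∑ j, |zs j - ((z + G) j : ℤ)| < ∑ j, |zs j - z j| := by
      have key : ∀ j, |zs j - ((z + G) j : ℤ)| = |zs j - z j| - |(G j : ℝ)| := by
        intro j
        simp only [Pi.add_apply, Int.cast_add]
        rcases hb j with h | h
        · rw [abs_of_nonneg (by linarith), abs_of_nonneg (by linarith : 0 ≤ zs j - z j),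
            abs_of_nonneg h.1]
          ring
        · rw [abs_of_nonpos (by linarith), abs_of_nonpos (by linarith : zs j - z j ≤ 0),
            abs_of_nonpos h.2]
          ring
      apply Finset.sum_lt_sum
      · intro j _
        rw [key j]
        linarith [abs_nonneg (G j : ℝ)]
      · refine ⟨i, Finset.mem_univ _, ?_⟩
        rw [key i]
        linarith [abs_pos.2 hGi]
    exact absurd hm (not_le.2 hlt)
  · intro j
    exact h j

theorem statement6 {h p m n : ℕ} (Δ : ℕ) (hΔ : 1 ≤ Δ)
    (C : Matrix (Fin h) (Fin p) ℤ) (W : Matrix (Fin h) (Fin n) ℤ)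
    (T : Matrix (Fin m) (Fin p) ℤ) (M : Matrix (Fin m) (Fin n) ℤ)
    (hC : ∀ i j, |C i j| ≤ (Δ : ℤ)) (hW : ∀ i j, |W i j| ≤ (Δ : ℤ))
    (hT : ∀ i j, |T i j| ≤ (Δ : ℤ)) (hM : ∀ j, (∑ i, |M i j|) ≤ 2)
    (a : Fin p → ℤ) (c : Fin n → ℤ) (d : Fin h → ℤ) (b : Fin m → ℤ)
    (e g : Fin p → ℤ) (l u : Fin n → ℤ)
    (PI : Set ((Fin p → ℤ) × (Fin n → ℤ)))
    (hPI : PI = {q : (Fin p → ℤ) × (Fin n → ℤ) |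
      C.mulVec q.1 + W.mulVec q.2 = d ∧ T.mulVec q.1 + M.mulVec q.2 = b ∧
      (∀ i, e i ≤ q.1 i ∧ q.1 i ≤ g i) ∧ (∀ j, l j ≤ q.2 j ∧ q.2 j ≤ u j)})
    (PR : Set ((Fin p → ℝ) × (Fin n → ℝ)))
    (hPR : PR = {q : (Fin p → ℝ) × (Fin n → ℝ) |
      (C.map (Int.cast : ℤ → ℝ)).mulVec q.1 + (W.map (Int.cast : ℤ → ℝ)).mulVec q.2
        = (fun i => (d i : ℝ)) ∧
      (T.map (Int.cast : ℤ → ℝ)).mulVec q.1 + (M.map (Int.cast : ℤ → ℝ)).mulVec q.2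
        = (fun i => (b i : ℝ)) ∧
      (∀ i, (e i : ℝ) ≤ q.1 i ∧ q.1 i ≤ (g i : ℝ)) ∧
      (∀ j, (l j : ℝ) ≤ q.2 j ∧ q.2 j ≤ (u j : ℝ))})
    (ystar : Fin p → ℝ) (xstar : Fin n → ℝ)
    (hstar : (ystar, xstar) ∈ PR)
    (hopt : ∀ q ∈ PR,
      (fun j => (a j : ℝ)) ⬝ᵥ ystar + (fun j => (c j : ℝ)) ⬝ᵥ xstar ≤
      (fun j => (a j : ℝ)) ⬝ᵥ q.1 + (fun j => (c j : ℝ)) ⬝ᵥ q.2)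
    (hne : PI.Nonempty) :
    ∃ yx ∈ PI,
      (∀ q ∈ PI, a ⬝ᵥ yx.1 + c ⬝ᵥ yx.2 ≤ a ⬝ᵥ q.1 + c ⬝ᵥ q.2) ∧
      (∀ i, |ystar i - (yx.1 i : ℝ)| ≤
        ((p + n : ℕ) : ℝ) * ((Δ : ℝ) * ((m + h + 1 : ℕ) : ℝ)) ^ (p + h)
          * 2 ^ (2 * p + 3 * h + 3)) ∧
      (∀ j, |xstar j - (yx.2 j : ℝ)| ≤
        ((p + n : ℕ) : ℝ) * ((Δ : ℝ) * ((m + h + 1 : ℕ) : ℝ)) ^ (p + h)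
          * 2 ^ (2 * p + 3 * h + 3)) := by
  subst hPI hPR
  let A : Matrix (Fin h ⊕ Fin m) (Fin p ⊕ Fin n) ℤ := Matrix.fromBlocks C W T M
  have hA : ∀ i j, (i.isLeft = true ∨ j.isLeft = true) → |A i j| ≤ (Δ : ℤ) := by
    rintro (i | i) (j | j) hij
    · exact hC i j
    · exact hW i j
    · exact hT i j
    · simp at hij
  have hmap : A.map (Int.cast : ℤ → ℝ) = Matrix.fromBlocks (C.map (Int.cast : ℤ → ℝ))
      (W.map (Int.cast : ℤ → ℝ)) (T.map (Int.cast : ℤ → ℝ)) (M.map (Int.cast : ℤ → ℝ)) :=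
    Matrix.fromBlocks_map _ _ _ _ _
  have hr : (fun i => ((Sum.elim d b i : ℤ) : ℝ)) =
      Sum.elim (fun i => (d i : ℝ)) (fun i => (b i : ℝ)) := by
    ext i; cases i <;> rfl
  have hB : (0 : ℤ) ≤ ((Δ * (m + h + 1) : ℕ) : ℤ) ^ (p + h) * 2 ^ (p + h + 2) := by positivity
  obtain ⟨hs1, hs2, hs3, hs4⟩ := hstar
  obtain ⟨q0, hq1, hq2, hq3, hq4⟩ := hne
  obtain ⟨z, ⟨hz1, hz2⟩, hz3, hz4⟩ := prox A _ hB (key_circuit Δ hΔ A hA hM) (Sum.elim d b)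
    (Sum.elim e l) (Sum.elim g u) (Sum.elim a c) (Sum.elim ystar xstar)
    (by
      rw [hmap, hr, Matrix.fromBlocks_mulVec]
      simp only [Sum.elim_comp_inl, Sum.elim_comp_inr]
      exact congrArg₂ _ hs1 hs2)
    (by rintro (j | j); exacts [hs3 j, hs4 j])
    (by
      intro z hz hzb
      rw [hmap, hr, Matrix.fromBlocks_mulVec] at hz
      have := hopt (z ∘ Sum.inl, z ∘ Sum.inr) ⟨funext fun i => congrFun hz (Sum.inl i),
        funext fun i => congrFun hz (Sum.inr i), fun i => hzb (Sum.inl i),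
        fun i => hzb (Sum.inr i)⟩
      simpa [dotProduct, Fintype.sum_sum_type] using this)
    ⟨Sum.elim q0.1 q0.2, by
      simp only [A]
      rw [Matrix.fromBlocks_mulVec]
      simp only [Sum.elim_comp_inl, Sum.elim_comp_inr]
      exact congrArg₂ _ hq1 hq2, by rintro (j | j); exacts [hq3 j, hq4 j]⟩
  simp only [A] at hz1
  rw [Matrix.fromBlocks_mulVec] at hz1
  have hbound : ((Fintype.card (Fin p ⊕ Fin n) : ℕ) : ℝ) *
      ((((Δ * (m + h + 1) : ℕ) : ℤ) ^ (p + h) * 2 ^ (p + h + 2) : ℤ) : ℝ) ≤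
      ((p + n : ℕ) : ℝ) * ((Δ : ℝ) * ((m + h + 1 : ℕ) : ℝ)) ^ (p + h)
          * 2 ^ (2 * p + 3 * h + 3) := by
    rw [Fintype.card_sum, Fintype.card_fin, Fintype.card_fin]
    have : (2 : ℝ) ^ (p + h + 2) ≤ 2 ^ (2 * p + 3 * h + 3) :=
      pow_le_pow_right₀ (by norm_num) (by omega)
    rw [mul_assoc]
    push_cast
    gcongr
  refine ⟨(z ∘ Sum.inl, z ∘ Sum.inr), ⟨funext fun i => congrFun hz1 (Sum.inl i),
    funext fun i => congrFun hz1 (Sum.inr i), fun i => hz2 (Sum.inl i),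
    fun i => hz2 (Sum.inr i)⟩, ?_, fun i => (hz4 (Sum.inl i)).trans hbound,
    fun i => (hz4 (Sum.inr i)).trans hbound⟩
  rintro q ⟨h1, h2, h3, h4⟩
  have := hz3 (Sum.elim q.1 q.2) ⟨by
      simp only [A]
      rw [Matrix.fromBlocks_mulVec]
      simp only [Sum.elim_comp_inl, Sum.elim_comp_inr]
      exact congrArg₂ _ h1 h2, by rintro (j | j); exacts [h3 j, h4 j]⟩
  simpa [dotProduct, Fintype.sum_sum_type] using this
end
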